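/- arXiv:1812.06022 — 4 statements merged into one kernel-verified Lean document; each statement's English description precedes it below -/
import Mathlib

section
/- Let X be a two-dimensional real normed space whose norm is not induced by an inner product, and let G be a finite simple graph with at least one vertex. Then G has an infinitesimally rigid well-positioned placement in X — i.e. a well-positioned placement p whose rigidity operator R(p) has kernel exactly the constant maps — if and only if G contains a spanning subgraph H (with V(H) = V(G)) that is (2,2)-tight. -/
namespace NormedPlane

open Filter Topology

section Support

variable {X : Type*} [NormedAddCommGroup X] [NormedSpace ℝ X]

/-- `φ` is a norming functional of `x`: it lies in the subdifferential of the norm at `x`. -/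
def IsSupport (x : X) (φ : X →L[ℝ] ℝ) : Prop := ‖φ‖ ≤ 1 ∧ φ x = ‖x‖

lemma IsSupport.apply_le {x : X} {φ : X →L[ℝ] ℝ} (h : IsSupport x φ) (y : X) : φ y ≤ ‖y‖ :=
  (le_abs_self _).trans (by simpa using φ.le_of_opNorm_le h.1 y)

lemma IsSupport.neg {x : X} {φ : X →L[ℝ] ℝ} (h : IsSupport x φ) : IsSupport (-x) (-φ) :=
  ⟨by simpa using h.1, by simpa using h.2⟩

lemma IsSupport.smul {x : X} {φ : X →L[ℝ] ℝ} (h : IsSupport x φ) {c : ℝ} (hc : 0 ≤ c) :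
    IsSupport (c • x) φ :=
  ⟨h.1, by rw [map_smul, h.2, norm_smul, Real.norm_of_nonneg hc, smul_eq_mul]⟩

lemma IsSupport.of_smul {x : X} {φ : X →L[ℝ] ℝ} {c : ℝ} (h : IsSupport (c • x) φ) (hc : 0 < c) :
    IsSupport x φ := by
  simpa [smul_smul, hc.ne'] using h.smul (inv_nonneg.2 hc.le)

lemma IsSupport.ne_zero {x : X} {φ : X →L[ℝ] ℝ} (h : IsSupport x φ) (hx : x ≠ 0) : φ ≠ 0 := by
  rintro rfl
  exact hx (by simpa using h.2.symm)

lemma exists_isSupport (x : X) : ∃ φ, IsSupport x φ :=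
  exists_dual_vector'' ℝ x

lemma tendsto_clm_apply {ι : Type*} {l : Filter ι} {x : ι → X}
    {φ : ι → X →L[ℝ] ℝ} {x₀ : X} {φ₀ : X →L[ℝ] ℝ} (hφ : Tendsto φ l (𝓝 φ₀))
    (hx : Tendsto x l (𝓝 x₀)) : Tendsto (fun i => φ i (x i)) l (𝓝 (φ₀ x₀)) :=
  ((isBoundedBilinearMap_apply (𝕜 := ℝ) (E := X) (F := ℝ)).continuous.tendsto (φ₀, x₀)).comp
    (hφ.prodMk_nhds hx)

lemma isSupport_of_tendsto {ι : Type*} {l : Filter ι} [l.NeBot] {x : ι → X}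
    {φ : ι → X →L[ℝ] ℝ} {x₀ : X} {φ₀ : X →L[ℝ] ℝ} (hx : Tendsto x l (𝓝 x₀))
    (hφ : Tendsto φ l (𝓝 φ₀)) (h : ∀ᶠ i in l, IsSupport (x i) (φ i)) : IsSupport x₀ φ₀ := by
  refine ⟨le_of_tendsto hφ.norm (h.mono fun i hi => hi.1), ?_⟩
  exact tendsto_nhds_unique (tendsto_clm_apply hφ hx)
    (hx.norm.congr' (h.mono fun i hi => hi.2.symm))

lemma ne_zero_of_differentiableAt_norm [Nontrivial X] {x : X}
    (h : DifferentiableAt ℝ (fun y : X => ‖y‖) x) : x ≠ 0 := by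
  rintro rfl
  exact not_differentiableAt_norm_zero X h

lemma IsSupport.eq_fderiv {x : X} {φ : X →L[ℝ] ℝ} (h : IsSupport x φ)
    (hx : DifferentiableAt ℝ (fun y : X => ‖y‖) x) : φ = fderiv ℝ (fun y : X => ‖y‖) x := by
  have hmin : IsLocalMin (fun y : X => ‖y‖ - φ y) x :=
    Eventually.of_forall fun y => by
      simp only [h.2, sub_self, sub_nonneg]
      exact h.apply_le y
  have h1 := hmin.fderiv_eq_zero
  rw [fderiv_fun_sub hx φ.differentiableAt, φ.fderiv] at h1
  exact (sub_eq_zero.1 h1).symm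

lemma isSupport_fderiv {x : X} (hx : DifferentiableAt ℝ (fun y : X => ‖y‖) x) :
    IsSupport x (fderiv ℝ (fun y : X => ‖y‖) x) := by
  obtain ⟨φ, hφ⟩ := exists_isSupport x
  exact hφ.eq_fderiv hx ▸ hφ

lemma IsSupport.apply_eq_zero_of_smul {d : X} (hd : DifferentiableAt ℝ (fun y : X => ‖y‖) d)
    {c : ℝ} (hc : c ≠ 0) {ψ : X →L[ℝ] ℝ} (h : IsSupport (c • d) ψ) {k : X} (hk : ψ k = 0) :
    fderiv ℝ (fun y : X => ‖y‖) d k = 0 := by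
  rcases lt_or_gt_of_ne hc with hc | hc
  · have h1 : IsSupport ((-c) • d) (-ψ) := by simpa using h.neg
    rw [← (h1.of_smul (neg_pos.2 hc)).eq_fderiv hd]
    simpa using hk
  · rwa [← (h.of_smul hc).eq_fderiv hd]

end Support

section Stiff

variable {X : Type*} [NormedAddCommGroup X] [NormedSpace ℝ X] {V : Type*}

/-- With edge functionals `Φ`, every flex of the edges of `H` inside `S` is constant on `S`. -/
def Stiff (S : Finset V) (H : SimpleGraph V) (Φ : V → V → X →L[ℝ] ℝ) : Prop :=
  ∀ u : V → X, (∀ v ∈ S, ∀ w ∈ S, H.Adj v w → Φ v w (u v - u w) = 0) →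
    ∀ v ∈ S, ∀ w ∈ S, u v = u w

/-- Stiffness for every choice of norming functionals of the edge vectors `z`. -/
def RobustlyStiff (S : Finset V) (H : SimpleGraph V) (z : V → V → X) : Prop :=
  ∀ Φ : V → V → X →L[ℝ] ℝ,
    (∀ v ∈ S, ∀ w ∈ S, H.Adj v w → IsSupport (z v w) (Φ v w)) → Stiff S H Φ

variable [Fintype V]

lemma exists_normalized_flex {S : Finset V} {H : SimpleGraph V} {z : V → V → X}
    (h : ¬ RobustlyStiff S H z) (v₀ : V) :
    ∃ Φ : V → V → X →L[ℝ] ℝ, ∃ u : V → X, ‖Φ‖ ≤ 1 ∧ ‖u‖ = 1 ∧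
      (∀ v ∈ S, ∀ w ∈ S, H.Adj v w → IsSupport (z v w) (Φ v w) ∧ Φ v w (u v - u w) = 0) ∧
      u v₀ = 0 ∧ ∀ v ∉ S, u v = 0 := by
  classical
  simp only [RobustlyStiff, Stiff] at h
  push Not at h
  obtain ⟨Φ, hΦ, u, hu, a, ha, b, hb, hab⟩ := h
  set u' : V → X := fun v => if v ∈ S then u v - u v₀ else 0 with hu'
  have hne : u' ≠ 0 := by
    intro h0
    apply hab
    have h1 := congrFun h0 a
    have h2 := congrFun h0 b
    simp only [hu', ha, hb, if_true, Pi.zero_apply, sub_eq_zero] at h1 h2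
    rw [h1, h2]
  refine ⟨fun v w => if v ∈ S ∧ w ∈ S ∧ H.Adj v w then Φ v w else 0, ‖u'‖⁻¹ • u', ?_, ?_, ?_, ?_, ?_⟩
  · refine (pi_norm_le_iff_of_nonneg zero_le_one).2 fun v =>
      (pi_norm_le_iff_of_nonneg zero_le_one).2 fun w => ?_
    split_ifs with h
    · exact (hΦ v h.1 w h.2.1 h.2.2).1
    · simp
  · exact norm_smul_inv_norm (𝕜 := ℝ) hne
  · intro v hv w hw hvw
    simp only [hv, hw, hvw, and_self, if_true]
    refine ⟨hΦ v hv w hw hvw, ?_⟩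
    have := hu v hv w hw hvw
    simp only [hu', Pi.smul_apply, hv, hw, if_true, ← smul_sub, map_smul, sub_sub_sub_cancel_right,
      this, smul_zero]
  · simp [hu']
  · intro v hv
    simp [hu', hv]

variable [FiniteDimensional ℝ X]

/-- Robust stiffness persists under convergence of the edge directions. -/
lemma RobustlyStiff.eventually {ι : Type*} {l : Filter ι} {S : Finset V} {H : SimpleGraph V}
    {z : V → V → X} (hz : RobustlyStiff S H z) {Z : ι → V → V → X}
    (h : ∀ v ∈ S, ∀ w ∈ S, H.Adj v w → ∃ c : ι → ℝ, (∀ᶠ i in l, 0 < c i) ∧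
      Tendsto (fun i => c i • Z i v w) l (𝓝 (z v w))) :
    ∀ᶠ i in l, RobustlyStiff S H (Z i) := by
  classical
  rcases S.eq_empty_or_nonempty with rfl | ⟨v₀, hv₀⟩
  · exact Eventually.of_forall fun i Φ _ u _ v hv => by simp at hv
  by_contra hcon
  have hfreq : ∃ᶠ i in l, ¬ RobustlyStiff S H (Z i) := not_eventually.1 hcon
  rw [frequently_iff_neBot] at hfreq
  set U := Ultrafilter.of (l ⊓ 𝓟 {i | ¬ RobustlyStiff S H (Z i)}) with hU
  have hUle : (U : Filter ι) ≤ l ⊓ 𝓟 {i | ¬ RobustlyStiff S H (Z i)} := Ultrafilter.of_le _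
  have hUl : (U : Filter ι) ≤ l := hUle.trans inf_le_left
  have hbad : ∀ᶠ i in (U : Filter ι), ¬ RobustlyStiff S H (Z i) :=
    (hUle.trans inf_le_right) (mem_principal_self _)
  have hex : ∀ i, ∃ q : (V → V → X →L[ℝ] ℝ) × (V → X), ¬ RobustlyStiff S H (Z i) →
      (‖q.1‖ ≤ 1 ∧ ‖q.2‖ = 1 ∧
      (∀ v ∈ S, ∀ w ∈ S, H.Adj v w →
        IsSupport (Z i v w) (q.1 v w) ∧ q.1 v w (q.2 v - q.2 w) = 0) ∧
      q.2 v₀ = 0 ∧ ∀ v ∉ S, q.2 v = 0) := by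
    intro i
    by_cases hi : RobustlyStiff S H (Z i)
    · exact ⟨0, fun h => absurd hi h⟩
    · obtain ⟨Φ, u, h⟩ := exists_normalized_flex hi v₀
      exact ⟨(Φ, u), fun _ => h⟩
  choose q hq using hex
  have : ProperSpace X := FiniteDimensional.proper ℝ X
  have hK : IsCompact (Metric.closedBall (0 : V → V → X →L[ℝ] ℝ) 1 ×ˢ
      Metric.sphere (0 : V → X) 1) := (isCompact_closedBall _ _).prod (isCompact_sphere _ _)
  obtain ⟨⟨Φ, u⟩, hmem, hlim⟩ := hK.ultrafilter_le_nhds (U.map q) (by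
    rw [le_principal_iff]
    refine Ultrafilter.mem_map.2 (Filter.mem_of_superset hbad fun i hi => ?_)
    obtain ⟨h1, h2, -⟩ := hq i hi
    exact ⟨by simpa using h1, by simpa using h2⟩)
  have hq1 : Tendsto q U (𝓝 (Φ, u)) := hlim
  have hΦ : Tendsto (fun i => (q i).1) U (𝓝 Φ) := (continuous_fst.tendsto _).comp hq1
  have hu : Tendsto (fun i => (q i).2) U (𝓝 u) := (continuous_snd.tendsto _).comp hq1
  have hΦ' : ∀ v w, Tendsto (fun i => (q i).1 v w) U (𝓝 (Φ v w)) := fun v w =>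
    (tendsto_pi_nhds.1 ((tendsto_pi_nhds.1 hΦ) v)) w
  have hu' : ∀ v, Tendsto (fun i => (q i).2 v) U (𝓝 (u v)) := tendsto_pi_nhds.1 hu
  have hS := hz Φ (fun v hv w hw hvw => by
    obtain ⟨c, hc, hcz⟩ := h v hv w hw hvw
    refine isSupport_of_tendsto (hcz.mono_left hUl) (hΦ' v w) ?_
    filter_upwards [hbad, hUl hc] with i hi hci
    exact ((hq i hi).2.2.1 v hv w hw hvw).1.smul (le_of_lt hci)) u (fun v hv w hw hvw => by
    refine tendsto_nhds_unique (tendsto_clm_apply (hΦ' v w) ((hu' v).sub (hu' w)))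
      (tendsto_const_nhds.congr' ?_)
    filter_upwards [hbad] with i hi
    exact ((hq i hi).2.2.1 v hv w hw hvw).2.symm)
  have h0 : u v₀ = 0 := tendsto_nhds_unique (hu' v₀) (tendsto_const_nhds.congr' (by
    filter_upwards [hbad] with i hi
    exact (hq i hi).2.2.2.1.symm))
  have : u = 0 := by
    funext v
    by_cases hv : v ∈ S
    · rw [hS v hv v₀ hv₀, h0]; rfl
    · exact tendsto_nhds_unique (hu' v) (tendsto_const_nhds.congr' (by
        filter_upwards [hbad] with i hi
        exact ((hq i hi).2.2.2.2 v hv).symm))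
  have h1 : ‖u‖ = 1 := by simpa using hmem.2
  simp [this] at h1

lemma RobustlyStiff.eventually_nhds {S : Finset V} {H : SimpleGraph V} {p : V → X}
    (hp : RobustlyStiff S H fun v w => p v - p w) :
    ∀ᶠ p' in 𝓝 p, RobustlyStiff S H fun v w => p' v - p' w := by
  refine hp.eventually fun v _ w _ _ => ⟨fun _ => 1, by simp, ?_⟩
  have h : Continuous fun q : V → X => q v - q w := by fun_prop
  simpa using h.tendsto p

/-- Placements for which all the edge directions are smooth points of the norm are dense. -/
lemma dense_wellPositioned :
    Dense {p : V → X | ∀ v w, v ≠ w → DifferentiableAt ℝ (fun x : X => ‖x‖) (p v - p w)} := by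
  classical
  borelize X
  have : ProperSpace X := FiniteDimensional.proper ℝ X
  have : SecondCountableTopology X := secondCountable_of_proper
  let K := (Module.finBasis ℝ X)
  let μ : MeasureTheory.Measure X := K.addHaar
  let ν : MeasureTheory.Measure (V → X) := (Module.finBasis ℝ (V → X)).addHaar
  refine MeasureTheory.Measure.dense_of_ae (μ := ν) ?_
  rw [MeasureTheory.ae_all_iff]; intro v
  rw [MeasureTheory.ae_all_iff]; intro w
  by_cases hvw : v = w
  · simp [hvw]
  let L : (V → X) →ₗ[ℝ] X := LinearMap.proj (R := ℝ) (φ := fun _ => X) v - LinearMap.proj w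
  have hL : Function.Surjective L := fun x =>
    ⟨Pi.single v x, by simp [L, Ne.symm hvw]⟩
  have := (MeasureTheory.ae_comp_linearMap_mem_iff L ν μ hL
    (measurableSet_of_differentiableAt ℝ (fun x : X => ‖x‖))).2
    ((lipschitzWith_one_norm (E := X)).ae_differentiableAt)
  filter_upwards [this] with p hp _
  simpa [L] using hp

lemma RobustlyStiff.exists_wellPositioned {S : Finset V} {H : SimpleGraph V} {p : V → X}
    (hp : RobustlyStiff S H fun v w => p v - p w) :
    ∃ p' : V → X, (∀ v w, v ≠ w → DifferentiableAt ℝ (fun x : X => ‖x‖) (p' v - p' w)) ∧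
      RobustlyStiff S H fun v w => p' v - p' w := by
  obtain ⟨p', h1, h2⟩ := mem_closure_iff_frequently.1 (dense_wellPositioned p)
    |>.and_eventually hp.eventually_nhds |>.exists
  exact ⟨p', h1, h2⟩

end Stiff

section Extension

variable {X : Type*} [NormedAddCommGroup X] [NormedSpace ℝ X] {V : Type*}

/-- `H` has a robustly stiff placement on `S`. -/
def HasStiffPlacement (X : Type*) [NormedAddCommGroup X] [NormedSpace ℝ X]
    (S : Finset V) (H : SimpleGraph V) : Prop :=
  ∃ p : V → X, RobustlyStiff S H fun v w => p v - p w

lemma finiteDimensional_of_finrank_eq_two (hdim : Module.finrank ℝ X = 2) :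
    FiniteDimensional ℝ X :=
  Module.finite_of_finrank_pos (by omega)

lemma exists_smul_of_apply_eq_zero (hdim : Module.finrank ℝ X = 2) {φ : X →L[ℝ] ℝ} (hφ : φ ≠ 0)
    {z k : X} (hz : z ≠ 0) (hφz : φ z = 0) (hφk : φ k = 0) : ∃ c : ℝ, k = c • z := by
  have := finiteDimensional_of_finrank_eq_two hdim
  have hs : LinearMap.range φ.toLinearMap = ⊤ :=
    LinearMap.range_eq_top.2 (LinearMap.surjective_of_ne_zero
      fun h => hφ (ContinuousLinearMap.ext fun x => LinearMap.congr_fun h x))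
  have h1 := φ.toLinearMap.finrank_range_add_finrank_ker
  rw [hs, finrank_top, Module.finrank_self, hdim] at h1
  have h2 : Module.finrank ℝ (LinearMap.ker φ.toLinearMap) = 1 := by omega
  obtain ⟨c, hc⟩ := (finrank_eq_one_iff_of_nonzero'
    (⟨z, hφz⟩ : LinearMap.ker φ.toLinearMap)
    fun h => hz (congrArg Subtype.val h)).1 h2 ⟨k, hφk⟩
  exact ⟨c, (congrArg Subtype.val hc).symm⟩

lemma exists_ne_zero_apply_eq_zero (hdim : Module.finrank ℝ X = 2) (φ : X →L[ℝ] ℝ) :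
    ∃ z : X, z ≠ 0 ∧ φ z = 0 := by
  have := finiteDimensional_of_finrank_eq_two hdim
  have h : LinearMap.ker φ.toLinearMap ≠ ⊥ :=
    LinearMap.ker_ne_bot_of_finrank_lt (by rw [hdim, Module.finrank_self]; norm_num)
  obtain ⟨z, hz, hz0⟩ := (Submodule.ne_bot_iff _).1 h
  exact ⟨z, hz0, hz⟩

lemma nontrivial_of_finrank_eq_two (hdim : Module.finrank ℝ X = 2) : Nontrivial X :=
  Module.nontrivial_of_finrank_pos (R := ℝ) (by omega)

/-- The graph obtained from `H` by contracting `T` to the vertex `k`. -/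
def contract [DecidableEq V] (H : SimpleGraph V) (T : Finset V) (k : V) : SimpleGraph V where
  Adj a b := a ≠ b ∧ ∃ a' b', (if a' ∈ T then k else a') = a ∧ (if b' ∈ T then k else b') = b ∧
    H.Adj a' b'
  symm := ⟨fun _ _ ⟨h, a', b', ha, hb, hab⟩ => ⟨h.symm, b', a', hb, ha, hab.symm⟩⟩
  loopless := ⟨fun _ h => h.1 rfl⟩

variable [Fintype V] [DecidableEq V]

/-- Adding a vertex joined to two vertices of a stiff part. -/
lemma HasStiffPlacement.insert (hdim : Module.finrank ℝ X = 2) {T : Finset V} {H : SimpleGraph V}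
    (h : HasStiffPlacement X T H) {w x y : V} (hw : w ∉ T) (hx : x ∈ T) (hy : y ∈ T)
    (hxy : x ≠ y) (hwx : H.Adj w x) (hwy : H.Adj w y) :
    HasStiffPlacement X (insert w T) H := by
  have := finiteDimensional_of_finrank_eq_two hdim
  have := nontrivial_of_finrank_eq_two hdim
  obtain ⟨p₀, hp₀⟩ := h
  obtain ⟨p, hd, hp⟩ := hp₀.exists_wellPositioned
  have hd := hd x y hxy
  set d := p x - p y
  set φ := fderiv ℝ (fun x : X => ‖x‖) d with hφdef
  have hφ : IsSupport d φ := isSupport_fderiv hd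
  have hφ0 : φ ≠ 0 := hφ.ne_zero (ne_zero_of_differentiableAt_norm hd)
  obtain ⟨z, hz, hφz⟩ := exists_ne_zero_apply_eq_zero hdim φ
  have hne : ∀ a ∈ T, a ≠ w := fun a ha h => hw (h ▸ ha)
  let Z : V → V → X := fun a b => if a = w ∧ b = x then z else if a = x ∧ b = w then -z else
    Function.update p w (p x) a - Function.update p w (p x) b
  have hZ : RobustlyStiff (Insert.insert w T) H Z := by
    intro Φ hΦ u hu
    have hT : ∀ a ∈ T, ∀ b ∈ T, u a = u b := by
      refine hp Φ (fun a ha b hb hab => ?_) u fun a ha b hb hab =>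
        hu a (Finset.mem_insert_of_mem ha) b (Finset.mem_insert_of_mem hb) hab
      have := hΦ a (Finset.mem_insert_of_mem ha) b (Finset.mem_insert_of_mem hb) hab
      simpa [Z, hne a ha, hne b hb] using this
    have hwm := Finset.mem_insert_self w T
    have h1 := hΦ w hwm x (Finset.mem_insert_of_mem hx) hwx
    have h2 := hΦ w hwm y (Finset.mem_insert_of_mem hy) hwy
    have h3 := hu w hwm x (Finset.mem_insert_of_mem hx) hwx
    have h4 := hu w hwm y (Finset.mem_insert_of_mem hy) hwy
    simp only [Z, true_and, if_true] at h1
    have h2 : IsSupport d (Φ w y) := by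
      simpa [Z, hxy.symm, (hne x hx).symm, hne y hy] using h2
    rw [h2.eq_fderiv hd, hT y hy x hx] at h4
    obtain ⟨c, hc⟩ := exists_smul_of_apply_eq_zero hdim hφ0 hz hφz h4
    rw [hc, map_smul, h1.2, smul_eq_mul, mul_eq_zero, norm_eq_zero, or_iff_left hz] at h3
    have hwx : u w = u x := by rwa [h3, zero_smul, sub_eq_zero] at hc
    have key : ∀ a ∈ Insert.insert w T, u a = u x := by
      intro a ha
      rcases Finset.mem_insert.1 ha with rfl | ha
      · exact hwx
      · exact hT a ha x hx
    exact fun a ha b hb => (key a ha).trans (key b hb).symm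
  have hev := hZ.eventually (l := 𝓝[>] (0 : ℝ))
    (Z := fun t a b => Function.update p w (p x + t • z) a - Function.update p w (p x + t • z) b)
    (fun a ha b hb hab => ?_)
  · obtain ⟨t, ht⟩ := hev.exists
    exact ⟨_, ht⟩
  have hpos : ∀ᶠ t : ℝ in 𝓝[>] (0 : ℝ), 0 < t := self_mem_nhdsWithin
  have hinv : ∀ᶠ t : ℝ in 𝓝[>] (0 : ℝ), 0 < t⁻¹ := hpos.mono fun t ht => inv_pos.2 ht
  by_cases h1 : a = w ∧ b = x
  · refine ⟨fun t => t⁻¹, hinv, tendsto_const_nhds.congr' ?_⟩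
    filter_upwards [hpos] with t ht
    obtain ⟨rfl, rfl⟩ := h1
    simp [Z, smul_smul, ht.ne', hne b hx]
  by_cases h2 : a = x ∧ b = w
  · refine ⟨fun t => t⁻¹, hinv, tendsto_const_nhds.congr' ?_⟩
    filter_upwards [hpos] with t ht
    obtain ⟨rfl, rfl⟩ := h2
    simp [Z, smul_smul, ht.ne', hne a hx]
  · refine ⟨fun _ => 1, by simp, ?_⟩
    have hc : Continuous fun t : ℝ =>
        Function.update p w (p x + t • z) a - Function.update p w (p x + t • z) b := by
      fun_prop
    have := (hc.tendsto 0).mono_left (nhdsWithin_le_nhds (s := Set.Ioi 0))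
    simpa [Z, h1, h2] using this

/-- Replacing the edge `xy` by a vertex joined to `x`, `y` and `z`. -/
lemma HasStiffPlacement.insert_of_edge (hdim : Module.finrank ℝ X = 2) {T : Finset V}
    {H : SimpleGraph V} {v x y z : V}
    (h : HasStiffPlacement X T (H ⊔ SimpleGraph.edge x y)) (hv : v ∉ T) (hx : x ∈ T)
    (hy : y ∈ T) (hz : z ∈ T) (hxy : x ≠ y) (hzx : z ≠ x) (hzy : z ≠ y)
    (hvx : H.Adj v x) (hvy : H.Adj v y) (hvz : H.Adj v z) :
    HasStiffPlacement X (Insert.insert v T) H := by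
  have := finiteDimensional_of_finrank_eq_two hdim
  have := nontrivial_of_finrank_eq_two hdim
  obtain ⟨p₀, hp₀⟩ := h
  obtain ⟨p, hd, hp⟩ := hp₀.exists_wellPositioned
  have hd := hd x y hxy
  set d := p x - p y with hddef
  set φ := fderiv ℝ (fun x : X => ‖x‖) d with hφdef
  have hφ : IsSupport d φ := isSupport_fderiv hd
  have hd0 := ne_zero_of_differentiableAt_norm hd
  have hφ0 : φ ≠ 0 := hφ.ne_zero hd0
  have hφd : φ d ≠ 0 := by rw [hφ.2]; exact norm_ne_zero_iff.2 hd0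
  obtain ⟨e, he, hφe⟩ := exists_ne_zero_apply_eq_zero hdim φ
  have hne : ∀ a ∈ T, a ≠ v := fun a ha h => hv (h ▸ ha)
  obtain ⟨β, hβ⟩ : ∃ β : ℝ, p z - p y - (φ (p z - p y) / φ d) • d = β • e :=
    exists_smul_of_apply_eq_zero hdim hφ0 he hφe (by
      rw [map_sub, map_smul, smul_eq_mul, div_mul_cancel₀ _ hφd, sub_self])
  set α := φ (p z - p y) / φ d
  have hpz : p z = p y + α • d + β • e := by rw [← hβ]; abel
  obtain ⟨t, ht, hα0, hα1, hβ0⟩ : ∃ t : ℝ, (RobustlyStiff T (H ⊔ SimpleGraph.edge x y) fun a b =>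
      Function.update p z (p z + t • (d + e)) a - Function.update p z (p z + t • (d + e)) b) ∧
      α + t ≠ 0 ∧ α + t ≠ 1 ∧ β + t ≠ 0 := by
    have hc : Continuous fun t : ℝ => Function.update p z (p z + t • (d + e)) := by fun_prop
    have h1 := (hc.tendsto 0).mono_left (nhdsWithin_le_nhds (s := {0}ᶜ))
    simp only [zero_smul, add_zero, Function.update_eq_self] at h1
    have hfin : ∀ b c : ℝ, ∀ᶠ t in 𝓝[≠] (0 : ℝ), b + t ≠ c := by
      intro b c
      by_cases hbc : b = c
      · filter_upwards [self_mem_nhdsWithin] with t ht h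
        exact ht (by simpa [hbc] using h)
      · have hcont : Continuous fun t : ℝ => b + t := by fun_prop
        have := (hcont.tendsto 0).mono_left (nhdsWithin_le_nhds (s := {0}ᶜ))
        exact this.eventually_ne (by simpa using hbc)
    exact ((h1.eventually hp.eventually_nhds).and ((hfin α 0).and ((hfin α 1).and
      (hfin β 0)))).exists
  set q := Function.update p z (p z + t • (d + e)) with hq
  have hqx : q x = p x := by simp [q, hzx.symm]
  have hqy : q y = p y := by simp [q, hzy.symm]
  set r := p y + (α + t) • d with hr
  refine ⟨Function.update q v r, fun Φ hΦ u hu => ?_⟩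
  have hvm := Finset.mem_insert_self v T
  have hsx := hΦ v hvm x (Finset.mem_insert_of_mem hx) hvx
  have hsy := hΦ v hvm y (Finset.mem_insert_of_mem hy) hvy
  have hsz := hΦ v hvm z (Finset.mem_insert_of_mem hz) hvz
  have hfx := hu v hvm x (Finset.mem_insert_of_mem hx) hvx
  have hfy := hu v hvm y (Finset.mem_insert_of_mem hy) hvy
  have hfz := hu v hvm z (Finset.mem_insert_of_mem hz) hvz
  simp only [Function.update_self, Function.update_of_ne (hne x hx),
    Function.update_of_ne (hne y hy), Function.update_of_ne (hne z hz), hqx, hqy] at hsx hsy hsz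
  have hrx : r - p x = (α + t - 1) • d := by
    rw [hr, sub_smul, one_smul, hddef]; abel
  have hry : r - p y = (α + t) • d := by rw [hr]; abel
  have hrz : r - q z = (-(β + t)) • e := by
    simp only [hr, hq, Function.update_self, hpz]; module
  rw [hrx] at hsx
  rw [hry] at hsy
  rw [hrz] at hsz
  have hx0 := hsx.apply_eq_zero_of_smul hd (sub_ne_zero.2 hα1) hfx
  have hy0 := hsy.apply_eq_zero_of_smul hd hα0 hfy
  have hT : ∀ a ∈ T, ∀ b ∈ T, u a = u b := by
    refine ht (fun a b => if a = x ∧ b = y then φ else if a = y ∧ b = x then -φ else Φ a b)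
      (fun a ha b hb hab => ?_) u (fun a ha b hb hab => ?_)
    · by_cases h1 : a = x ∧ b = y
      · simp only [h1, and_self, if_true, hqx, hqy]; exact hφ
      by_cases h2 : a = y ∧ b = x
      · simp only [h2, hxy, hxy.symm, and_self, if_true, if_false, hqx, hqy]
        rw [← neg_sub]; exact hφ.neg
      · have hab' : H.Adj a b := by
          rw [SimpleGraph.sup_adj, SimpleGraph.edge_adj] at hab
          tauto
        have := hΦ a (Finset.mem_insert_of_mem ha) b (Finset.mem_insert_of_mem hb) hab'
        simpa [h1, h2, hne a ha, hne b hb] using this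
    · have hk : φ (u x - u y) = 0 := by
        rw [show u x - u y = (u v - u y) - (u v - u x) by abel, map_sub, hx0, hy0, sub_zero]
      by_cases h1 : a = x ∧ b = y
      · simp only [h1, and_self, if_true]; exact hk
      by_cases h2 : a = y ∧ b = x
      · simp only [h2, hxy, hxy.symm, and_self, if_true, if_false]
        rw [← neg_sub]; simpa using hk
      · have hab' : H.Adj a b := by
          rw [SimpleGraph.sup_adj, SimpleGraph.edge_adj] at hab
          tauto
        simp only [h1, h2, if_false]
        exact hu a (Finset.mem_insert_of_mem ha) b (Finset.mem_insert_of_mem hb) hab'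
  obtain ⟨c, hc⟩ := exists_smul_of_apply_eq_zero hdim hφ0 he hφe hx0
  have hse : (Φ v z) e ≠ 0 := by
    intro h0
    have := hsz.2
    rw [map_smul, h0, smul_zero, eq_comm, norm_eq_zero, smul_eq_zero] at this
    rcases this with h | h
    · exact hβ0 (neg_eq_zero.1 h)
    · exact he h
  rw [hT z hz x hx, hc, map_smul, smul_eq_mul, mul_eq_zero, or_iff_left hse] at hfz
  have hvx' : u v = u x := by rwa [hfz, zero_smul, sub_eq_zero] at hc
  have key : ∀ a ∈ Insert.insert v T, u a = u x := by
    intro a ha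
    rcases Finset.mem_insert.1 ha with rfl | ha
    · exact hvx'
    · exact hT a ha x hx
  exact fun a ha b hb => (key a ha).trans (key b hb).symm

/-- Substituting a small copy of a stiff part for a vertex. -/
lemma HasStiffPlacement.of_contract [FiniteDimensional ℝ X] {S T : Finset V} {H : SimpleGraph V}
    {k : V} (hT : HasStiffPlacement X T H)
    (hS : HasStiffPlacement X (Insert.insert k (S \ T)) (contract H T k))
    (hTS : T ⊆ S) (hk : k ∈ T) : HasStiffPlacement X S H := by
  obtain ⟨p, hp⟩ := hT
  obtain ⟨q, hq⟩ := hS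
  let c : V → V := fun v => if v ∈ T then k else v
  have hcS : ∀ v ∈ S, c v ∈ Insert.insert k (S \ T) := by
    intro v hv
    by_cases h : v ∈ T <;> simp [c, h, hv]
  let Z : V → V → X := fun a b => if a ∈ T ∧ b ∈ T then p a - p b else q (c a) - q (c b)
  have hZ : RobustlyStiff S H Z := by
    intro Φ hΦ u hu
    have huT : ∀ a ∈ T, ∀ b ∈ T, u a = u b :=
      hp Φ (fun a ha b hb hab => by simpa [Z, ha, hb] using hΦ a (hTS ha) b (hTS hb) hab) u
        fun a ha b hb hab => hu a (hTS ha) b (hTS hb) hab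
    have huc : ∀ a, u (c a) = u a := by
      intro a
      by_cases h : a ∈ T
      · simpa [c, h] using huT k hk a h
      · simp [c, h]
    have hSmem : ∀ a', c a' ∈ Insert.insert k (S \ T) → a' ∈ S := by
      intro a' ha'
      by_cases h : a' ∈ T
      · exact hTS h
      · simp only [c, h, if_false, Finset.mem_insert, Finset.mem_sdiff] at ha'
        rcases ha' with rfl | ha'
        · exact hTS hk
        · exact ha'.1
    have hrep : ∀ a b, ∃ r : V × V, (contract H T k).Adj a b →
        c r.1 = a ∧ c r.2 = b ∧ H.Adj r.1 r.2 := by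
      intro a b
      by_cases h : (contract H T k).Adj a b
      · obtain ⟨-, a', b', h⟩ := h
        exact ⟨(a', b'), fun _ => h⟩
      · exact ⟨(a, b), fun h' => absurd h' h⟩
    choose r hr using hrep
    have hS' : ∀ a ∈ Insert.insert k (S \ T), ∀ b ∈ Insert.insert k (S \ T), u a = u b := by
      refine hq (fun a b => Φ (r a b).1 (r a b).2) (fun a ha b hb hab => ?_) u
        (fun a ha b hb hab => ?_)
      · obtain ⟨h1, h2, h3⟩ := hr a b hab
        have := hΦ _ (hSmem _ (by rw [h1]; exact ha)) _ (hSmem _ (by rw [h2]; exact hb)) h3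
        have hnot : ¬ ((r a b).1 ∈ T ∧ (r a b).2 ∈ T) := by
          rintro ⟨h4, h5⟩
          exact hab.ne (h1.symm.trans
            ((show c (r a b).1 = c (r a b).2 by simp only [c, h4, h5, if_true]).trans h2))
        simpa only [Z, hnot, if_false, h1, h2] using this
      · obtain ⟨h1, h2, h3⟩ := hr a b hab
        have := hu _ (hSmem _ (by rw [h1]; exact ha)) _ (hSmem _ (by rw [h2]; exact hb)) h3
        rwa [← huc (r a b).1, ← huc (r a b).2, h1, h2] at this
    intro a ha b hb
    rw [← huc a, ← huc b]
    exact hS' _ (hcS a ha) _ (hcS b hb)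
  have hev := hZ.eventually (l := 𝓝[>] (0 : ℝ))
    (Z := fun t a b => (q (c a) + if a ∈ T then t • p a else 0) -
      (q (c b) + if b ∈ T then t • p b else 0)) (fun a ha b hb hab => ?_)
  · obtain ⟨t, ht⟩ := hev.exists
    exact ⟨_, ht⟩
  have hpos : ∀ᶠ t : ℝ in 𝓝[>] (0 : ℝ), 0 < t := self_mem_nhdsWithin
  have hinv : ∀ᶠ t : ℝ in 𝓝[>] (0 : ℝ), 0 < t⁻¹ := hpos.mono fun t ht => inv_pos.2 ht
  by_cases h1 : a ∈ T ∧ b ∈ T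
  · refine ⟨fun t => t⁻¹, hinv, tendsto_const_nhds.congr' ?_⟩
    filter_upwards [hpos] with t ht
    simp [Z, h1, c, ← smul_sub, smul_smul, ht.ne']
  · refine ⟨fun _ => 1, by simp, ?_⟩
    have hc : Continuous fun t : ℝ => (q (c a) + if a ∈ T then t • p a else 0) -
      (q (c b) + if b ∈ T then t • p b else 0) := by
      by_cases h2 : a ∈ T <;> by_cases h3 : b ∈ T <;> simp only [h2, h3, if_true, if_false] <;>
        fun_prop
    have := (hc.tendsto 0).mono_left (nhdsWithin_le_nhds (s := Set.Ioi 0))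
    simpa [Z, h1] using this

end Extension

section Profile

/-- The norm `G` along an affine line missing the origin, with a right-continuous selection `g` of
subgradients; `N` describes the behaviour at infinity. -/
structure Profile (G g N : ℝ → ℝ) : Prop where
  pos : ∀ τ, 0 < G τ
  subgradient : ∀ σ τ, G σ + (τ - σ) * g σ ≤ G τ
  rightCont : ∀ σ, ContinuousWithinAt g (Set.Ioi σ) σ
  continuous_infty : Continuous N
  ne_zero_infty : N 0 ≠ 0
  homogeneous : ∀ s, s ≠ 0 → s ^ 2 * G s⁻¹ ^ 2 = N s ^ 2

/-- The determinant of the functionals supporting the points of slopes `σ` and `τ`. -/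
def bracket (G g : ℝ → ℝ) (σ τ : ℝ) : ℝ :=
  (G σ - σ * g σ) * g τ - g σ * (G τ - τ * g τ)

variable {G g N : ℝ → ℝ}

lemma bracket_self (σ : ℝ) : bracket G g σ σ = 0 := by simp only [bracket]; ring

lemma bracket_antisymm (σ τ : ℝ) : bracket G g σ τ = -bracket G g τ σ := by
  simp only [bracket]; ring

namespace Profile

lemma monotone (h : Profile G g N) : Monotone g := by
  intro σ τ hστ
  rcases hστ.eq_or_lt with rfl | hlt
  · exact le_rfl
  · nlinarith [h.subgradient σ τ, h.subgradient τ σ]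

lemma hasDerivWithinAt (h : Profile G g N) (τ : ℝ) :
    HasDerivWithinAt G (g τ) (Set.Ioi τ) τ := by
  rw [hasDerivWithinAt_iff_tendsto_slope' (by simp)]
  refine tendsto_of_tendsto_of_tendsto_of_le_of_le' tendsto_const_nhds (h.rightCont τ) ?_ ?_
  · filter_upwards [self_mem_nhdsWithin] with σ hσ
    rw [slope_def_field, le_div_iff₀ (sub_pos.2 hσ)]
    linarith [h.subgradient τ σ]
  · filter_upwards [self_mem_nhdsWithin] with σ hσ
    rw [slope_def_field, div_le_iff₀ (sub_pos.2 hσ)]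
    linarith [h.subgradient σ τ]

lemma hasDerivAt (h : Profile G g N) {τ : ℝ} (hg : ContinuousAt g τ) :
    HasDerivAt G (g τ) τ := by
  rw [hasDerivAt_iff_tendsto_slope]
  have hg' : Tendsto g (𝓝[≠] τ) (𝓝 (g τ)) := hg.tendsto.mono_left nhdsWithin_le_nhds
  have hmin : Tendsto (fun σ => min (g τ) (g σ)) (𝓝[≠] τ) (𝓝 (g τ)) := by
    simpa using (tendsto_const_nhds (x := g τ)).min hg'
  have hmax : Tendsto (fun σ => max (g τ) (g σ)) (𝓝[≠] τ) (𝓝 (g τ)) := by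
    simpa using (tendsto_const_nhds (x := g τ)).max hg'
  refine tendsto_of_tendsto_of_tendsto_of_le_of_le' hmin hmax ?_ ?_
  · filter_upwards [self_mem_nhdsWithin] with σ hσ
    rcases lt_or_gt_of_ne hσ with hσ | hσ
    · refine (min_le_right _ _).trans ?_
      rw [slope_comm, slope_def_field, le_div_iff₀ (sub_pos.2 hσ)]
      linarith [h.subgradient σ τ]
    · refine (min_le_left _ _).trans ?_
      rw [slope_def_field, le_div_iff₀ (sub_pos.2 hσ)]
      linarith [h.subgradient τ σ]
  · filter_upwards [self_mem_nhdsWithin] with σ hσ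
    rcases lt_or_gt_of_ne hσ with hσ | hσ
    · refine le_trans ?_ (le_max_left _ _)
      rw [slope_comm, slope_def_field, div_le_iff₀ (sub_pos.2 hσ)]
      linarith [h.subgradient τ σ]
    · refine le_trans ?_ (le_max_right _ _)
      rw [slope_def_field, div_le_iff₀ (sub_pos.2 hσ)]
      linarith [h.subgradient σ τ]

lemma continuous (h : Profile G g N) : Continuous G := by
  have hconv : ConvexOn ℝ Set.univ G := by
    refine ⟨convex_univ, fun x _ y _ a b ha hb hab => ?_⟩
    have h1 := h.subgradient (a • x + b • y) x
    have h2 := h.subgradient (a • x + b • y) y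
    simp only [smul_eq_mul] at *
    have h3 := add_le_add (mul_le_mul_of_nonneg_left h1 ha) (mul_le_mul_of_nonneg_left h2 hb)
    convert h3 using 1
    obtain rfl : a = 1 - b := by linarith
    ring
  exact continuousOn_univ.1 (hconv.continuousOn isOpen_univ)

lemma not_constant (h : Profile G g N) (c : ℝ) (hg : ∀ τ, g τ = c) : False := by
  have hG : ∀ τ, G τ = G 0 + τ * c := by
    intro τ
    have h1 := h.subgradient 0 τ
    have h2 := h.subgradient τ 0
    rw [hg] at h1 h2
    linarith
  have hN : ∀ᶠ s in 𝓝[≠] (0 : ℝ), N s ^ 2 = (G 0 * s + c) ^ 2 := by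
    filter_upwards [self_mem_nhdsWithin] with s hs
    have hs : s ≠ 0 := hs
    rw [← h.homogeneous s hs, hG]
    field_simp
  have h1 : Tendsto (fun s => N s ^ 2) (𝓝[≠] 0) (𝓝 (N 0 ^ 2)) :=
    ((h.continuous_infty.pow 2).tendsto 0).mono_left nhdsWithin_le_nhds
  have h2 : Tendsto (fun s => (G 0 * s + c) ^ 2) (𝓝[≠] 0) (𝓝 ((G 0 * 0 + c) ^ 2)) :=
    ((by fun_prop : Continuous fun s => (G 0 * s + c) ^ 2).tendsto 0).mono_left nhdsWithin_le_nhds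
  have h3 := tendsto_nhds_unique (h1.congr' hN) h2
  have hc : c ≠ 0 := by
    rintro rfl
    exact h.ne_zero_infty (by simpa using h3)
  have h4 := h.pos (-G 0 / c)
  rw [hG] at h4
  field_simp at h4
  simp at h4

lemma bracket_eq (α μ : ℝ) :
    bracket G g α μ = g μ * (G α + (μ - α) * g α) - g α * G μ := by
  simp only [bracket]; ring

lemma exists_bracket_ne_zero (h : Profile G g N) {α β : ℝ} (hαβ : α ≠ β) :
    ∃ μ, μ ≠ α ∧ μ ≠ β ∧ bracket G g μ α ≠ 0 := by
  by_contra! hcon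
  have h0 : ∀ μ, μ ≠ α → μ ≠ β → bracket G g α μ = 0 := fun μ h1 h2 => by
    rw [bracket_antisymm, hcon μ h1 h2, neg_zero]
  have h1 : ∀ μ, bracket G g α μ = 0 := by
    intro μ
    by_cases hα : μ = α
    · rw [hα, bracket_self]
    by_cases hβ : μ = β
    · subst hβ
      have hG : Tendsto G (𝓝[>] μ) (𝓝 (G μ)) :=
        (h.continuous.tendsto μ).mono_left nhdsWithin_le_nhds
      have hid : Tendsto (fun σ : ℝ => σ) (𝓝[>] μ) (𝓝 μ) := tendsto_id.mono_left nhdsWithin_le_nhds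
      have hlim : Tendsto (fun σ => bracket G g α σ) (𝓝[>] μ) (𝓝 (bracket G g α μ)) := by
        have hg : Tendsto g (𝓝[>] μ) (𝓝 (g μ)) := h.rightCont μ
        exact (hg.const_mul _).sub ((hG.sub (hid.mul hg)).const_mul _)
      refine tendsto_nhds_unique hlim (tendsto_const_nhds.congr' ?_)
      filter_upwards [self_mem_nhdsWithin, hid.eventually_ne hα] with σ hσ hσα
      exact (h0 σ hσα (ne_of_gt hσ)).symm
    · exact h0 μ hα hβ
  have h2 : ∀ μ, g μ * (G α + (μ - α) * g α) = g α * G μ := fun μ => by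
    have := h1 μ
    rw [bracket_eq] at this
    linarith
  by_cases hα : g α = 0
  · refine h.not_constant 0 fun τ => ?_
    have := h2 τ
    simpa [hα, (h.pos α).ne'] using this
  · have := h2 (α - G α / g α)
    rw [show G α + (α - G α / g α - α) * g α = 0 by field_simp; ring, mul_zero] at this
    exact mul_ne_zero hα (h.pos _).ne' this.symm

lemma hasDerivAt_bracket (h : Profile G g N) {α g' : ℝ} (hg : HasDerivAt g g' α) (τ : ℝ) :
    HasDerivAt (fun σ => bracket G g σ τ)
      (-(α * g') * g τ - g' * (G τ - τ * g τ)) α := by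
  have hG := h.hasDerivAt hg.continuousAt
  have := ((hG.sub ((hasDerivAt_id α).mul hg)).mul_const (g τ)).sub
    (hg.mul_const (G τ - τ * g τ))
  refine this.congr_deriv ?_
  simp only [id]
  ring

lemma hasDerivAt_bracket_self (h : Profile G g N) {α g' : ℝ} (hg : HasDerivAt g g' α) :
    HasDerivAt (fun σ => bracket G g σ α) (-(g' * G α)) α := by
  convert h.hasDerivAt_bracket hg α using 1
  ring

/-- A quadratic satisfying the logarithmic derivative equation of `G ^ 2` is proportional to
`G ^ 2`. -/
lemma quadratic_eq (h : Profile G g N) {q₀ q₁ q₂ c : ℝ} (hc : 0 ≤ c)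
    (hQ : ∀ τ, 2 * g τ * (q₂ * τ ^ 2 + q₁ * τ + q₀) = G τ * (2 * q₂ * τ + q₁ - c)) (τ : ℝ) :
    N 0 ^ 2 * (q₂ * τ ^ 2 + q₁ * τ + q₀) = q₂ * G τ ^ 2 := by
  set Ψ : ℝ → ℝ := fun τ => (q₂ * τ ^ 2 + q₁ * τ + q₀) / G τ ^ 2 with hΨ
  have hcont : Continuous Ψ :=
    Continuous.div (by fun_prop) (h.continuous.pow 2) fun τ => pow_ne_zero 2 (h.pos τ).ne'
  have hder : ∀ τ, HasDerivWithinAt Ψ (c / G τ ^ 2) (Set.Ici τ) τ := by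
    intro τ
    rw [← hasDerivWithinAt_Ioi_iff_Ici]
    have hq : HasDerivAt (fun τ => q₂ * τ ^ 2 + q₁ * τ + q₀) (2 * q₂ * τ + q₁) τ := by
      have :=
        (((hasDerivAt_pow 2 τ).const_mul q₂).add ((hasDerivAt_id τ).const_mul q₁)).add_const q₀
      refine this.congr_deriv ?_
      simp; ring
    have hG0 := (h.pos τ).ne'
    have := hq.hasDerivWithinAt.div ((h.hasDerivWithinAt τ).pow 2) (pow_ne_zero 2 hG0)
    refine this.congr_deriv ?_
    have hQτ := hQ τ
    simp only [Pi.pow_apply]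
    field_simp
    simp
    linear_combination -G τ * hQτ
  have hmono : Monotone Ψ := by
    intro a b hab
    refine image_le_of_deriv_right_le_deriv_boundary (f := fun _ => Ψ a) (f' := fun _ => 0)
      (B := Ψ) (B' := fun τ => c / G τ ^ 2) (a := a) (b := b) continuousOn_const
      (fun x _ => hasDerivWithinAt_const _ _ _) le_rfl hcont.continuousOn (fun x _ => hder x)
      (fun x _ => by positivity) ⟨hab, le_rfl⟩
  set R : ℝ → ℝ := fun s => (q₂ + q₁ * s + q₀ * s ^ 2) / N s ^ 2 with hR
  have hRΨ : ∀ s, s ≠ 0 → Ψ s⁻¹ = R s := by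
    intro s hs
    have := (h.pos s⁻¹).ne'
    simp only [hΨ, hR, ← h.homogeneous s hs]
    field_simp
  have hRc : Tendsto R (𝓝 0) (𝓝 (R 0)) := by
    have h1 : Continuous fun s => q₂ + q₁ * s + q₀ * s ^ 2 := by fun_prop
    exact (h1.tendsto 0).div ((h.continuous_infty.pow 2).tendsto 0)
      (pow_ne_zero 2 h.ne_zero_infty)
  have hle : Ψ τ ≤ R 0 := by
    refine ge_of_tendsto (hRc.mono_left (nhdsWithin_le_nhds (s := Set.Ioi 0))) ?_
    filter_upwards [self_mem_nhdsWithin, tendsto_inv_nhdsGT_zero.eventually_ge_atTop τ] with s hs h1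
    rw [← hRΨ s (ne_of_gt hs)]
    exact hmono h1
  have hge : R 0 ≤ Ψ τ := by
    refine le_of_tendsto (hRc.mono_left (nhdsWithin_le_nhds (s := Set.Iio 0))) ?_
    filter_upwards [self_mem_nhdsWithin, tendsto_inv_nhdsLT_zero.eventually_le_atBot τ] with s hs h1
    rw [← hRΨ s (ne_of_lt hs)]
    exact hmono h1
  have heq := le_antisymm hle hge
  have h1 := (h.pos τ).ne'
  have h2 := h.ne_zero_infty
  simp only [hΨ, hR] at heq
  field_simp at heq
  simp at heq
  linarith

/-- The relation forced by the degeneracy of all placements of the complete graph on four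
vertices. -/
def Degenerate (G g : ℝ → ℝ) : Prop :=
  ∀ α β μ τ k ε : ℝ, α ≠ β → μ ≠ α → μ ≠ β → k * (μ - β) = μ - α → ε ≠ 0 → ε ≠ 1 → ε ≠ k →
    bracket G g μ α * bracket G g (α + ε * (α - τ) / (1 - ε)) τ *
        bracket G g (β + ε * (β - τ) / (k - ε)) β =
      bracket G g μ β * bracket G g (α + ε * (α - τ) / (1 - ε)) α *
        bracket G g (β + ε * (β - τ) / (k - ε)) τ

lemma hasDerivAt_slope {k : ℝ} (hk : k ≠ 0) (β τ : ℝ) :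
    HasDerivAt (fun ε : ℝ => β + ε * (β - τ) / (k - ε)) ((β - τ) / k) 0 := by
  have := (((hasDerivAt_id (0 : ℝ)).mul_const (β - τ)).div ((hasDerivAt_id (0 : ℝ)).const_sub k)
    (by simpa using hk)).const_add β
  refine this.congr_deriv ?_
  simp
  field_simp

lemma eq_quadratic_of_hasDerivAt_ne_zero (h : Profile G g N) (hd : Degenerate G g) {β b' : ℝ}
    (hβ : HasDerivAt g b' β) (hb' : b' ≠ 0) :
    ∃ a b, ∀ τ, G τ ^ 2 = N 0 ^ 2 * τ ^ 2 + b * τ + a := by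
  obtain ⟨α, hα, hαβ⟩ : ∃ α, DifferentiableAt ℝ g α ∧ α ≠ β :=
    ((h.monotone.ae_differentiableAt).and
      (MeasureTheory.compl_mem_ae_iff.2 (MeasureTheory.measure_singleton β))).exists
  obtain ⟨a', hα⟩ : ∃ a', HasDerivAt g a' α := ⟨_, hα.hasDerivAt⟩
  obtain ⟨μ, hμα, hμβ, hμ⟩ := h.exists_bracket_ne_zero hαβ
  set k := (μ - α) / (μ - β) with hk
  have hμβ' := sub_ne_zero.2 hμβ
  have hk1 : k * (μ - β) = μ - α := div_mul_cancel₀ _ hμβ'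
  have hk0 : k ≠ 0 := div_ne_zero (sub_ne_zero.2 hμα) hμβ'
  have hdiff : ∀ τ, bracket G g μ α * (bracket G g α τ * ((-(b' * G β)) * ((β - τ) / k))) =
      bracket G g μ β * ((-(a' * G α)) * (α - τ) * bracket G g β τ) := by
    intro τ
    have hα1 := hasDerivAt_slope one_ne_zero α τ
    have hβ1 := hasDerivAt_slope hk0 β τ
    have hcomp : ∀ {f : ℝ → ℝ} {f' k x : ℝ}, HasDerivAt f f' x →
        HasDerivAt (fun ε : ℝ => x + ε * (x - τ) / (k - ε)) ((x - τ) / k) 0 →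
        HasDerivAt (fun ε => f (x + ε * (x - τ) / (k - ε))) (f' * ((x - τ) / k)) 0 := by
      intro f f' k x hf hs
      exact HasDerivAt.comp (h₂ := f) 0 (by simpa using hf) hs
    have e1 := ((hcomp (h.hasDerivAt_bracket hα τ) hα1).mul
      (hcomp (h.hasDerivAt_bracket_self hβ) hβ1)).const_mul (bracket G g μ α)
    have e2 := ((hcomp (h.hasDerivAt_bracket_self hα) hα1).mul
      (hcomp (h.hasDerivAt_bracket hβ τ) hβ1)).const_mul (bracket G g μ β)
    have hev : (fun ε => bracket G g μ α * (bracket G g (α + ε * (α - τ) / (1 - ε)) τ *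
        bracket G g (β + ε * (β - τ) / (k - ε)) β)) =ᶠ[𝓝 0]
        fun ε => bracket G g μ β * (bracket G g (α + ε * (α - τ) / (1 - ε)) α *
        bracket G g (β + ε * (β - τ) / (k - ε)) τ) := by
      filter_upwards [eventually_ne_nhds zero_ne_one, eventually_ne_nhds hk0.symm] with ε h1 h2
      by_cases h0 : ε = 0
      · simp [h0, bracket_self]
      · rw [← mul_assoc, ← mul_assoc]
        exact hd α β μ τ k ε hαβ hμα hμβ hk1 h0 h1 h2
    have := (e1.congr_of_eventuallyEq hev.symm).unique e2
    simpa [bracket_self] using this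
  set c₁ := bracket G g μ α * b' * G β with hc₁
  set c₂ := bracket G g μ β * a' * G α * k with hc₂
  have hc₁0 : c₁ ≠ 0 := mul_ne_zero (mul_ne_zero hμ hb') (h.pos β).ne'
  have hrel : ∀ τ, c₁ * (τ - β) * bracket G g α τ = c₂ * (τ - α) * bracket G g β τ := by
    intro τ
    have := hdiff τ
    field_simp at this
    rw [hc₁, hc₂]
    linear_combination this
  set q₂ := c₁ * g α - c₂ * g β with hq₂
  set q₁ := c₁ * (G α - α * g α) - c₁ * β * g α - (c₂ * (G β - β * g β) - c₂ * α * g β) with hq₁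
  set q₀ := -(c₁ * β * (G α - α * g α)) + c₂ * α * (G β - β * g β) with hq₀
  set c := c₁ * (G α + (β - α) * g α) - c₂ * (G β + (α - β) * g β) with hc
  have hQ : ∀ τ, 2 * g τ * (q₂ * τ ^ 2 + q₁ * τ + q₀) = G τ * (2 * q₂ * τ + q₁ - c) := by
    intro τ
    have := hrel τ
    simp only [bracket_eq] at this
    rw [hq₂, hq₁, hq₀, hc]
    linear_combination 2 * this
  have hkey : ∀ τ, N 0 ^ 2 * (q₂ * τ ^ 2 + q₁ * τ + q₀) = q₂ * G τ ^ 2 := by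
    rcases le_total 0 c with h0 | h0
    · exact h.quadratic_eq h0 hQ
    · intro τ
      have := h.quadratic_eq (q₀ := -q₀) (q₁ := -q₁) (q₂ := -q₂) (c := -c) (neg_nonneg.2 h0)
        (fun τ => by linear_combination - hQ τ) τ
      linear_combination - this
  have hq0 : q₂ ≠ 0 := by
    intro h0
    have h1 := hkey α
    rw [h0, zero_mul (G α ^ 2), mul_eq_zero, or_iff_right (pow_ne_zero 2 h.ne_zero_infty)] at h1
    have h2 : c₁ * (α - β) * G α = 0 := by
      rw [← h1, ← h0, hq₂, hq₁, hq₀]; ring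
    exact mul_ne_zero (mul_ne_zero hc₁0 (sub_ne_zero.2 hαβ)) (h.pos α).ne' h2
  refine ⟨N 0 ^ 2 * q₀ / q₂, N 0 ^ 2 * q₁ / q₂, fun τ => ?_⟩
  have := hkey τ
  field_simp
  linear_combination -this

lemma hasDerivAt_zero (h : Profile G g N) (hd : Degenerate G g) {α β : ℝ} (hβ : β ≠ α)
    (hα : HasDerivAt g 0 α) : HasDerivAt g 0 β := by
  obtain ⟨μ, hμα, hμβ, hμ⟩ := h.exists_bracket_ne_zero hβ.symm
  set k := (μ - α) / (μ - β) with hk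
  have hμβ' := sub_ne_zero.2 hμβ
  have hk1 : k * (μ - β) = μ - α := div_mul_cancel₀ _ hμβ'
  have hk0 : k ≠ 0 := div_ne_zero (sub_ne_zero.2 hμα) hμβ'
  have hβμ := sub_ne_zero.2 hμβ.symm
  set ε : ℝ → ℝ := fun σ => (σ - β) * k / (σ - μ) with hε
  have hε' : HasDerivAt ε (k / (β - μ)) β := by
    have := (((hasDerivAt_id β).sub_const β).mul_const k).div ((hasDerivAt_id β).sub_const μ)
      (by simpa using hβμ)
    refine this.congr_deriv ?_
    simp
    field_simp
  have hε0 : ε β = 0 := by simp [hε]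
  set a : ℝ → ℝ := fun σ => α + ε σ * (α - μ) / (1 - ε σ) with ha
  have haβ : a β = α := by simp [ha, hε0]
  obtain ⟨a', ha'⟩ : ∃ a', HasDerivAt a a' β := by
    have h1 : HasDerivAt (fun e : ℝ => α + e * (α - μ) / (1 - e)) ((α - μ) / 1) (ε β) := by
      rw [hε0]; exact hasDerivAt_slope one_ne_zero α μ
    exact ⟨_, h1.comp β hε'⟩
  have hA₁ : Tendsto (fun σ => bracket G g (a σ) μ) (𝓝 β) (𝓝 (bracket G g α μ)) := by
    have h1 := (h.hasDerivAt_bracket hα μ).continuousAt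
    rw [← haβ] at h1
    have := h1.comp (f := a) ha'.continuousAt
    rw [ContinuousAt] at this
    simpa only [Function.comp_def, haβ] using this
  have hαμ : bracket G g α μ ≠ 0 := by
    rw [bracket_antisymm]; exact neg_ne_zero.2 hμ
  have hA₂ : (fun σ => bracket G g (a σ) α) =o[𝓝 β] fun σ => σ - β := by
    have h1 := h.hasDerivAt_bracket_self hα
    rw [← haβ] at h1
    have := (HasDerivAt.comp β (by simpa only [haβ] using h1) ha' :
      HasDerivAt ((fun σ => bracket G g σ α) ∘ a) _ β)
    rw [hasDerivAt_iff_isLittleO] at this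
    simpa [haβ, bracket_self] using this
  have hg1 : g =O[𝓝 β] fun _ => (1 : ℝ) := by
    refine Asymptotics.IsBigO.of_bound (max |g (β - 1)| |g (β + 1)|) ?_
    filter_upwards [Icc_mem_nhds (sub_one_lt β) (lt_add_one β)] with σ hσ
    simpa using abs_le_max_abs_abs (h.monotone hσ.1) (h.monotone hσ.2)
  have hA₃ : (fun σ => bracket G g σ μ) =O[𝓝 β] fun _ => (1 : ℝ) := by
    have h1 : ∀ {f : ℝ → ℝ}, Continuous f → f =O[𝓝 β] fun _ => (1 : ℝ) := fun hf =>
      (hf.tendsto β).isBigO_one ℝ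
    have h2 : (fun σ => σ * g σ) =O[𝓝 β] fun _ => (1 : ℝ) := by
      simpa using (h1 continuous_id).mul hg1
    have h3 := ((h1 h.continuous).sub h2).mul (h1 (continuous_const (y := g μ)))
    have h4 := hg1.mul (h1 (continuous_const (y := G μ - μ * g μ)))
    simpa [bracket] using h3.sub h4
  have hB : (fun σ => bracket G g σ β) =o[𝓝 β] fun σ => σ - β := by
    have h1 : Tendsto (fun σ => bracket G g μ β / (bracket G g μ α * bracket G g (a σ) μ)) (𝓝 β)
        (𝓝 (bracket G g μ β / (bracket G g μ α * bracket G g α μ))) :=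
      tendsto_const_nhds.div (hA₁.const_mul _) (mul_ne_zero hμ hαμ)
    have h2 := ((h1.isBigO_one ℝ).mul_isLittleO hA₂).mul_isBigO hA₃
    simp only [one_mul, mul_one] at h2
    refine h2.congr' ?_ EventuallyEq.rfl
    have hεt : Tendsto ε (𝓝 β) (𝓝 0) := hε0 ▸ hε'.continuousAt.tendsto
    filter_upwards [hA₁.eventually_ne hαμ, eventually_ne_nhds hμβ.symm,
      hεt.eventually_ne zero_ne_one] with σ h3 h4 h5
    have h4' := sub_ne_zero.2 h4
    by_cases hσ : σ = β
    · simp [hσ, haβ, bracket_self]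
    have h6 : k - ε σ = k * (β - μ) / (σ - μ) := by
      simp only [hε]; field_simp; ring
    have h7 : ε σ ≠ 0 := div_ne_zero (mul_ne_zero (sub_ne_zero.2 hσ) hk0) h4'
    have h8 : k - ε σ ≠ 0 := by
      rw [h6]; exact div_ne_zero (mul_ne_zero hk0 hβμ) h4'
    have h9 : β + ε σ * (β - μ) / (k - ε σ) = σ := by
      rw [h6]; simp only [hε]; field_simp; ring
    have h10 := hd α β μ μ k (ε σ) hβ.symm hμα hμβ hk1 h7 h5 (sub_ne_zero.1 h8).symm
    rw [h9] at h10
    change _ * bracket G g (a σ) μ * _ = _ * bracket G g (a σ) α * _ at h10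
    field_simp
    linear_combination -h10
  rw [hasDerivAt_iff_isLittleO]
  simp only [smul_zero, sub_zero]
  refine Asymptotics.IsBigO.trans_isLittleO ?_ hB
  refine Asymptotics.IsBigO.of_bound (2 / G β) ?_
  have hGβ := h.pos β
  have hsmall : ∀ᶠ σ in 𝓝 β, 2 * |(σ - β) * g β| < G β := by
    have h1 : Continuous fun σ : ℝ => 2 * |(σ - β) * g β| := by fun_prop
    exact (h1.tendsto β).eventually_lt_const (by simpa using hGβ)
  filter_upwards [hsmall] with σ hσ
  rw [Real.norm_eq_abs, Real.norm_eq_abs, div_mul_eq_mul_div, le_div_iff₀ hGβ]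
  have h1 := h.subgradient σ β
  have h2 := h.subgradient β σ
  set δ := g σ - g β with hδ
  set E := G σ - G β - (σ - β) * g β with hE
  have h3 : |E - (σ - β) * δ| ≤ |(σ - β) * δ| := by
    have h4 : 0 ≤ E := by rw [hE]; linarith
    have h5 : E ≤ (σ - β) * δ := by rw [hE, hδ]; linarith
    rw [abs_of_nonpos (by linarith), abs_of_nonneg (h4.trans h5)]
    linarith
  have h4 : δ * G β = (E - (σ - β) * δ) * g β - bracket G g σ β := by
    simp only [bracket, hE, hδ]; ring
  have h5 : |δ| * G β ≤ |δ| * |(σ - β) * g β| + |bracket G g σ β| := by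
    rw [← abs_of_pos hGβ, ← abs_mul, h4]
    refine (abs_sub _ _).trans (add_le_add_left ?_ _)
    rw [abs_mul, ← abs_mul δ, show δ * ((σ - β) * g β) = ((σ - β) * δ) * g β by ring, abs_mul]
    exact mul_le_mul_of_nonneg_right h3 (abs_nonneg _)
  nlinarith [abs_nonneg δ]

theorem eq_quadratic (h : Profile G g N) (hd : Degenerate G g) :
    ∃ a b, ∀ τ, G τ ^ 2 = N 0 ^ 2 * τ ^ 2 + b * τ + a := by
  obtain ⟨α, hα⟩ := h.monotone.ae_differentiableAt.exists
  by_cases h0 : deriv g α = 0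
  · have hα0 : HasDerivAt g 0 α := h0 ▸ hα.hasDerivAt
    have hall : ∀ β, HasDerivAt g 0 β := fun β => by
      by_cases hβ : β = α
      · exact hβ ▸ hα0
      · exact h.hasDerivAt_zero hd hβ hα0
    exact (h.not_constant (g 0) fun τ => is_const_of_deriv_eq_zero
      (fun β => (hall β).differentiableAt) (fun β => (hall β).deriv) τ 0).elim
  · exact h.eq_quadratic_of_hasDerivAt_ne_zero hd hα.hasDerivAt h0

end Profile

end Profile

section FourPoints

variable {X : Type*} [NormedAddCommGroup X] [NormedSpace ℝ X]

lemma IsSupport.exists_of_smul {c : ℝ} (hc : c ≠ 0) {x : X} {φ : X →L[ℝ] ℝ}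
    (h : IsSupport (c • x) φ) : ∃ ψ, IsSupport x ψ ∧ ∀ y, φ y = 0 → ψ y = 0 := by
  rcases lt_or_gt_of_ne hc with hc | hc
  · have h1 : IsSupport ((-c) • x) (-φ) := by simpa using h.neg
    exact ⟨-φ, h1.of_smul (neg_pos.2 hc), fun y hy => by simpa using hy⟩
  · exact ⟨φ, h.of_smul hc, fun _ => id⟩

lemma IsSupport.apply_fst {e₁ e₂ : X} {σ : ℝ} {φ : X →L[ℝ] ℝ} (h : IsSupport (e₁ + σ • e₂) φ) :
    φ e₁ = ‖e₁ + σ • e₂‖ - σ * φ e₂ := by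
  rw [← h.2, map_add, map_smul, smul_eq_mul]; ring

lemma IsSupport.subgradient {e₁ e₂ : X} {σ : ℝ} {φ : X →L[ℝ] ℝ}
    (h : IsSupport (e₁ + σ • e₂) φ) (τ : ℝ) :
    ‖e₁ + σ • e₂‖ + (τ - σ) * φ e₂ ≤ ‖e₁ + τ • e₂‖ := by
  have := h.apply_le (e₁ + τ • e₂)
  rw [map_add, map_smul, smul_eq_mul, h.apply_fst] at this
  linarith

lemma IsSupport.apply_le_of_lt {e₁ e₂ : X} {σ τ : ℝ} {φ : X →L[ℝ] ℝ}
    (h : IsSupport (e₁ + σ • e₂) φ) {y : ℝ} (hστ : σ < τ)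
    (hy : ‖e₁ + τ • e₂‖ + (σ - τ) * y ≤ ‖e₁ + σ • e₂‖) : φ e₂ ≤ y := by
  nlinarith [h.subgradient τ]

lemma IsSupport.le_apply_of_lt {e₁ e₂ : X} {σ τ : ℝ} {φ : X →L[ℝ] ℝ}
    (h : IsSupport (e₁ + τ • e₂) φ) {y : ℝ} (hστ : σ < τ)
    (hy : ‖e₁ + σ • e₂‖ + (τ - σ) * y ≤ ‖e₁ + τ • e₂‖) : y ≤ φ e₂ := by
  nlinarith [h.subgradient σ]

lemma exists_profile {e₁ e₂ : X} (he : LinearIndependent ℝ ![e₁, e₂]) :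
    ∃ g, Profile (fun τ => ‖e₁ + τ • e₂‖) g (fun s => ‖s • e₁ + e₂‖) := by
  rw [LinearIndependent.pair_iff] at he
  choose φ hφ using fun τ : ℝ => exists_isSupport (e₁ + τ • e₂)
  have hmono : Monotone fun τ => φ τ e₂ := by
    intro σ τ hστ
    rcases hστ.eq_or_lt with rfl | hlt
    · exact le_rfl
    · exact (hφ σ).apply_le_of_lt hlt ((hφ τ).subgradient σ)
  refine ⟨hmono.stieltjesFunction, ⟨fun τ => ?_, fun σ τ => ?_, fun σ => ?_, by fun_prop, ?_, ?_⟩⟩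
  · refine norm_pos_iff.2 fun h => ?_
    simpa using (he 1 τ (by simpa using h)).1
  · have h1 : Tendsto (fun t => φ t e₂) (𝓝[>] σ) (𝓝 (hmono.stieltjesFunction σ)) :=
      hmono.tendsto_rightLim σ
    have hc : Continuous fun t : ℝ => ‖e₁ + t • e₂‖ := by fun_prop
    have hd : Continuous fun t : ℝ => τ - t := by fun_prop
    exact le_of_tendsto' (((hc.tendsto σ).mono_left nhdsWithin_le_nhds).add
      (((hd.tendsto σ).mono_left nhdsWithin_le_nhds).mul h1)) fun t => (hφ t).subgradient τ
  · exact (hmono.stieltjesFunction.right_continuous σ).mono Set.Ioi_subset_Ici_self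
  · intro h
    simpa using (he 0 1 (by simpa using h)).2
  · intro s hs
    rw [← sq_abs s, ← Real.norm_eq_abs, ← mul_pow, ← norm_smul, smul_add, smul_smul,
      mul_inv_cancel₀ hs, one_smul]

lemma Profile.tendsto_isSupport {e₁ e₂ : X} {g : ℝ → ℝ}
    (h : Profile (fun τ => ‖e₁ + τ • e₂‖) g (fun s => ‖s • e₁ + e₂‖)) {σ : ℝ}
    {φ : ℝ → X →L[ℝ] ℝ} (hφ : ∀ s, 0 < s → IsSupport (e₁ + (σ + s) • e₂) (φ s)) :
    Tendsto (fun s => φ s e₁) (𝓝[>] 0) (𝓝 (‖e₁ + σ • e₂‖ - σ * g σ)) ∧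
      Tendsto (fun s => φ s e₂) (𝓝[>] 0) (𝓝 (g σ)) := by
  have h2 : Tendsto (fun s => φ s e₂) (𝓝[>] 0) (𝓝 (g σ)) := by
    have hlim : Tendsto (fun s : ℝ => g (σ + 2 * s)) (𝓝[>] 0) (𝓝 (g σ)) := by
      refine (h.rightCont σ).tendsto.comp (tendsto_nhdsWithin_iff.2 ⟨?_, ?_⟩)
      · have hc : Continuous fun s : ℝ => σ + 2 * s := by fun_prop
        simpa using (hc.tendsto 0).mono_left (nhdsWithin_le_nhds (s := Set.Ioi 0))
      · filter_upwards [self_mem_nhdsWithin] with s hs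
        have hs : 0 < s := hs
        simpa using hs
    refine tendsto_of_tendsto_of_tendsto_of_le_of_le' tendsto_const_nhds hlim ?_ ?_
    · filter_upwards [self_mem_nhdsWithin] with s hs
      have hs : 0 < s := hs
      exact (hφ s hs).le_apply_of_lt (by linarith) (h.subgradient σ (σ + s))
    · filter_upwards [self_mem_nhdsWithin] with s hs
      have hs : 0 < s := hs
      exact (hφ s hs).apply_le_of_lt (by linarith) (h.subgradient (σ + 2 * s) (σ + s))
  refine ⟨?_, h2⟩
  have hc : Continuous fun s : ℝ => ‖e₁ + (σ + s) • e₂‖ := by fun_prop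
  have hd : Continuous fun s : ℝ => σ + s := by fun_prop
  have h3 := ((hc.tendsto 0).mono_left (nhdsWithin_le_nhds (s := Set.Ioi 0))).sub
    (((hd.tendsto 0).mono_left (nhdsWithin_le_nhds (s := Set.Ioi 0))).mul h2)
  simp only [add_zero] at h3
  refine h3.congr' ?_
  filter_upwards [self_mem_nhdsWithin] with s hs
  exact (hφ s hs).apply_fst.symm

/-- The determinant of two functionals in the coordinates `e₁, e₂`. -/
def functionalDet (e₁ e₂ : X) (φ ψ : X →L[ℝ] ℝ) : ℝ := φ e₁ * ψ e₂ - φ e₂ * ψ e₁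

lemma exists_functionalDet {e₁ e₂ : X} (hs : ∀ x : X, ∃ a b : ℝ, x = a • e₁ + b • e₂)
    {φ : X →L[ℝ] ℝ} (hφ : φ ≠ 0) {x : X} (hx : φ x = 0) :
    ∃ t : ℝ, (t = 0 → x = 0) ∧ ∀ ψ : X →L[ℝ] ℝ, ψ x = t * functionalDet e₁ e₂ ψ φ := by
  obtain ⟨a, b, rfl⟩ := hs x
  simp only [map_add, map_smul, smul_eq_mul] at hx
  simp only [functionalDet, map_add, map_smul, smul_eq_mul]
  by_cases h2 : φ e₂ = 0
  · have h1 : φ e₁ ≠ 0 := by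
      intro h1
      apply hφ
      ext y
      obtain ⟨c, d, rfl⟩ := hs y
      simp [h1, h2]
    have ha : a = 0 := by simpa [h2, h1] using hx
    refine ⟨-b / φ e₁, fun h => ?_, fun ψ => ?_⟩
    · have hb : b = 0 := by simpa [h1] using h
      simp [ha, hb]
    · rw [h2, ha]; field_simp; ring
  · refine ⟨a / φ e₂, fun h => ?_, fun ψ => ?_⟩
    · have ha : a = 0 := by simpa [h2] using h
      have hb : b = 0 := by simpa [ha, h2] using hx
      simp [ha, hb]
    · field_simp
      linear_combination (ψ e₂) * hx

lemma functionalDet_relation {e₁ e₂ : X} (hs : ∀ x : X, ∃ a b : ℝ, x = a • e₁ + b • e₂)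
    {ω α β α' β' γ : X →L[ℝ] ℝ} (hω : ω ≠ 0) (hα : α ≠ 0) (hβ : β ≠ 0) {x y z : X}
    (h1 : ω x = 0) (h2 : α y = 0) (h3 : β z = 0) (h4 : α' (x - y) = 0) (h5 : β' (x - z) = 0)
    (h6 : γ (y - z) = 0) (hne : ¬ (x = 0 ∧ y = 0 ∧ z = 0)) :
    functionalDet e₁ e₂ γ α * functionalDet e₁ e₂ α' ω * functionalDet e₁ e₂ β' β =
      functionalDet e₁ e₂ γ β * functionalDet e₁ e₂ α' α * functionalDet e₁ e₂ β' ω := by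
  obtain ⟨s, hs0, hs1⟩ := exists_functionalDet hs hω h1
  obtain ⟨t, ht0, ht1⟩ := exists_functionalDet hs hα h2
  obtain ⟨r, hr0, hr1⟩ := exists_functionalDet hs hβ h3
  rw [map_sub, hs1, ht1] at h4
  rw [map_sub, hs1, hr1] at h5
  rw [map_sub, ht1, hr1] at h6
  generalize functionalDet e₁ e₂ γ α = A at *
  generalize functionalDet e₁ e₂ α' ω = B at *
  generalize functionalDet e₁ e₂ β' β = C at *
  generalize functionalDet e₁ e₂ γ β = D at *
  generalize functionalDet e₁ e₂ α' α = E at *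
  generalize functionalDet e₁ e₂ β' ω = F at *
  by_contra hcon
  have hcon := sub_ne_zero.2 hcon
  have k1 : s * (A * B * C - D * E * F) = 0 := by
    linear_combination A * C * h4 - D * E * h5 + E * C * h6
  have k2 : t * (A * B * C - D * E * F) = 0 := by
    linear_combination D * F * h4 - D * B * h5 + B * C * h6
  have k3 : r * (A * B * C - D * E * F) = 0 := by
    linear_combination A * F * h4 - A * B * h5 + E * F * h6
  exact hne ⟨hs0 ((mul_eq_zero.1 k1).resolve_right hcon),
    ht0 ((mul_eq_zero.1 k2).resolve_right hcon), hr0 ((mul_eq_zero.1 k3).resolve_right hcon)⟩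

/-- The placement of four points is robustly stiff for the complete graph. -/
abbrev StiffQuadruple (P : Fin 4 → X) : Prop :=
  RobustlyStiff Finset.univ (⊤ : SimpleGraph (Fin 4)) fun i j => P i - P j

lemma exists_relation_of_not_stiffQuadruple {e₁ e₂ : X}
    (hs : ∀ x : X, ∃ a b : ℝ, x = a • e₁ + b • e₂) {P : Fin 4 → X} (hP : ¬ StiffQuadruple P)
    {d : Fin 4 → Fin 4 → X} {c : Fin 4 → Fin 4 → ℝ} (hd0 : ∀ i j, i < j → d i j ≠ 0)
    (hd : ∀ i j, i < j → P i - P j = c i j • d i j)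
    (hc : ∀ i j, i < j → c i j ≠ 0) :
    ∃ φ : Fin 4 → Fin 4 → X →L[ℝ] ℝ, (∀ i j, i < j → IsSupport (d i j) (φ i j)) ∧
      functionalDet e₁ e₂ (φ 2 3) (φ 0 2) * functionalDet e₁ e₂ (φ 1 2) (φ 0 1) *
        functionalDet e₁ e₂ (φ 1 3) (φ 0 3) =
      functionalDet e₁ e₂ (φ 2 3) (φ 0 3) * functionalDet e₁ e₂ (φ 1 2) (φ 0 2) *
        functionalDet e₁ e₂ (φ 1 3) (φ 0 1) := by
  simp only [StiffQuadruple, RobustlyStiff, Stiff, Finset.mem_univ, forall_true_left,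
    SimpleGraph.top_adj] at hP
  push Not at hP
  obtain ⟨Φ, hΦ, u, hu, a, b, hab⟩ := hP
  have hex : ∀ i j : Fin 4, ∃ ψ : X →L[ℝ] ℝ, i < j →
      IsSupport (d i j) ψ ∧ ψ (u i - u j) = 0 := by
    intro i j
    by_cases hij : i < j
    · have h1 := hΦ i j hij.ne
      rw [hd i j hij] at h1
      obtain ⟨ψ, h2, h3⟩ := h1.exists_of_smul (hc i j hij)
      exact ⟨ψ, fun _ => ⟨h2, h3 _ (hu i j hij.ne)⟩⟩
    · exact ⟨0, fun h => absurd h hij⟩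
  choose φ hφ using hex
  have hφ0 : ∀ i j, i < j → φ i j ≠ 0 := fun i j hij => (hφ i j hij).1.ne_zero (hd0 i j hij)
  refine ⟨φ, fun i j hij => (hφ i j hij).1, ?_⟩
  have h12 := (hφ 1 2 (by decide)).2
  have h13 := (hφ 1 3 (by decide)).2
  have h23 := (hφ 2 3 (by decide)).2
  have hdiff : ∀ i j, u i - u j = -((u 0 - u i) - (u 0 - u j)) := fun i j => by abel
  rw [hdiff, map_neg, neg_eq_zero] at h12 h13 h23
  refine functionalDet_relation hs (hφ0 0 1 (by decide)) (hφ0 0 2 (by decide))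
    (hφ0 0 3 (by decide)) (hφ 0 1 (by decide)).2 (hφ 0 2 (by decide)).2 (hφ 0 3 (by decide)).2
    h12 h13 h23 ?_
  rintro ⟨h1, h2, h3⟩
  rw [sub_eq_zero] at h1 h2 h3
  have hall : ∀ i, u i = u 0 := by
    intro i
    fin_cases i
    exacts [rfl, h1.symm, h2.symm, h3.symm]
  exact hab ((hall a).trans (hall b).symm)

lemma Profile.degenerate {e₁ e₂ : X} {g : ℝ → ℝ}
    (h : Profile (fun τ => ‖e₁ + τ • e₂‖) g (fun s => ‖s • e₁ + e₂‖))
    (hs : ∀ x : X, ∃ a b : ℝ, x = a • e₁ + b • e₂) (hP : ∀ P : Fin 4 → X, ¬ StiffQuadruple P) :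
    Profile.Degenerate (fun τ => ‖e₁ + τ • e₂‖) g := by
  intro α β μ τ k ε hαβ hμα hμβ hk hε0 hε1 hεk
  have hk0 : k ≠ 0 := by
    rintro rfl
    exact hμα (by linarith)
  have hk1 : k - 1 ≠ 0 := by
    intro h1
    rw [sub_eq_zero.1 h1] at hk
    exact hαβ (by linarith)
  have hε1' : 1 - ε ≠ 0 := sub_ne_zero.2 hε1.symm
  have hεk' : k - ε ≠ 0 := sub_ne_zero.2 hεk.symm
  set α' := α + ε * (α - τ) / (1 - ε) with hα'
  set β' := β + ε * (β - τ) / (k - ε) with hβ'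
  have hα'' : (1 - ε) * α' = α - ε * τ := by rw [hα']; field_simp; ring
  have hβ'' : (k - ε) * β' = k * β - ε * τ := by rw [hβ']; field_simp; ring
  clear_value α' β'
  let σ : Fin 4 → Fin 4 → ℝ := ![![0, τ, α, β], ![0, 0, α', β'], ![0, 0, 0, μ], ![0, 0, 0, 0]]
  let c : Fin 4 → Fin 4 → ℝ :=
    ![![0, ε, 1, k], ![0, 0, 1 - ε, k - ε], ![0, 0, 0, k - 1], ![0, 0, 0, 0]]
  have hex : ∀ s : ℝ, ∃ φ : Fin 4 → Fin 4 → X →L[ℝ] ℝ,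
      (∀ i j, i < j → IsSupport (e₁ + (σ i j + s) • e₂) (φ i j)) ∧
      functionalDet e₁ e₂ (φ 2 3) (φ 0 2) * functionalDet e₁ e₂ (φ 1 2) (φ 0 1) *
        functionalDet e₁ e₂ (φ 1 3) (φ 0 3) =
      functionalDet e₁ e₂ (φ 2 3) (φ 0 3) * functionalDet e₁ e₂ (φ 1 2) (φ 0 2) *
        functionalDet e₁ e₂ (φ 1 3) (φ 0 1) := by
    intro s
    refine exists_relation_of_not_stiffQuadruple hs
      (hP ![0, -(ε • (e₁ + (τ + s) • e₂)), -(e₁ + (α + s) • e₂), -(k • (e₁ + (β + s) • e₂))])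
      (c := c) (fun i j _ => norm_pos_iff.1 (h.pos _)) ?_ ?_
    · intro i j hij
      fin_cases i <;> fin_cases j <;> simp at hij <;> simp [σ, c]
      · match_scalars <;> first | ring1 | linear_combination -hα''
      · match_scalars <;> first | ring1 | linear_combination -hβ''
      · match_scalars <;> first | ring1 | linear_combination -hk
    · intro i j hij
      fin_cases i <;> fin_cases j <;> simp at hij <;> simp [c, *]
  choose φ hφ hrel using hex
  have hlim : ∀ i j, i < j →
      Tendsto (fun s => φ s i j e₁) (𝓝[>] 0) (𝓝 (‖e₁ + σ i j • e₂‖ - σ i j * g (σ i j))) ∧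
      Tendsto (fun s => φ s i j e₂) (𝓝[>] 0) (𝓝 (g (σ i j))) := fun i j hij =>
    h.tendsto_isSupport fun s _ => hφ s i j hij
  have hdet : ∀ i j k l, i < j → k < l →
      Tendsto (fun s => functionalDet e₁ e₂ (φ s i j) (φ s k l)) (𝓝[>] 0)
        (𝓝 (bracket (fun τ => ‖e₁ + τ • e₂‖) g (σ i j) (σ k l))) := fun i j k l hij hkl =>
    ((hlim i j hij).1.mul (hlim k l hkl).2).sub ((hlim i j hij).2.mul (hlim k l hkl).1)
  exact tendsto_nhds_unique_of_eventuallyEq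
    (((hdet 2 3 0 2 (by decide) (by decide)).mul (hdet 1 2 0 1 (by decide) (by decide))).mul
      (hdet 1 3 0 3 (by decide) (by decide)))
    (((hdet 2 3 0 3 (by decide) (by decide)).mul (hdet 1 2 0 2 (by decide) (by decide))).mul
      (hdet 1 3 0 1 (by decide) (by decide))) (Eventually.of_forall hrel)

lemma parallelogram_of_not_stiffQuadruple (hdim : Module.finrank ℝ X = 2)
    (hP : ∀ P : Fin 4 → X, ¬ StiffQuadruple P) (x y : X) :
    ‖x + y‖ ^ 2 + ‖x - y‖ ^ 2 = 2 * ‖x‖ ^ 2 + 2 * ‖y‖ ^ 2 := by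
  have := finiteDimensional_of_finrank_eq_two hdim
  let b := Module.finBasisOfFinrankEq ℝ X hdim
  have hs : ∀ x : X, ∃ s t : ℝ, x = s • b 0 + t • b 1 := fun x =>
    ⟨b.repr x 0, b.repr x 1, by
      rw [← Fin.sum_univ_two fun i => b.repr x i • b i, b.sum_repr]⟩
  have hli : LinearIndependent ℝ ![b 0, b 1] := by
    convert b.linearIndependent using 1
    ext i
    fin_cases i <;> rfl
  obtain ⟨g, hg⟩ := exists_profile hli
  obtain ⟨m, n, hmn⟩ := hg.eq_quadratic (hg.degenerate hs hP)
  have hquad : ∀ s t : ℝ, ‖s • b 0 + t • b 1‖ ^ 2 = m * s ^ 2 + n * s * t + ‖b 1‖ ^ 2 * t ^ 2 := by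
    intro s t
    by_cases h0 : s = 0
    · simp [h0, norm_smul, mul_pow, mul_comm]
    · have h1 := hmn (t / s)
      have h2 : s • b 0 + t • b 1 = s • (b 0 + (t / s) • b 1) := by
        rw [smul_add, smul_smul, mul_div_cancel₀ _ h0]
      rw [h2, norm_smul, mul_pow, h1, Real.norm_eq_abs, sq_abs, zero_smul, zero_add]
      field_simp
      ring
  obtain ⟨s, t, rfl⟩ := hs x
  obtain ⟨s', t', rfl⟩ := hs y
  rw [show s • b 0 + t • b 1 + (s' • b 0 + t' • b 1) = (s + s') • b 0 + (t + t') • b 1 by module,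
    show s • b 0 + t • b 1 - (s' • b 0 + t' • b 1) = (s - s') • b 0 + (t - t') • b 1 by module]
  simp only [hquad]
  ring

/-- In a non-Euclidean plane the complete graph on four vertices has a stiff placement. -/
lemma hasStiffPlacement_of_isClique (hdim : Module.finrank ℝ X = 2)
    (hnE : ∃ x y : X, ‖x + y‖ ^ 2 + ‖x - y‖ ^ 2 ≠ 2 * ‖x‖ ^ 2 + 2 * ‖y‖ ^ 2)
    {V : Type*} {H : SimpleGraph V} {S : Finset V} (hS : S.card = 4) (hH : H.IsClique S) :
    HasStiffPlacement X S H := by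
  obtain ⟨P, hP⟩ : ∃ P : Fin 4 → X, StiffQuadruple P := by
    by_contra! hcon
    obtain ⟨x, y, hxy⟩ := hnE
    exact hxy (parallelogram_of_not_stiffQuadruple hdim hcon x y)
  let f : Fin 4 ≃ S := (S.equivFinOfCardEq hS).symm
  have hf : Function.Injective fun i => (f i : V) :=
    Subtype.val_injective.comp f.injective
  refine ⟨Function.extend (fun i => (f i : V)) P 0, fun Φ hΦ u hu => ?_⟩
  have key := hP (fun i j => Φ (f i) (f j)) (fun i _ j _ hij => by
    have := hΦ _ (f i).2 _ (f j).2 (hH (f i).2 (f j).2 (hf.ne hij))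
    simpa only [hf.extend_apply P 0 i, hf.extend_apply P 0 j] using this) (fun i => u (f i))
    (fun i _ j _ hij => hu _ (f i).2 _ (f j).2 (hH (f i).2 (f j).2 (hf.ne hij)))
  intro a ha b hb
  simpa using key (f.symm ⟨a, ha⟩) (Finset.mem_univ _) (f.symm ⟨b, hb⟩) (Finset.mem_univ _)

end FourPoints

section Sparse

variable {V : Type*}

open Classical in
/-- The number of neighbours of `a` in `T`. -/
noncomputable def degreeIn (H : SimpleGraph V) (T : Finset V) (a : V) : ℕ :=
  ∑ b ∈ T, if H.Adj a b then 1 else 0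

/-- The number of ordered pairs of adjacent vertices in `T`. -/
noncomputable def dartCount (H : SimpleGraph V) (T : Finset V) : ℕ :=
  ∑ a ∈ T, degreeIn H T a

/-- The subgraph of `H` induced on `S` is (2,2)-sparse. -/
def IsSparse (H : SimpleGraph V) (S : Finset V) : Prop :=
  ∀ T ⊆ S, T.Nonempty → dartCount H T + 4 ≤ 4 * T.card

/-- The subgraph of `H` induced on `S` is (2,2)-tight. -/
def IsTight (H : SimpleGraph V) (S : Finset V) : Prop :=
  IsSparse H S ∧ dartCount H S + 4 = 4 * S.card

lemma IsSparse.mono {H : SimpleGraph V} {S T : Finset V} (h : IsSparse H S) (hTS : T ⊆ S) :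
    IsSparse H T :=
  fun U hU => h U (hU.trans hTS)

variable {H : SimpleGraph V} {T A : Finset V} {a v k : V}

open Classical in
lemma degreeIn_eq_card : degreeIn H T a = (T.filter (H.Adj a)).card :=
  (Finset.card_filter _ _).symm

lemma degreeIn_le_card : degreeIn H T a ≤ T.card := by
  classical
  rw [degreeIn_eq_card]
  exact Finset.card_filter_le _ _

lemma degreeIn_insert [DecidableEq V] [Decidable (H.Adj a v)] (hv : v ∉ T) :
    degreeIn H (insert v T) a = degreeIn H T a + if H.Adj a v then 1 else 0 := by
  rw [degreeIn, Finset.sum_insert hv, add_comm, degreeIn]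
  congr

lemma dartCount_insert [DecidableEq V] (hv : v ∉ T) :
    dartCount H (insert v T) = dartCount H T + 2 * degreeIn H T v := by
  classical
  have h1 : degreeIn H (insert v T) v = degreeIn H T v := by
    rw [degreeIn_insert hv]
    simp
  have h2 : ∑ a ∈ T, degreeIn H (insert v T) a = dartCount H T + degreeIn H T v := by
    simp_rw [degreeIn_insert hv, Finset.sum_add_distrib, H.adj_comm _ v, dartCount]
    congr 1
  rw [dartCount, Finset.sum_insert hv, h1, h2]
  ring

lemma even_dartCount (H : SimpleGraph V) (T : Finset V) : Even (dartCount H T) := by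
  classical
  induction T using Finset.induction_on with
  | empty => simp [dartCount]
  | insert v T hv ih =>
    rw [dartCount_insert hv]
    exact ih.add (even_two_mul _)

lemma dartCount_union [DecidableEq V] (hA : Disjoint A T) :
    dartCount H (A ∪ T) = dartCount H A + dartCount H T + 2 * ∑ a ∈ A, degreeIn H T a := by
  classical
  induction A using Finset.induction_on with
  | empty => simp [dartCount]
  | insert v A hv ih =>
    rw [Finset.disjoint_insert_left] at hA
    have hd : degreeIn H (A ∪ T) v = degreeIn H A v + degreeIn H T v :=
      Finset.sum_union hA.2
    rw [Finset.insert_union, dartCount_insert (by simp [hv, hA.1]), ih hA.2, dartCount_insert hv,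
      Finset.sum_insert hv, hd]
    ring

lemma dartCount_congr {H' : SimpleGraph V} (h : ∀ a ∈ T, ∀ b ∈ T, H.Adj a b ↔ H'.Adj a b) :
    dartCount H T = dartCount H' T := by
  classical
  refine Finset.sum_congr rfl fun a ha => Finset.sum_congr rfl fun b hb => ?_
  simp only [h a ha b hb]

lemma contract_adj_of_notMem [DecidableEq V] {b : V} (hk : k ∈ T) (ha : a ∉ T) (hb : b ∉ T) :
    H.Adj a b ↔ (contract H T k).Adj a b := by
  constructor
  · exact fun h => ⟨h.ne, a, b, by simp [ha], by simp [hb], h⟩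
  · rintro ⟨-, a', b', h1, h2, h⟩
    split_ifs at h1 h2 <;> subst h1 <;> subst h2 <;> first | exact h | contradiction

lemma contract_adj_left [DecidableEq V] (hk : k ∈ T) (ha : a ∉ T) :
    (contract H T k).Adj k a ↔ ∃ b ∈ T, H.Adj a b := by
  constructor
  · rintro ⟨-, b, a', h1, h2, h⟩
    split_ifs at h1 h2 with h3 h4 h5
    · exact absurd (h2 ▸ hk) ha
    · exact ⟨b, h3, h2 ▸ h.symm⟩
    · exact absurd (h2 ▸ hk) ha
    · exact absurd (h1 ▸ hk) h3
  · rintro ⟨b, hb, h⟩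
    exact ⟨fun h => ha (h ▸ hk), b, a, by simp [hb], by simp [ha], h.symm⟩

lemma dartCount_contract [DecidableEq V] (hk : k ∈ T) (hA : Disjoint A T)
    (hdeg : ∀ a ∈ A, degreeIn H T a ≤ 1) :
    dartCount (contract H T k) (insert k A) + dartCount H T = dartCount H (A ∪ T) := by
  classical
  have hAT : ∀ a ∈ A, a ∉ T := fun a ha => Finset.disjoint_left.1 hA ha
  have h1 : dartCount H A = dartCount (contract H T k) A :=
    dartCount_congr fun a ha b hb => contract_adj_of_notMem hk (hAT a ha) (hAT b hb)
  have h2 : degreeIn (contract H T k) A k = ∑ a ∈ A, degreeIn H T a := by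
    refine Finset.sum_congr rfl fun a ha => ?_
    rw [contract_adj_left hk (hAT a ha)]
    have h3 := hdeg a ha
    split_ifs with h
    · obtain ⟨b, hb, hab⟩ := h
      have : 0 < degreeIn H T a := by
        rw [degreeIn_eq_card]
        exact Finset.card_pos.2 ⟨b, by simp [hb, hab]⟩
      omega
    · rw [eq_comm, degreeIn]
      refine Finset.sum_eq_zero fun b hb => if_neg fun hab => h ⟨b, hb, hab⟩
  rw [dartCount_insert fun h => hAT k h hk, dartCount_union hA, h1, h2]
  ring

lemma IsTight.contract [DecidableEq V] {S : Finset V} (hS : IsTight H S) (hTS : T ⊆ S)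
    (hT : dartCount H T + 4 = 4 * T.card) (hk : k ∈ T)
    (hdeg : ∀ a ∈ S \ T, degreeIn H T a ≤ 1) :
    IsTight (contract H T k) (insert k (S \ T)) := by
  have hkS : k ∉ S \ T := by simp [hk]
  refine ⟨fun U hU hne => ?_, ?_⟩
  · by_cases hkU : k ∈ U
    · have hA : U.erase k ⊆ S \ T := fun a ha => by
        have := hU (Finset.mem_of_mem_erase ha)
        exact (Finset.mem_insert.1 this).resolve_left (Finset.ne_of_mem_erase ha)
      have hd : Disjoint (U.erase k) T := Finset.disjoint_of_subset_left hA Finset.sdiff_disjoint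
      have h1 := dartCount_contract hk hd fun a ha => hdeg a (hA ha)
      rw [Finset.insert_erase hkU] at h1
      have h2 := hS.1 (U.erase k ∪ T)
        (Finset.union_subset (hA.trans Finset.sdiff_subset) hTS) ⟨k, by simp [hk]⟩
      rw [Finset.card_union_of_disjoint hd, Finset.card_erase_of_mem hkU] at h2
      have := Finset.card_pos.2 hne
      omega
    · have hA : U ⊆ S \ T := (Finset.subset_insert_iff_of_notMem hkU).1 hU
      have hn : ∀ a ∈ U, a ∉ T := fun a ha => (Finset.mem_sdiff.1 (hA ha)).2
      rw [← dartCount_congr fun a ha b hb => contract_adj_of_notMem hk (hn a ha) (hn b hb)]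
      exact hS.1 U (hA.trans Finset.sdiff_subset) hne
  · have h1 := dartCount_contract hk Finset.sdiff_disjoint hdeg
    rw [Finset.sdiff_union_of_subset hTS] at h1
    rw [Finset.card_insert_of_notMem hkS, Finset.card_sdiff_of_subset hTS]
    have := Finset.card_le_card hTS
    have := hS.2
    omega

lemma dartCount_sup_edge {x y : V} (hxy : x ≠ y) (hn : ¬ H.Adj x y) [Decidable (x ∈ T ∧ y ∈ T)] :
    dartCount (H ⊔ SimpleGraph.edge x y) T =
      dartCount H T + if x ∈ T ∧ y ∈ T then 2 else 0 := by
  classical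
  have h1 : ∀ a b [Decidable ((H ⊔ SimpleGraph.edge x y).Adj a b)] [Decidable (H.Adj a b)],
      (if (H ⊔ SimpleGraph.edge x y).Adj a b then 1 else 0) = (if H.Adj a b then 1 else 0) +
        ((if a = x then if b = y then 1 else 0 else 0) + if a = y then if b = x then 1 else 0 else 0) := by
    intro a b _ _
    have hn' : ¬ H.Adj y x := fun h => hn h.symm
    simp only [SimpleGraph.sup_adj, SimpleGraph.edge_adj]
    by_cases h1 : a = x <;> by_cases h2 : b = y <;> by_cases h3 : a = y <;> by_cases h4 : b = x <;>
      simp_all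
  have h2 : ∀ p q : V, ∑ a ∈ T, ∑ b ∈ T, (if a = p then if b = q then 1 else 0 else 0) =
      if p ∈ T ∧ q ∈ T then 1 else 0 := by
    intro p q
    by_cases hp : p ∈ T <;> by_cases hq : q ∈ T <;> simp [hp, hq]
  simp only [dartCount, degreeIn, h1, Finset.sum_add_distrib, h2]
  by_cases hx : x ∈ T <;> by_cases hy : y ∈ T <;> simp [hx, hy]

lemma dartCount_of_isClique (hT : H.IsClique T) : dartCount H T = T.card * (T.card - 1) := by
  classical
  have h : ∀ a ∈ T, degreeIn H T a = T.card - 1 := by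
    intro a ha
    rw [degreeIn_eq_card, ← Finset.card_erase_of_mem ha]
    congr 1
    ext b
    simp only [Finset.mem_filter, Finset.mem_erase]
    exact ⟨fun h => ⟨h.2.ne', h.1⟩, fun h => ⟨h.2, hT ha h.2 h.1.symm⟩⟩
  rw [dartCount, Finset.sum_congr rfl h, Finset.sum_const, smul_eq_mul]

variable {X : Type*} [NormedAddCommGroup X] [NormedSpace ℝ X] [Fintype V]

theorem hasStiffPlacement_of_isTight (hdim : Module.finrank ℝ X = 2)
    (hnE : ∃ x y : X, ‖x + y‖ ^ 2 + ‖x - y‖ ^ 2 ≠ 2 * ‖x‖ ^ 2 + 2 * ‖y‖ ^ 2)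
    {S : Finset V} {H : SimpleGraph V} (hS : IsTight H S) : HasStiffPlacement X S H := by
  classical
  have := finiteDimensional_of_finrank_eq_two hdim
  induction hn : S.card using Nat.strong_induction_on generalizing S H with
  | _ n ih =>
  subst hn
  replace ih : ∀ {T : Finset V} {H' : SimpleGraph V}, T.card < S.card → IsTight H' T →
      HasStiffPlacement X T H' := fun h h' => ih _ h h' rfl
  rcases Nat.lt_or_ge 1 S.card with hcard | hcard
  swap
  · refine ⟨0, fun Φ _ u _ a ha b hb => ?_⟩
    rw [Finset.card_le_one.1 hcard a ha b hb]
  by_cases hex : ∃ T ⊆ S, 2 ≤ T.card ∧ T.card < S.card ∧ dartCount H T + 4 = 4 * T.card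
  · obtain ⟨T, hTmem, hTmax⟩ := (S.powerset.filter fun T =>
      2 ≤ T.card ∧ T.card < S.card ∧ dartCount H T + 4 = 4 * T.card).exists_max_image
      Finset.card (by
        obtain ⟨T, h1, h2⟩ := hex
        exact ⟨T, by simpa [h1] using h2⟩)
    simp only [Finset.mem_filter, Finset.mem_powerset] at hTmem hTmax
    obtain ⟨hTS, hT2, hTlt, hT⟩ := hTmem
    have hTstiff : HasStiffPlacement X T H := ih hTlt ⟨hS.1.mono hTS, hT⟩
    by_cases hw : ∃ w ∈ S \ T, 2 ≤ degreeIn H T w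
    · obtain ⟨w, hw, hdeg⟩ := hw
      rw [Finset.mem_sdiff] at hw
      have hsub : insert w T ⊆ S := Finset.insert_subset hw.1 hTS
      have h1 := hS.1 _ hsub (Finset.insert_nonempty _ _)
      have hcw := Finset.card_insert_of_notMem hw.2
      have h2 := dartCount_insert (H := H) hw.2
      have hle := Finset.card_le_card hsub
      have hSeq : insert w T = S := by
        refine Finset.eq_of_subset_of_card_le hsub ?_
        by_contra hlt
        have := hTmax (insert w T) ⟨hsub, by omega, by omega, by omega⟩
        omega
      rw [degreeIn_eq_card] at hdeg
      obtain ⟨x, hx, y, hy, hxy⟩ := Finset.one_lt_card.1 hdeg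
      rw [Finset.mem_filter] at hx hy
      exact hSeq ▸ hTstiff.insert hdim hw.2 hx.1 hy.1 hxy hx.2 hy.2
    · push Not at hw
      obtain ⟨k, hk⟩ := Finset.card_pos.1 (by omega : 0 < T.card)
      refine hTstiff.of_contract (ih ?_ (hS.contract hTS hT hk fun a ha => ?_)) hTS hk
      · rw [Finset.card_insert_of_notMem (by simp [hk]), Finset.card_sdiff_of_subset hTS]
        omega
      · have := hw a ha
        omega
  · push Not at hex
    obtain ⟨v, hvS, hv⟩ : ∃ v ∈ S, degreeIn H S v < 4 := by
      refine Finset.exists_lt_of_sum_lt ?_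
      have := hS.2
      rw [dartCount] at this
      rw [Finset.sum_const, smul_eq_mul]
      omega
    set R := S.erase v with hR
    have hvR : v ∉ R := Finset.notMem_erase v S
    have hSR : insert v R = S := Finset.insert_erase hvS
    have hRS : R ⊆ S := Finset.erase_subset v S
    have hRc : R.card + 1 = S.card := Finset.card_erase_add_one hvS
    have hdeg : degreeIn H S v = degreeIn H R v := by
      rw [← hSR]
      rw [degreeIn_insert hvR]
      simp
    rw [hdeg] at hv
    have hdart := dartCount_insert (H := H) hvR
    rw [hSR] at hdart
    have hSd := hS.2
    have hRsparse := hS.1 R hRS (Finset.card_pos.1 (by omega))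
    have hdle := degreeIn_le_card (H := H) (T := R) (a := v)
    have hthree : degreeIn H R v = 3 := by
      by_contra h3
      exact hex R hRS (by omega) (by omega) (by omega)
    have key : ∀ x y z, x ∈ R → y ∈ R → z ∈ R → x ≠ y → z ≠ x → z ≠ y → H.Adj v x → H.Adj v y →
        H.Adj v z → ¬ H.Adj x y → HasStiffPlacement X S H := by
      intro x y z hx hy hz hxy hzx hzy hvx hvy hvz hn
      have ht : IsTight (H ⊔ SimpleGraph.edge x y) R := by
        refine ⟨fun U hU hne => ?_, ?_⟩
        · rw [dartCount_sup_edge hxy hn]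
          have h1 := hS.1 U (hU.trans hRS) hne
          split_ifs with h
          · have h2 : 2 ≤ U.card := Finset.one_lt_card.2 ⟨x, h.1, y, h.2, hxy⟩
            have h3 := Finset.card_le_card hU
            have h4 := hex U (hU.trans hRS) h2 (by omega)
            obtain ⟨m, hm⟩ := even_dartCount H U
            omega
          · exact h1
        · rw [dartCount_sup_edge hxy hn, if_pos ⟨hx, hy⟩]
          omega
      exact hSR ▸ (ih (by omega) ht).insert_of_edge hdim hvR hx hy hz hxy hzx hzy hvx hvy hvz
    rw [degreeIn_eq_card, Finset.card_eq_three] at hthree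
    obtain ⟨x, y, z, hxy, hxz, hyz, hxyz⟩ := hthree
    have hmem : ∀ a, a ∈ R ∧ H.Adj v a ↔ a = x ∨ a = y ∨ a = z := fun a => by
      simpa using Finset.ext_iff.1 hxyz a
    obtain ⟨hx, hvx⟩ := (hmem x).2 (by simp)
    obtain ⟨hy, hvy⟩ := (hmem y).2 (by simp)
    obtain ⟨hz, hvz⟩ := (hmem z).2 (by simp)
    by_cases h1 : H.Adj x y
    swap
    · exact key x y z hx hy hz hxy hxz.symm hyz.symm hvx hvy hvz h1
    by_cases h2 : H.Adj x z
    swap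
    · exact key x z y hx hz hy hxz hxy.symm hyz hvx hvz hvy h2
    by_cases h3 : H.Adj y z
    swap
    · exact key y z x hy hz hx hyz hxy hxz hvy hvz hvx h3
    have hcl : H.IsClique (({v, x, y, z} : Finset V) : Set V) := by
      intro a ha b hb hab
      simp only [Finset.coe_insert, Finset.coe_singleton, Set.mem_insert_iff,
        Set.mem_singleton_iff] at ha hb
      rcases ha with rfl | rfl | rfl | rfl <;> rcases hb with rfl | rfl | rfl | rfl <;>
        first | exact absurd rfl hab | assumption | (apply SimpleGraph.Adj.symm; assumption)
    have hc4 : ({v, x, y, z} : Finset V).card = 4 := by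
      have hvx := hvx.ne
      have hvy := hvy.ne
      have hvz := hvz.ne
      simp [*]
    have hsub : ({v, x, y, z} : Finset V) ⊆ S := by
      simp [Finset.insert_subset_iff, hvS, hRS hx, hRS hy, hRS hz]
    have hd := dartCount_of_isClique hcl
    have heq : ({v, x, y, z} : Finset V) = S := by
      refine Finset.eq_of_subset_of_card_le hsub ?_
      by_contra hlt
      refine hex _ hsub (by omega) (by omega) ?_
      rw [hd, hc4]
    rw [← heq]
    exact hasStiffPlacement_of_isClique hdim hnE hc4 hcl

end Sparse

section Counting

variable {V : Type*} [Fintype V]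

lemma dartCount_univ (H : SimpleGraph V) :
    dartCount H Finset.univ = 2 * H.edgeSet.ncard := by
  classical
  rw [← SimpleGraph.coe_edgeFinset, Set.ncard_coe_finset, ← H.sum_degrees_eq_twice_card_edges,
    dartCount]
  refine Finset.sum_congr rfl fun a _ => ?_
  rw [degreeIn_eq_card, ← SimpleGraph.card_neighborFinset_eq_degree]
  congr 1
  ext b
  simp

lemma dartCount_eq_two_mul_ncard_induce (H : SimpleGraph V) (T : Finset V) :
    dartCount H T = 2 * ((⊤ : H.Subgraph).induce (T : Set V)).edgeSet.ncard := by
  classical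
  set K := (⊤ : H.Subgraph).induce (T : Set V) with hK
  have hadj : ∀ a b, K.spanningCoe.Adj a b ↔ a ∈ T ∧ b ∈ T ∧ H.Adj a b := by simp [hK]
  have hedge : K.spanningCoe.edgeSet = K.edgeSet := by simp
  rw [← hedge, ← dartCount_univ]
  have h1 : ∀ a ∉ T, degreeIn K.spanningCoe Finset.univ a = 0 := fun a ha =>
    Finset.sum_eq_zero fun b _ => if_neg fun h => ha ((hadj a b).1 h).1
  rw [dartCount, dartCount, ← Finset.sum_subset (Finset.subset_univ T) fun a _ ha => h1 a ha]
  refine Finset.sum_congr rfl fun a ha => ?_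
  rw [degreeIn_eq_card, degreeIn_eq_card]
  congr 1
  ext b
  simp only [Finset.mem_filter, Finset.mem_univ, true_and, hadj, ha]

lemma isTight_univ [Nonempty V] {H : SimpleGraph V}
    (hsparse : ∀ K : H.Subgraph, K.verts.Nonempty → K.edgeSet.ncard ≤ 2 * K.verts.ncard - 2)
    (hcard : H.edgeSet.ncard = 2 * Fintype.card V - 2) : IsTight H Finset.univ := by
  refine ⟨fun T _ hT => ?_, ?_⟩
  · have h := hsparse ((⊤ : H.Subgraph).induce (T : Set V)) (by simpa using hT)
    rw [SimpleGraph.Subgraph.induce_verts, Set.ncard_coe_finset] at h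
    rw [dartCount_eq_two_mul_ncard_induce]
    have := hT.card_pos
    omega
  · rw [dartCount_univ, hcard, Finset.card_univ]
    have := Fintype.card_pos (α := V)
    omega

end Counting

section Rows

variable {X : Type*} [NormedAddCommGroup X] [NormedSpace ℝ X] {V : Type*}

/-- The row of the rigidity operator of `p` indexed by an unordered pair of vertices. -/
noncomputable def rigidityRow (p : V → X) (e : Sym2 V) : Module.Dual ℝ (V → X) :=
  (fderiv ℝ (fun x : X => ‖x‖) (p e.out.1 - p e.out.2)).toLinearMap ∘ₗ
    (LinearMap.proj (R := ℝ) (φ := fun _ => X) e.out.1 - LinearMap.proj e.out.2)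

lemma fderiv_norm_sub_rev (x y z w : X) :
    fderiv ℝ (fun x : X => ‖x‖) (y - x) (w - z) = fderiv ℝ (fun x : X => ‖x‖) (x - y) (z - w) := by
  have h := fderiv_norm_smul_neg (E := X) (x := x - y) (t := -1) (by norm_num)
  rw [neg_one_smul, neg_sub] at h
  rw [h, neg_apply, ← map_neg, neg_sub]

lemma rigidityRow_apply (p u : V → X) (v w : V) :
    rigidityRow p s(v, w) u = fderiv ℝ (fun x : X => ‖x‖) (p v - p w) (u v - u w) := by
  have h : s((Quot.out s(v, w)).1, (Quot.out s(v, w)).2) = s(v, w) := Quot.out_eq _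
  have h' : rigidityRow p s(v, w) u = fderiv ℝ (fun x : X => ‖x‖)
      (p (Quot.out s(v, w)).1 - p (Quot.out s(v, w)).2)
      (u (Quot.out s(v, w)).1 - u (Quot.out s(v, w)).2) := rfl
  rw [h']
  rcases Sym2.eq_iff.1 h with ⟨h1, h2⟩ | ⟨h1, h2⟩
  · rw [h1, h2]
  · rw [h1, h2, fderiv_norm_sub_rev]

open Classical in
/-- Placements of the vertices outside `S`, together with a common position for `S`. -/
noncomputable def extendConst (X : Type*) [NormedAddCommGroup X] [NormedSpace ℝ X] (S : Set V) :
    ((↥Sᶜ → X) × X) →ₗ[ℝ] (V → X) where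
  toFun f v := if h : v ∈ S then f.2 else f.1 ⟨v, h⟩
  map_add' f g := by ext v; by_cases h : v ∈ S <;> simp [h]
  map_smul' c f := by ext v; by_cases h : v ∈ S <;> simp [h]

lemma extendConst_apply_of_mem {S : Set V} {v : V} (h : v ∈ S) (f : (↥Sᶜ → X) × X) :
    extendConst X S f v = f.2 := dif_pos h

lemma extendConst_injective {S : Set V} (hS : S.Nonempty) :
    Function.Injective (extendConst X S) := by
  rintro ⟨f, c⟩ ⟨g, d⟩ h
  obtain ⟨s, hs⟩ := hS
  refine Prod.ext (funext fun v => ?_) ?_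
  · have := congrFun h v
    simpa [extendConst, show (v : V) ∉ S from v.2] using this
  · simpa [extendConst, hs] using congrFun h s

variable [Fintype V]

lemma ncard_add_two_le (hdim : Module.finrank ℝ X = 2) {p : V → X} {b : Set (Sym2 V)}
    (hb : LinearIndepOn ℝ (rigidityRow p) b) {S : Set V} (hS : S.Nonempty)
    (hbS : ∀ v w, s(v, w) ∈ b → v ∈ S ∧ w ∈ S) : b.ncard + 2 ≤ 2 * S.ncard := by
  classical
  have := finiteDimensional_of_finrank_eq_two hdim
  have h1 : Module.finrank ℝ (Submodule.span ℝ (rigidityRow p '' b)) = b.ncard := by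
    rw [Set.image_eq_range, finrank_span_eq_card hb, Set.ncard_eq_toFinset_card',
      Set.toFinset_card]
  have h2 : Module.finrank ℝ (LinearMap.range (extendConst X S)) = 2 * Sᶜ.ncard + 2 := by
    rw [LinearMap.finrank_range_of_inj (extendConst_injective hS), Module.finrank_prod,
      Module.finrank_pi_fintype, hdim, Set.ncard_eq_toFinset_card', Set.toFinset_card]
    simp [mul_comm]
  have h3 : LinearMap.range (extendConst X S) ≤
      (Submodule.span ℝ (rigidityRow p '' b)).dualCoannihilator := by
    rintro _ ⟨f, rfl⟩
    rw [Submodule.mem_dualCoannihilator]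
    intro φ hφ
    induction hφ using Submodule.span_induction with
    | mem φ h =>
      obtain ⟨e, he, rfl⟩ := h
      induction e with | _ v w
      obtain ⟨hv, hw⟩ := hbS v w he
      rw [rigidityRow_apply, extendConst_apply_of_mem hv, extendConst_apply_of_mem hw, sub_self,
        map_zero]
    | zero => rfl
    | add φ ψ _ _ h h' => rw [LinearMap.add_apply, h, h', add_zero]
    | smul c φ _ h => rw [LinearMap.smul_apply, h, smul_zero]
  have h4 := Submodule.finrank_mono h3
  have h5 := Subspace.finrank_add_finrank_dualCoannihilator_eq
    (Submodule.span ℝ (rigidityRow p '' b))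
  rw [Module.finrank_pi_fintype, hdim, Finset.sum_const, Finset.card_univ, smul_eq_mul,
    ← Nat.card_eq_fintype_card, ← Set.ncard_add_ncard_compl S] at h5
  omega

lemma le_ncard_add_two [Nonempty V] (hdim : Module.finrank ℝ X = 2) {p : V → X} {b : Set (Sym2 V)}
    (hb : ∀ u : V → X, (∀ e ∈ b, rigidityRow p e u = 0) → ∃ c, ∀ v, u v = c) :
    2 * Fintype.card V ≤ b.ncard + 2 := by
  classical
  have := finiteDimensional_of_finrank_eq_two hdim
  have h1 : Module.finrank ℝ (Submodule.span ℝ (rigidityRow p '' b)) ≤ b.ncard := by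
    have := finrank_span_le_card (R := ℝ) (rigidityRow p '' b)
    rw [← Set.ncard_eq_toFinset_card'] at this
    exact this.trans (Set.ncard_image_le b.toFinite)
  have h2 : (Submodule.span ℝ (rigidityRow p '' b)).dualCoannihilator ≤
      LinearMap.range (LinearMap.pi fun _ : V => (LinearMap.id : X →ₗ[ℝ] X)) := by
    intro u hu
    rw [Submodule.mem_dualCoannihilator] at hu
    obtain ⟨c, hc⟩ := hb u fun e he => hu _ (Submodule.subset_span ⟨e, he, rfl⟩)
    exact ⟨c, funext fun v => (hc v).symm⟩
  have h3 := (Submodule.finrank_mono h2).trans (LinearMap.finrank_range_le _)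
  have h5 := Subspace.finrank_add_finrank_dualCoannihilator_eq
    (Submodule.span ℝ (rigidityRow p '' b))
  rw [Module.finrank_pi_fintype, hdim, Finset.sum_const, Finset.card_univ, smul_eq_mul] at h5
  omega

theorem exists_tight_of_rigid [Nonempty V] (hdim : Module.finrank ℝ X = 2) {G : SimpleGraph V}
    {p : V → X}
    (hp : ∀ u : V → X, (∀ v w : V, G.Adj v w →
      fderiv ℝ (fun x : X => ‖x‖) (p v - p w) (u v - u w) = 0) → ∃ c : X, ∀ v, u v = c) :
    ∃ H : SimpleGraph V, H ≤ G ∧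
      (∀ K : H.Subgraph, K.verts.Nonempty → K.edgeSet.ncard ≤ 2 * K.verts.ncard - 2) ∧
      H.edgeSet.ncard = 2 * Fintype.card V - 2 := by
  obtain ⟨b, hbG, -, hspan, hb⟩ := exists_linearIndepOn_extension
    (linearIndepOn_empty ℝ (rigidityRow p)) (Set.empty_subset G.edgeSet)
  have hedge : (SimpleGraph.fromEdgeSet b).edgeSet = b := by
    rw [SimpleGraph.edgeSet_fromEdgeSet, sdiff_eq_left, Set.disjoint_left]
    exact fun e he => G.not_isDiag_of_mem_edgeSet (hbG he)
  have hup : b.ncard + 2 ≤ 2 * Fintype.card V := by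
    have := ncard_add_two_le hdim hb Set.univ_nonempty (by simp)
    rwa [Set.ncard_univ, Nat.card_eq_fintype_card] at this
  have hlow : 2 * Fintype.card V ≤ b.ncard + 2 := by
    refine le_ncard_add_two hdim (p := p) fun u hu => hp u fun v w hvw => ?_
    rw [← rigidityRow_apply]
    have hle : Submodule.span ℝ (rigidityRow p '' b) ≤
        (LinearMap.ker (LinearMap.applyₗ u : Module.Dual ℝ (V → X) →ₗ[ℝ] ℝ)) := by
      rw [Submodule.span_le]
      rintro _ ⟨e, he, rfl⟩
      exact hu e he
    exact hle (hspan ⟨s(v, w), hvw, rfl⟩)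
  refine ⟨SimpleGraph.fromEdgeSet b, ?_, fun K hK => ?_, ?_⟩
  · rw [← SimpleGraph.edgeSet_subset_edgeSet, hedge]
    exact hbG
  · have hKb : K.edgeSet ⊆ b := K.edgeSet_subset.trans hedge.le
    have := ncard_add_two_le hdim (hb.mono hKb) hK fun v w h =>
      ⟨K.edge_vert h, K.edge_vert (K.adj_symm h)⟩
    omega
  · rw [hedge]
    omega

theorem exists_rigid_of_tight [Nonempty V] (hdim : Module.finrank ℝ X = 2)
    (hnE : ∃ x y : X, ‖x + y‖ ^ 2 + ‖x - y‖ ^ 2 ≠ 2 * ‖x‖ ^ 2 + 2 * ‖y‖ ^ 2)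
    {G H : SimpleGraph V} (hHG : H ≤ G)
    (hsparse : ∀ K : H.Subgraph, K.verts.Nonempty → K.edgeSet.ncard ≤ 2 * K.verts.ncard - 2)
    (hcard : H.edgeSet.ncard = 2 * Fintype.card V - 2) :
    ∃ p : V → X,
      (∀ v w : V, G.Adj v w → DifferentiableAt ℝ (fun x : X => ‖x‖) (p v - p w)) ∧
      (∀ u : V → X, (∀ v w : V, G.Adj v w →
        fderiv ℝ (fun x : X => ‖x‖) (p v - p w) (u v - u w) = 0) ↔ ∃ c : X, ∀ v, u v = c) := by
  have := finiteDimensional_of_finrank_eq_two hdim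
  have := nontrivial_of_finrank_eq_two hdim
  obtain ⟨q, hq⟩ := hasStiffPlacement_of_isTight hdim hnE (isTight_univ hsparse hcard)
  obtain ⟨p, hdiff, hp⟩ := hq.exists_wellPositioned
  refine ⟨p, fun v w h => hdiff v w h.ne, fun u => ⟨fun hu => ?_, ?_⟩⟩
  · have hconst := hp (fun v w => fderiv ℝ (fun x : X => ‖x‖) (p v - p w))
      (fun v _ w _ h => isSupport_fderiv (hdiff v w h.ne)) u fun v _ w _ h => hu v w (hHG h)
    exact ⟨u (Classical.arbitrary V), fun v =>
      hconst v (Finset.mem_univ v) _ (Finset.mem_univ _)⟩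
  · rintro ⟨c, hc⟩ v w -
    rw [hc v, hc w, sub_self, map_zero]

end Rows

end NormedPlane

/-- In a non-Euclidean normed plane `X`, a finite simple graph `G`
with at least one vertex has an infinitesimally rigid well-positioned placement
(one whose rigidity operator has kernel exactly the constant maps) if and only if
`G` contains a spanning (2,2)-tight subgraph. -/
theorem rigid_iff_contains_spanning_two_two_tight
    (X : Type*) [NormedAddCommGroup X] [NormedSpace ℝ X]
    (hdim : Module.finrank ℝ X = 2)
    (hnE : ∃ x y : X, ‖x + y‖ ^ 2 + ‖x - y‖ ^ 2 ≠ 2 * ‖x‖ ^ 2 + 2 * ‖y‖ ^ 2)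
    (V : Type*) [Fintype V] [Nonempty V] (G : SimpleGraph V) :
    (∃ p : V → X,
      (∀ v w : V, G.Adj v w → DifferentiableAt ℝ (fun x : X => ‖x‖) (p v - p w)) ∧
      (∀ u : V → X,
        (∀ v w : V, G.Adj v w →
            fderiv ℝ (fun x : X => ‖x‖) (p v - p w) (u v - u w) = 0)
          ↔ ∃ c : X, ∀ v, u v = c))
    ↔ (∃ H : SimpleGraph V, H ≤ G ∧
        (∀ K : H.Subgraph, K.verts.Nonempty →
          K.edgeSet.ncard ≤ 2 * K.verts.ncard - 2) ∧
        H.edgeSet.ncard = 2 * Fintype.card V - 2) := by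
  constructor
  · rintro ⟨p, -, hp⟩
    exact NormedPlane.exists_tight_of_rigid hdim fun u => (hp u).1
  · rintro ⟨H, hHG, hsparse, hcard⟩
    exact NormedPlane.exists_rigid_of_tight hdim hnE hHG hsparse hcard
end

section
/- Let X be a two-dimensional real normed space whose norm is not induced by an inner product. Then the complete graph K₄ on four vertices is rigid in X: there exists a placement p : {1,2,3,4} → X with the norm of X Fréchet differentiable at p_i − p_j for all i ≠ j, such that every u : {1,2,3,4} → X satisfying D(p_i − p_j)(u_i − u_j) = 0 for all i ≠ j is a constant map. -/
open Filter Topology Asymptotics MeasureTheory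

section NormDerivative

variable {X : Type*} [NormedAddCommGroup X] [NormedSpace ℝ X]

/-- The norm is differentiable at `x`. -/
abbrev IsSmoothPoint (x : X) : Prop := DifferentiableAt ℝ (fun y : X => ‖y‖) x

/-- The derivative of the norm at `x`. -/
noncomputable abbrev normDeriv (x : X) : X →L[ℝ] ℝ := fderiv ℝ (fun y : X => ‖y‖) x

lemma normDeriv_le (x w : X) : normDeriv x w ≤ ‖w‖ := by
  have h : ‖normDeriv x‖ ≤ 1 :=
    NNReal.coe_one ▸ norm_fderiv_le_of_lipschitz ℝ lipschitzWith_one_norm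
  calc normDeriv x w ≤ ‖normDeriv x w‖ := le_abs_self _
    _ ≤ 1 * ‖w‖ := (normDeriv x).le_of_opNorm_le h w
    _ = ‖w‖ := one_mul _

lemma IsSmoothPoint.normDeriv_self {x : X} (hx : IsSmoothPoint x) : normDeriv x x = ‖x‖ :=
  hx.fderiv_norm_self

lemma normDeriv_neg (x : X) : normDeriv (-x) = -normDeriv x := by
  simpa using fderiv_norm_smul_neg (x := x) (t := -1) (by norm_num)

lemma IsSmoothPoint.smul {x : X} (hx : IsSmoothPoint x) {t : ℝ} (ht : t ≠ 0) :
    IsSmoothPoint (t • x) :=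
  (differentiableAt_norm_smul ht).1 hx

lemma IsSmoothPoint.neg {x : X} (hx : IsSmoothPoint x) : IsSmoothPoint (-x) := by
  simpa using hx.smul (t := -1) (by norm_num)

lemma IsSmoothPoint.ne_zero [Nontrivial X] {x : X} (hx : IsSmoothPoint x) : x ≠ 0 := by
  rintro rfl
  exact not_differentiableAt_norm_zero X hx

lemma IsSmoothPoint.normDeriv_eq {x : X} (hx : IsSmoothPoint x) {g : X →L[ℝ] ℝ}
    (hgx : g x = ‖x‖) (hg : ∀ w, g w ≤ ‖w‖) : normDeriv x = g := by
  have hmin : IsLocalMin (fun w : X => ‖w‖ - g w) x :=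
    Eventually.of_forall fun w => by
      simp only [hgx, sub_self]
      exact sub_nonneg.2 (hg w)
  have hd : HasFDerivAt (fun w : X => ‖w‖ - g w) (normDeriv x - g) x :=
    hx.hasFDerivAt.sub g.hasFDerivAt
  exact sub_eq_zero.1 (hmin.hasFDerivAt_eq_zero hd)

lemma normDeriv_add_of_eq {a b : X} (ha : IsSmoothPoint a) (hb : IsSmoothPoint b)
    (hab : IsSmoothPoint (a + b)) (h : normDeriv a = normDeriv b) :
    normDeriv (a + b) = normDeriv a := by
  refine hab.normDeriv_eq (le_antisymm (normDeriv_le _ _) ?_) (normDeriv_le a)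
  rw [map_add, ha.normDeriv_self, h, hb.normDeriv_self]
  exact norm_add_le a b

lemma IsSmoothPoint.norm_le_norm_add_smul {z w : X} (hz : IsSmoothPoint z)
    (h : normDeriv z w = 0) (t : ℝ) : ‖z‖ ≤ ‖z + t • w‖ := by
  have := normDeriv_le z (z + t • w)
  rwa [map_add, map_smul, h, smul_zero, add_zero, hz.normDeriv_self] at this

end NormDerivative

section Plane

variable {X : Type*} [NormedAddCommGroup X] [NormedSpace ℝ X]

lemma exists_smul_add_smul_eq (hdim : Module.finrank ℝ X = 2) {x y : X}
    (h : LinearIndependent ℝ ![x, y]) (w : X) : ∃ a b : ℝ, a • x + b • y = w := by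
  have : FiniteDimensional ℝ X := Module.finite_of_finrank_pos (by omega)
  have hs := h.span_eq_top_of_card_eq_finrank' (by simp [hdim])
  have hw : w ∈ Submodule.span ℝ (Set.range ![x, y]) := hs ▸ Submodule.mem_top
  rwa [Matrix.range_cons, Matrix.range_cons, Matrix.range_empty, Set.union_empty,
    Set.singleton_union, Submodule.mem_span_pair] at hw

/-- Two derivatives of the norm which do not agree up to sign have no common zero. -/
lemma eq_zero_of_normDeriv_eq_zero (hdim : Module.finrank ℝ X = 2) {a b : X}
    (ha : IsSmoothPoint a) (hb : IsSmoothPoint b) (h1 : normDeriv a ≠ normDeriv b)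
    (h2 : normDeriv a ≠ -normDeriv b) {z : X} (hza : normDeriv a z = 0)
    (hzb : normDeriv b z = 0) : z = 0 := by
  have : Nontrivial X := Module.nontrivial_of_finrank_pos (R := ℝ) (by omega)
  by_contra hz
  have ha0 : ‖a‖ ≠ 0 := norm_ne_zero_iff.2 ha.ne_zero
  have hli : LinearIndependent ℝ ![z, a] := by
    rw [LinearIndependent.pair_iff]
    intro s t hst
    have h := congrArg (normDeriv a) hst
    simp only [map_add, map_smul, hza, ha.normDeriv_self, smul_eq_mul, mul_zero, zero_add,
      map_zero, mul_eq_zero, ha0, or_false] at h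
    subst h
    simpa [hz] using hst
  set c : ℝ := normDeriv b a / ‖a‖ with hc
  have hbc : normDeriv b = c • normDeriv a := by
    ext w
    obtain ⟨s, t, rfl⟩ := exists_smul_add_smul_eq hdim hli w
    simp only [map_add, map_smul, hza, hzb, ha.normDeriv_self, smul_eq_mul, mul_zero, zero_add,
      smul_apply, hc]
    field_simp
  have hn : |c| = 1 := by
    have := congrArg norm hbc
    rwa [norm_smul, norm_fderiv_norm ha, norm_fderiv_norm hb, mul_one, eq_comm] at this
  rcases eq_or_eq_neg_of_abs_eq hn with h | h
  · exact h1 (by simp [hbc, h])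
  · exact h2 (by rw [hbc, h]; module)

lemma exists_dual_pair (hdim : Module.finrank ℝ X = 2) {f g : X →L[ℝ] ℝ}
    (h : ∀ z, f z = 0 → g z = 0 → z = 0) :
    ∃ k l : X, ∀ z, z = f z • k + g z • l := by
  have : FiniteDimensional ℝ X := Module.finite_of_finrank_pos (by omega)
  let F : X →ₗ[ℝ] ℝ × ℝ := (f : X →ₗ[ℝ] ℝ).prod (g : X →ₗ[ℝ] ℝ)
  have hinj : Function.Injective F := by
    rw [injective_iff_map_eq_zero]
    intro z hz
    exact h z (congrArg Prod.fst hz) (congrArg Prod.snd hz)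
  have hsurj : Function.Surjective F :=
    (LinearMap.injective_iff_surjective_of_finrank_eq_finrank (by simp [hdim])).1 hinj
  obtain ⟨k, hk⟩ := hsurj (1, 0)
  obtain ⟨l, hl⟩ := hsurj (0, 1)
  refine ⟨k, l, fun z => hinj ?_⟩
  rw [map_add, map_smul, map_smul, hk, hl]
  simp [F]

/-- The flexes of a triangle with edges `a`, `b`, `a - b` form a line, provided the derivatives of
the norm at `a` and `b` are independent. -/
lemma normDeriv_flex_unique (hdim : Module.finrank ℝ X = 2) {f g q : X →L[ℝ] ℝ}
    (h : ∀ z, f z = 0 → g z = 0 → z = 0) (hq : q ≠ 0) {v w v' w' : X} (hv : f v = 0)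
    (hw : g w = 0) (hvw : q v = q w) (hv' : f v' = 0) (hw' : g w' = 0) (hvw' : q v' = q w')
    (hne : v' ≠ 0 ∨ w' ≠ 0) : ∃ c : ℝ, v = c • v' ∧ w = c • w' := by
  obtain ⟨k, l, hkl⟩ := exists_dual_pair hdim h
  have e1 : v = g v • l := by simpa [hv] using hkl v
  have e2 : w = f w • k := by simpa [hw] using hkl w
  have e3 : v' = g v' • l := by simpa [hv'] using hkl v'
  have e4 : w' = f w' • k := by simpa [hw'] using hkl w'
  have hq1 : g v * q l = f w * q k := by
    rw [e1, e2] at hvw; simpa using hvw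
  have hq2 : g v' * q l = f w' * q k := by
    rw [e3, e4] at hvw'; simpa using hvw'
  have hkl0 : q k ≠ 0 ∨ q l ≠ 0 := by
    by_contra! hcon
    refine hq (ContinuousLinearMap.ext fun z => ?_)
    rw [hkl z]; simp [hcon.1, hcon.2]
  generalize g v = α at e1 hq1
  generalize f w = β at e2 hq1
  generalize g v' = α' at e3 hq2
  generalize f w' = β' at e4 hq2
  subst e1 e2 e3 e4
  have hdet : α * β' = α' * β := by
    rcases hkl0 with h0 | h0 <;> apply mul_right_cancel₀ h0
    · linear_combination α * (-hq2) + α' * hq1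
    · linear_combination β' * hq1 - β * hq2
  rcases hne with h0 | h0
  · have hα : α' ≠ 0 := fun h => h0 (by rw [h, zero_smul])
    refine ⟨α / α', ?_, ?_⟩
    · rw [smul_smul, div_mul_cancel₀ _ hα]
    · rw [smul_smul, div_mul_eq_mul_div, hdet, mul_div_cancel_left₀ _ hα]
  · have hβ : β' ≠ 0 := fun h => h0 (by rw [h, zero_smul])
    refine ⟨β / β', ?_, ?_⟩
    · rw [smul_smul, div_mul_eq_mul_div, mul_comm β, ← hdet, mul_div_cancel_right₀ _ hβ]
    · rw [smul_smul, div_mul_cancel₀ _ hβ]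

end Plane

section Parallelogram

variable {X : Type*} [NormedAddCommGroup X] [NormedSpace ℝ X]

/-- Every parallelogram with both diagonals whose sides have independent norm derivatives has a
nontrivial infinitesimal flex, with side velocities `v` and `w`. -/
def ParallelogramsFlexible (X : Type*) [NormedAddCommGroup X] [NormedSpace ℝ X] : Prop :=
  ∀ a b : X, IsSmoothPoint a → IsSmoothPoint b → IsSmoothPoint (a + b) → IsSmoothPoint (a - b) →
    normDeriv a ≠ normDeriv b → normDeriv a ≠ -normDeriv b →
    ∃ v w : X, (v ≠ 0 ∨ w ≠ 0) ∧ normDeriv a v = 0 ∧ normDeriv b w = 0 ∧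
      normDeriv (a + b) (v + w) = 0 ∧ normDeriv (a - b) (v - w) = 0

lemma parallelogramsFlexible_of_forall_placement (hdim : Module.finrank ℝ X = 2)
    (h : ∀ p : Fin 4 → X, (∀ i j : Fin 4, i ≠ j → IsSmoothPoint (p i - p j)) →
      ∃ u : Fin 4 → X, (∀ i j : Fin 4, i ≠ j → normDeriv (p i - p j) (u i - u j) = 0) ∧
        ¬∃ c : X, ∀ i, u i = c) :
    ParallelogramsFlexible X := by
  intro a b ha hb hab hab' h1 h2
  obtain ⟨u, hu, hne⟩ := h ![0, a, a + b, b] (by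
    have e1 : a - (a + b) = -b := by abel
    have e2 : b - (a + b) = -a := by abel
    intro i j hij
    fin_cases i <;> fin_cases j <;> first
      | exact absurd rfl hij
      | simpa [e1, e2] using ha
      | simpa [e1, e2] using hb
      | simpa [e1, e2] using hab
      | simpa [e1, e2] using hab'
      | simpa [e1, e2] using ha.neg
      | simpa [e1, e2] using hb.neg
      | simpa [e1, e2] using hab.neg
      | simpa using hab'.neg)
  have h10 : normDeriv a (u 1 - u 0) = 0 := by simpa using hu 1 0 (by decide)
  have h30 : normDeriv b (u 3 - u 0) = 0 := by simpa using hu 3 0 (by decide)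
  have h20 : normDeriv (a + b) (u 2 - u 0) = 0 := by simpa using hu 2 0 (by decide)
  have h13 : normDeriv (a - b) (u 1 - u 3) = 0 := by simpa using hu 1 3 (by decide)
  have h21 : normDeriv b (u 2 - u 1) = 0 := by simpa using hu 2 1 (by decide)
  have h23 : normDeriv a (u 2 - u 3) = 0 := by simpa using hu 2 3 (by decide)
  have hpar : u 2 - u 1 - (u 3 - u 0) = 0 := by
    refine eq_zero_of_normDeriv_eq_zero hdim ha hb h1 h2 ?_ ?_
    · rw [show u 2 - u 1 - (u 3 - u 0) = u 2 - u 3 - (u 1 - u 0) by abel, map_sub, h23, h10,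
        sub_zero]
    · rw [map_sub, h21, h30, sub_zero]
  have hpar' : u 1 - u 0 + (u 3 - u 0) = u 2 - u 0 := by
    rw [← sub_eq_zero, ← neg_eq_zero, ← hpar]; abel
  refine ⟨u 1 - u 0, u 3 - u 0, ?_, h10, h30, by rwa [hpar'], by simpa using h13⟩
  by_contra! hcon
  refine hne ⟨u 0, fun i => ?_⟩
  rw [hcon.1, hcon.2, add_zero, eq_comm] at hpar'
  fin_cases i
  · rfl
  · exact sub_eq_zero.1 hcon.1
  · exact sub_eq_zero.1 hpar'
  · exact sub_eq_zero.1 hcon.2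

lemma ParallelogramsFlexible.normDeriv_apply_add_eq_zero (hX : ParallelogramsFlexible X)
    (hdim : Module.finrank ℝ X = 2) (A : X →ₗ[ℝ] X) {a b : X} (ha : IsSmoothPoint a)
    (hb : IsSmoothPoint b) (hab : IsSmoothPoint (a + b)) (hab' : IsSmoothPoint (a - b))
    (hne : normDeriv a ≠ -normDeriv b) (hAa : normDeriv a (A a) = 0)
    (hAb : normDeriv b (A b) = 0) (hAab : normDeriv (a - b) (A (a - b)) = 0) :
    normDeriv (a + b) (A (a + b)) = 0 := by
  have : Nontrivial X := Module.nontrivial_of_finrank_pos (R := ℝ) (by omega)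
  by_cases heq : normDeriv a = normDeriv b
  · rw [normDeriv_add_of_eq ha hb hab heq, map_add, map_add, hAa, heq, hAb, add_zero]
  · obtain ⟨v, w, hvw, hv, hw, hp, hm⟩ := hX a b ha hb hab hab' heq hne
    have hq : normDeriv (a - b) ≠ 0 := fun h0 => by
      have : ‖normDeriv (a - b)‖ = 1 := norm_fderiv_norm hab'
      rw [h0, norm_zero] at this
      exact zero_ne_one this
    rw [map_sub, sub_eq_zero] at hm
    rw [map_sub, map_sub, sub_eq_zero] at hAab
    obtain ⟨c, h1, h2⟩ := normDeriv_flex_unique hdim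
      (fun z => eq_zero_of_normDeriv_eq_zero hdim ha hb heq hne) hq hAa hAb hAab hv hw hm hvw
    rw [map_add, h1, h2, ← smul_add, map_smul, hp, smul_zero]

/-- A pair of vectors spanning a lattice of smooth points such that `A` restricts to an
infinitesimal flex of the triangle with edges `a`, `b`, `a - b`. -/
structure IsFlexPair (A : X →ₗ[ℝ] X) (a b : X) : Prop where
  smooth : ∀ m n : ℤ, m ≠ 0 ∨ n ≠ 0 → IsSmoothPoint (m • a + n • b)
  ne_neg : normDeriv a ≠ -normDeriv b
  left : normDeriv a (A a) = 0
  right : normDeriv b (A b) = 0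
  sub : normDeriv (a - b) (A (a - b)) = 0

namespace IsFlexPair

variable {A : X →ₗ[ℝ] X} {a b : X}

lemma symm (h : IsFlexPair A a b) : IsFlexPair A b a where
  smooth m n hmn := by rw [add_comm]; exact h.smooth n m hmn.symm
  ne_neg h' := h.ne_neg (by rw [h', neg_neg])
  left := h.right
  right := h.left
  sub := by
    rw [← neg_sub a b, normDeriv_neg, map_neg, map_neg, neg_apply, h.sub,
      neg_zero, neg_zero]

lemma add_right (h : IsFlexPair A a b) (hX : ParallelogramsFlexible X)
    (hdim : Module.finrank ℝ X = 2) : IsFlexPair A a (a + b) := by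
  have ha : IsSmoothPoint a := by simpa using h.smooth 1 0 (by simp)
  have hb : IsSmoothPoint b := by simpa using h.smooth 0 1 (by simp)
  have hab : IsSmoothPoint (a + b) := by simpa using h.smooth 1 1 (by simp)
  have hab' : IsSmoothPoint (a - b) := by simpa [sub_eq_add_neg] using h.smooth 1 (-1) (by simp)
  refine ⟨fun m n hmn => ?_, fun heq => ?_, h.left, ?_, ?_⟩
  · rw [show m • a + n • (a + b) = (m + n) • a + n • b by module]
    exact h.smooth _ _ (by omega)
  · have hs : a + b + -a = b := by abel
    have := normDeriv_add_of_eq hab ha.neg (by rwa [hs]) (by rw [normDeriv_neg, heq, neg_neg])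
    rw [hs] at this
    exact h.ne_neg (by rw [heq, this])
  · exact hX.normDeriv_apply_add_eq_zero hdim A ha hb hab hab' h.ne_neg h.left h.right h.sub
  · rw [show a - (a + b) = -b by abel, normDeriv_neg, map_neg, map_neg, neg_apply, h.right,
      neg_zero, neg_zero]

lemma norm_le (h : IsFlexPair A a b) (hX : ParallelogramsFlexible X)
    (hdim : Module.finrank ℝ X = 2) (m n : ℕ) (t : ℝ) :
    ‖m • a + n • b‖ ≤ ‖m • a + n • b + t • A (m • a + n • b)‖ := by
  induction hk : m + n using Nat.strong_induction_on generalizing m n a b with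
  | _ k ih =>
    have key : ∀ {c : X} (r : ℕ), IsSmoothPoint c → normDeriv c (A c) = 0 →
        ‖r • c‖ ≤ ‖r • c + t • A (r • c)‖ := by
      intro c r hc hAc
      rw [map_nsmul, smul_comm t r, ← nsmul_add, ← Nat.cast_smul_eq_nsmul ℝ,
        ← Nat.cast_smul_eq_nsmul ℝ, norm_smul, norm_smul]
      gcongr
      exact hc.norm_le_norm_add_smul hAc t
    rcases Nat.eq_zero_or_pos m with rfl | hm
    · simpa using key n (by simpa using h.smooth 0 1 (by simp)) h.right
    rcases Nat.eq_zero_or_pos n with rfl | hn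
    · simpa using key m (by simpa using h.smooth 1 0 (by simp)) h.left
    rcases le_total n m with hmn | hmn
    · obtain ⟨r, rfl⟩ := Nat.exists_eq_add_of_le' hmn
      have := ih (r + n) (by omega) (h.add_right hX hdim) r n rfl
      rwa [show r • a + n • (a + b) = (r + n) • a + n • b by module] at this
    · obtain ⟨r, rfl⟩ := Nat.exists_eq_add_of_le' hmn
      have := ih (r + m) (by omega) (h.symm.add_right hX hdim) r m rfl
      rwa [show r • b + m • (b + a) = m • a + (r + m) • b by module] at this

end IsFlexPair

lemma norm_le_norm_add_smul_of_isFlexPair (hX : ParallelogramsFlexible X)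
    (hdim : Module.finrank ℝ X = 2) {A : X →ₗ[ℝ] X} {a b : X} (hli : LinearIndependent ℝ ![a, b])
    (h : IsFlexPair A a b) (h' : IsFlexPair A a (-b)) (z : X) (t : ℝ) :
    ‖z‖ ≤ ‖z + t • A z‖ := by
  have : FiniteDimensional ℝ X := Module.finite_of_finrank_pos (by omega)
  have hA : Continuous A := A.continuous_of_finiteDimensional
  have hscale : ∀ (c : ℝ) (z : X), ‖z‖ ≤ ‖z + t • A z‖ → ‖c • z‖ ≤ ‖c • z + t • A (c • z)‖ := by
    intro c z hz
    rw [map_smul, smul_comm t c, ← smul_add, norm_smul, norm_smul]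
    gcongr
  have hzint : ∀ m n : ℤ, ‖m • a + n • b‖ ≤ ‖m • a + n • b + t • A (m • a + n • b)‖ := by
    intro m n
    obtain ⟨i, rfl | rfl⟩ := m.eq_nat_or_neg <;> obtain ⟨j, rfl | rfl⟩ := n.eq_nat_or_neg
    · simpa using h.norm_le hX hdim i j t
    · simpa using h'.norm_le hX hdim i j t
    · have := hscale (-1) _ (h'.norm_le hX hdim i j t)
      rwa [show (-1 : ℝ) • (i • a + j • -b) = (-(i : ℤ)) • a + (j : ℤ) • b by module] at this
    · have := hscale (-1) _ (h.norm_le hX hdim i j t)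
      rwa [show (-1 : ℝ) • (i • a + j • b) = (-(i : ℤ)) • a + (-(j : ℤ)) • b by module] at this
  have hrat : ∀ q r : ℚ, ‖(q : ℝ) • a + (r : ℝ) • b‖ ≤
      ‖(q : ℝ) • a + (r : ℝ) • b + t • A ((q : ℝ) • a + (r : ℝ) • b)‖ := by
    intro q r
    have := hscale ((q.den : ℝ) * r.den)⁻¹ _ (hzint (q.num * r.den) (r.num * q.den))
    have hq : (q.den : ℝ) ≠ 0 := by exact_mod_cast q.den_nz
    have hr : (r.den : ℝ) ≠ 0 := by exact_mod_cast r.den_nz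
    have e : ((q.den : ℝ) * r.den)⁻¹ • ((q.num * r.den) • a + (r.num * q.den) • b) =
        (q : ℝ) • a + (r : ℝ) • b := by
      rw [smul_add, ← Int.cast_smul_eq_zsmul ℝ, ← Int.cast_smul_eq_zsmul ℝ, smul_smul, smul_smul,
        Rat.cast_def q, Rat.cast_def r]
      congr 2
      · push_cast; field_simp
      · push_cast; field_simp
    rwa [e] at this
  have hreal : ∀ s : ℝ × ℝ, ‖s.1 • a + s.2 • b‖ ≤
      ‖s.1 • a + s.2 • b + t • A (s.1 • a + s.2 • b)‖ := by
    intro s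
    have hd : DenseRange (Prod.map ((↑) : ℚ → ℝ) ((↑) : ℚ → ℝ)) :=
      Rat.denseRange_cast.prodMap Rat.denseRange_cast
    exact hd.induction_on s (isClosed_le (by fun_prop) (by fun_prop)) fun q => hrat q.1 q.2
  obtain ⟨c, d, rfl⟩ := exists_smul_add_smul_eq hdim hli z
  exact hreal (c, d)

lemma exists_lattice_of_smooth_points (hdim : Module.finrank ℝ X = 2) :
    ∃ a b : X, (∀ m n : ℤ, m ≠ 0 ∨ n ≠ 0 → IsSmoothPoint (m • a + n • b)) ∧
      normDeriv a ≠ normDeriv b ∧ normDeriv a ≠ -normDeriv b := by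
  have : FiniteDimensional ℝ X := Module.finite_of_finrank_pos (by omega)
  borelize X
  let μ : Measure X := Measure.addHaar
  have hae : ∀ᵐ y ∂μ, IsSmoothPoint y := lipschitzWith_one_norm.ae_differentiableAt
  obtain ⟨a, ha⟩ := hae.exists
  have hq : ∀ᵐ y ∂μ, ∀ q : ℚ, IsSmoothPoint ((q : ℝ) • a + y) :=
    ae_all_iff.2 fun q =>
      (measurePreserving_add_left μ ((q : ℝ) • a)).quasiMeasurePreserving.ae hae
  obtain ⟨w, hw, hw0⟩ : ∃ w, w ∈ (normDeriv a : X →ₗ[ℝ] ℝ).ker ∧ w ≠ 0 := by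
    refine Submodule.exists_mem_ne_zero_of_ne_bot fun hbot => ?_
    have := LinearMap.finrank_le_finrank_of_injective (LinearMap.ker_eq_bot.1 hbot)
    simp [hdim] at this
  have hU : IsOpen {y : X | |normDeriv a y| < ‖y‖} := isOpen_lt (by fun_prop) (by fun_prop)
  have hwU : w ∈ {y : X | |normDeriv a y| < ‖y‖} := by
    have : normDeriv a w = 0 := hw
    simpa [this] using hw0
  obtain ⟨b, hb, hbU⟩ : ∃ b, (∀ q : ℚ, IsSmoothPoint ((q : ℝ) • a + b)) ∧
      |normDeriv a b| < ‖b‖ := by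
    have hfreq : ∃ᵐ y ∂μ, y ∈ {y : X | |normDeriv a y| < ‖y‖} :=
      frequently_ae_mem_iff.2 (hU.measure_pos μ ⟨w, hwU⟩).ne'
    obtain ⟨b, h1, h2⟩ := (hfreq.and_eventually hq).exists
    exact ⟨b, h2, h1⟩
  have hbs : IsSmoothPoint b := by simpa using hb 0
  refine ⟨a, b, fun m n hmn => ?_, fun h => ?_, fun h => ?_⟩
  · rcases eq_or_ne n 0 with rfl | hn
    · have hm : (m : ℝ) ≠ 0 := by simpa using hmn
      simpa [Int.cast_smul_eq_zsmul] using ha.smul hm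
    · have hn' : (n : ℝ) ≠ 0 := by exact_mod_cast hn
      have := (hb (m / n)).smul hn'
      rwa [smul_add, smul_smul, Rat.cast_div, Rat.cast_intCast, Rat.cast_intCast,
        mul_div_cancel₀ _ hn', Int.cast_smul_eq_zsmul, Int.cast_smul_eq_zsmul] at this
  · rw [h, hbs.normDeriv_self, abs_norm] at hbU
    exact lt_irrefl _ hbU
  · rw [h, neg_apply, hbs.normDeriv_self, abs_neg, abs_norm] at hbU
    exact lt_irrefl _ hbU

lemma linearIndependent_of_normDeriv_ne [Nontrivial X] {a b : X} (ha : IsSmoothPoint a)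
    (hb : IsSmoothPoint b) (h1 : normDeriv a ≠ normDeriv b) (h2 : normDeriv a ≠ -normDeriv b) :
    LinearIndependent ℝ ![a, b] := by
  rw [LinearIndependent.pair_iff' ha.ne_zero]
  rintro c rfl
  rcases lt_trichotomy c 0 with hc | rfl | hc
  · exact h2 (eq_neg_of_add_eq_zero_right (by
      rw [normDeriv, fderiv_norm_smul_neg hc, neg_add_cancel]))
  · exact hb.ne_zero (zero_smul ℝ a)
  · exact h1 (fderiv_norm_smul_pos hc).symm

/-- If all parallelograms flex, then some nonzero operator is tangent to all spheres. -/
lemma ParallelogramsFlexible.exists_linearMap (hX : ParallelogramsFlexible X)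
    (hdim : Module.finrank ℝ X = 2) :
    ∃ A : X →ₗ[ℝ] X, A ≠ 0 ∧ ∀ (z : X) (t : ℝ), ‖z‖ ≤ ‖z + t • A z‖ := by
  have : Nontrivial X := Module.nontrivial_of_finrank_pos (R := ℝ) (by omega)
  obtain ⟨a, b, hs, h1, h2⟩ := exists_lattice_of_smooth_points hdim
  have ha : IsSmoothPoint a := by simpa using hs 1 0 (by simp)
  have hb : IsSmoothPoint b := by simpa using hs 0 1 (by simp)
  have hab : IsSmoothPoint (a + b) := by simpa using hs 1 1 (by simp)
  have hab' : IsSmoothPoint (a - b) := by simpa [sub_eq_add_neg] using hs 1 (-1) (by simp)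
  obtain ⟨v, w, hvw, hv, hw, hp, hm⟩ := hX a b ha hb hab hab' h1 h2
  have hli := linearIndependent_of_normDeriv_ne ha hb h1 h2
  let B := basisOfLinearIndependentOfCardEqFinrank hli (by simp [hdim])
  let A : X →ₗ[ℝ] X := B.constr ℝ ![v, w]
  have hB0 : B 0 = a := by simp [B]
  have hB1 : B 1 = b := by simp [B]
  have hAa : A a = v := by rw [← hB0]; exact B.constr_basis ℝ ![v, w] 0
  have hAb : A b = w := by rw [← hB1]; exact B.constr_basis ℝ ![v, w] 1
  refine ⟨A, ?_, norm_le_norm_add_smul_of_isFlexPair hX hdim hli ⟨hs, h2, ?_, ?_, ?_⟩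
    ⟨fun m n hmn => ?_, ?_, ?_, ?_, ?_⟩⟩
  · rintro h0
    simp [← hAa, ← hAb, h0] at hvw
  · rwa [hAa]
  · rwa [hAb]
  · rwa [map_sub, hAa, hAb]
  · simpa using hs m (-n) (by simpa using hmn)
  · rwa [normDeriv_neg, neg_neg]
  · rwa [hAa]
  · rw [normDeriv_neg, map_neg, hAb, neg_apply, map_neg, hw, neg_zero, neg_zero]
  · rwa [sub_neg_eq_add, map_add, hAa, hAb]

end Parallelogram

section Tangent

variable {X : Type*} [NormedAddCommGroup X] [NormedSpace ℝ X]

/-- An injective operator that does not decrease norms has determinant at least one. -/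
lemma one_le_abs_det_of_norm_le [FiniteDimensional ℝ X] {T : X →ₗ[ℝ] X}
    (hT : ∀ z, ‖z‖ ≤ ‖T z‖) : 1 ≤ |LinearMap.det T| := by
  borelize X
  let μ : Measure X := Measure.addHaar
  have hinj : Function.Injective T := by
    rw [injective_iff_map_eq_zero]
    intro z hz
    simpa [hz] using hT z
  have hsub : Metric.ball (0 : X) 1 ⊆ T '' Metric.ball 0 1 := by
    intro y hy
    obtain ⟨z, rfl⟩ := LinearMap.injective_iff_surjective.1 hinj y
    rw [mem_ball_zero_iff] at hy
    exact ⟨z, mem_ball_zero_iff.2 ((hT z).trans_lt hy), rfl⟩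
  have hμ := measure_mono (μ := μ) hsub
  rw [Measure.addHaar_image_linearMap] at hμ
  have h0 : μ (Metric.ball 0 1) ≠ 0 := (Metric.measure_ball_pos μ 0 one_pos).ne'
  have h1 : μ (Metric.ball 0 1) ≠ ⊤ := measure_ball_lt_top.ne
  rw [← ENNReal.one_le_ofReal, ← ENNReal.mul_le_mul_iff_left h0 h1, one_mul]
  exact hμ

lemma exists_sq_eq_of_norm_le (hdim : Module.finrank ℝ X = 2) {A : X →ₗ[ℝ] X}
    (hA : ∀ (z : X) (t : ℝ), ‖z‖ ≤ ‖z + t • A z‖) :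
    ∃ δ : ℝ, 0 ≤ δ ∧ ∀ z, A (A z) = -δ • z := by
  have : FiniteDimensional ℝ X := Module.finite_of_finrank_pos (by omega)
  let b := Module.finBasisOfFinrankEq ℝ X hdim
  set M := LinearMap.toMatrix b b A with hM
  set τ : ℝ := M.trace with hτ
  set δ : ℝ := M.det with hδ
  have hdet : ∀ t : ℝ, 1 ≤ |1 + t * τ + t ^ 2 * δ| := by
    intro t
    have h := one_le_abs_det_of_norm_le (T := LinearMap.id + t • A) fun z => by simpa using hA z t
    rw [← LinearMap.det_toMatrix b, map_add, map_smul, LinearMap.toMatrix_id, ← hM,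
      Matrix.det_fin_two] at h
    convert h using 2
    rw [hτ, hδ, Matrix.det_fin_two, Matrix.trace_fin_two]
    simp
    ring
  have hnear : ∀ᶠ t in 𝓝 (0 : ℝ), 1 ≤ 1 + t * τ + t ^ 2 * δ := by
    have hc : ContinuousAt (fun t : ℝ => 1 + t * τ + t ^ 2 * δ) 0 := by fun_prop
    have h0 : (0 : ℝ) < 1 + 0 * τ + 0 ^ 2 * δ := by norm_num
    filter_upwards [hc.eventually (lt_mem_nhds h0)] with t ht
    have := hdet t
    rwa [abs_of_pos ht] at this
  have hτ0 : τ = 0 := by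
    have hmin : IsLocalMin (fun t : ℝ => 1 + t * τ + t ^ 2 * δ) 0 := by
      filter_upwards [hnear] with t ht
      simpa using ht
    have hd : HasDerivAt (fun t : ℝ => 1 + t * τ + t ^ 2 * δ) τ 0 := by
      have := (((hasDerivAt_id (0 : ℝ)).mul_const τ).const_add 1).add
        (((hasDerivAt_id (0 : ℝ)).pow 2).mul_const δ)
      exact this.congr_deriv (by simp)
    exact hmin.hasDerivAt_eq_zero hd
  have hδ0 : 0 ≤ δ := by
    obtain ⟨t, ht, ht0⟩ :=
      ((hnear.filter_mono nhdsWithin_le_nhds).and (self_mem_nhdsWithin (s := {0}ᶜ))).exists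
    rw [hτ0, mul_zero, add_zero] at ht
    have : 0 < t ^ 2 := by
      have : t ≠ 0 := ht0
      positivity
    exact nonneg_of_mul_nonneg_right (by linarith) this
  refine ⟨δ, hδ0, fun z => ?_⟩
  have hsq : A * A = -δ • (1 : X →ₗ[ℝ] X) := by
    apply (LinearMap.toMatrix b b).injective
    rw [LinearMap.toMatrix_mul, map_smul, LinearMap.toMatrix_one, ← hM, hδ, Matrix.det_fin_two]
    rw [hτ, Matrix.trace_fin_two] at hτ0
    have h11 : M 1 1 = -M 0 0 := by linarith
    ext i j
    fin_cases i <;> fin_cases j <;> simp [Matrix.mul_apply, h11] <;> ring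
  simpa using LinearMap.congr_fun hsq z

lemma norm_cos_smul_add_sin_smul {J : X →ₗ[ℝ] X} (hJ2 : ∀ z, J (J z) = -z)
    (hJ : ∀ (z : X) (t : ℝ), ‖z‖ ≤ ‖z + t • J z‖) (z : X) (θ : ℝ) :
    ‖Real.cos θ • z + Real.sin θ • J z‖ = ‖z‖ := by
  set g : ℝ → ℝ := fun θ => ‖Real.cos θ • z + Real.sin θ • J z‖ with hg
  have hstep : ∀ θ s : ℝ, Real.cos s * g θ ≤ g (θ + s) := by
    intro θ s
    rcases le_or_gt (Real.cos s) 0 with hs | hs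
    · exact (mul_nonpos_of_nonpos_of_nonneg hs (norm_nonneg _)).trans (norm_nonneg _)
    set y := Real.cos θ • z + Real.sin θ • J z with hy
    have e : Real.cos (θ + s) • z + Real.sin (θ + s) • J z =
        Real.cos s • (y + (Real.sin s / Real.cos s) • J y) := by
      rw [smul_add, smul_smul, mul_div_cancel₀ _ hs.ne', hy, map_add, map_smul, map_smul, hJ2,
        Real.cos_add, Real.sin_add]
      module
    simp only [hg, e, norm_smul, Real.norm_eq_abs, abs_of_pos hs]
    gcongr
    exact hJ _ _
  have hbd : ∀ θ, g θ ≤ ‖z‖ + ‖J z‖ := by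
    intro θ
    refine (norm_add_le _ _).trans ?_
    rw [norm_smul, norm_smul]
    refine add_le_add (mul_le_of_le_one_left (norm_nonneg _) (Real.abs_cos_le_one θ))
      (mul_le_of_le_one_left (norm_nonneg _) (Real.abs_sin_le_one θ))
  have hquad : ∀ θ s : ℝ, |g (θ + s) - g θ| ≤ (‖z‖ + ‖J z‖) * s ^ 2 := by
    intro θ s
    have hlow : ∀ θ s : ℝ, g θ - g (θ + s) ≤ (‖z‖ + ‖J z‖) * s ^ 2 := by
      intro θ s
      have h1 := hstep θ s
      have h2 := Real.one_sub_sq_div_two_le_cos (x := s)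
      have h3 : (1 - Real.cos s) * g θ ≤ s ^ 2 * (‖z‖ + ‖J z‖) :=
        mul_le_mul (by nlinarith [sq_nonneg s]) (hbd θ) (norm_nonneg _) (sq_nonneg s)
      linarith
    rw [abs_le]
    have h1 := hlow θ s
    have h2 := hlow (θ + s) (-s)
    rw [add_neg_cancel_right, neg_sq] at h2
    constructor <;> linarith
  have hderiv : ∀ θ, HasDerivAt g 0 θ := by
    intro θ
    rw [hasDerivAt_iff_isLittleO_nhds_zero]
    have hO : (fun s : ℝ => g (θ + s) - g θ - s • (0 : ℝ)) =O[𝓝 0] fun s : ℝ => s ^ 2 :=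
      IsBigO.of_bound (‖z‖ + ‖J z‖) (Eventually.of_forall fun s => by simpa using hquad θ s)
    exact hO.trans_isLittleO (by simpa using isLittleO_pow_id (𝕜 := ℝ) one_lt_two)
  have := is_const_of_deriv_eq_zero (fun θ => (hderiv θ).differentiableAt)
    (fun θ => (hderiv θ).deriv) θ 0
  simpa [hg] using this

lemma norm_smul_add_smul_sq {J : X →ₗ[ℝ] X} (hJ2 : ∀ z, J (J z) = -z)
    (hJ : ∀ (z : X) (t : ℝ), ‖z‖ ≤ ‖z + t • J z‖) (z : X) (a b : ℝ) :
    ‖a • z + b • J z‖ ^ 2 = (a ^ 2 + b ^ 2) * ‖z‖ ^ 2 := by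
  set c : ℂ := ⟨a, b⟩ with hc
  have ha : a = ‖c‖ * Real.cos c.arg := (Complex.norm_mul_cos_arg c).symm
  have hb : b = ‖c‖ * Real.sin c.arg := (Complex.norm_mul_sin_arg c).symm
  have hn : a ^ 2 + b ^ 2 = ‖c‖ ^ 2 := by
    rw [Complex.sq_norm, Complex.normSq_apply]; ring
  rw [hn]
  conv_lhs => rw [ha, hb, mul_smul, mul_smul, ← smul_add, norm_smul,
    norm_cos_smul_add_sin_smul hJ2 hJ, norm_norm, mul_pow]

/-- A plane whose spheres are tangent to a nonzero linear vector field is Euclidean. -/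
lemma parallelogram_law_of_norm_le (hdim : Module.finrank ℝ X = 2) {A : X →ₗ[ℝ] X} (hA0 : A ≠ 0)
    (hA : ∀ (z : X) (t : ℝ), ‖z‖ ≤ ‖z + t • A z‖) (x y : X) :
    ‖x + y‖ ^ 2 + ‖x - y‖ ^ 2 = 2 * ‖x‖ ^ 2 + 2 * ‖y‖ ^ 2 := by
  have : Nontrivial X := Module.nontrivial_of_finrank_pos (R := ℝ) (by omega)
  obtain ⟨δ, hδ, hsq⟩ := exists_sq_eq_of_norm_le hdim hA
  rcases hδ.eq_or_lt with rfl | hδ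
  · exfalso
    obtain ⟨z, hz⟩ : ∃ z, A z ≠ 0 := by
      by_contra! h
      exact hA0 (LinearMap.ext h)
    have hbound : ∀ s : ℝ, ‖z + s • A z‖ ≤ ‖z‖ := by
      intro s
      have := hA (z + s • A z) (-s)
      rwa [map_add, map_smul, hsq, neg_zero, zero_smul, smul_zero, add_zero, neg_smul,
        add_neg_cancel_right] at this
    have h := hbound (3 * ‖z‖ / ‖A z‖)
    have h' : ‖(3 * ‖z‖ / ‖A z‖) • A z‖ = 3 * ‖z‖ := by
      rw [norm_smul, Real.norm_of_nonneg (by positivity), div_mul_cancel₀ _ (by simpa using hz)]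
    have hz0 : 0 < ‖z‖ := norm_pos_iff.2 (by rintro rfl; simp at hz)
    have := norm_sub_le (z + (3 * ‖z‖ / ‖A z‖) • A z) z
    rw [add_sub_cancel_left, h'] at this
    linarith
  have hω : 0 < √δ := Real.sqrt_pos.2 hδ
  let J : X →ₗ[ℝ] X := (√δ)⁻¹ • A
  have hJz : ∀ z, J z = (√δ)⁻¹ • A z := fun z => rfl
  have hJ2 : ∀ z, J (J z) = -z := by
    intro z
    have : (√δ)⁻¹ * (√δ)⁻¹ * δ = 1 := by
      field_simp
      exact (Real.sq_sqrt hδ.le).symm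
    rw [hJz, hJz, map_smul, hsq, neg_smul, smul_neg, smul_neg, smul_smul, smul_smul, this, one_smul]
  have hJ : ∀ (z : X) (t : ℝ), ‖z‖ ≤ ‖z + t • J z‖ := by
    intro z t
    rw [hJz, smul_smul]
    exact hA z _
  obtain ⟨e, he⟩ := exists_ne (0 : X)
  have hnorm := norm_smul_add_smul_sq hJ2 hJ e
  have hli : LinearIndependent ℝ ![e, J e] := by
    rw [LinearIndependent.pair_iff]
    intro s t hst
    have := hnorm s t
    have he' : ‖e‖ ^ 2 ≠ 0 := by simpa using he
    rw [hst, norm_zero, zero_pow two_ne_zero, eq_comm, mul_eq_zero, or_iff_left he'] at this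
    constructor <;> nlinarith [sq_nonneg s, sq_nonneg t]
  obtain ⟨a, b, rfl⟩ := exists_smul_add_smul_eq hdim hli x
  obtain ⟨c, d, rfl⟩ := exists_smul_add_smul_eq hdim hli y
  have e1 : a • e + b • J e + (c • e + d • J e) = (a + c) • e + (b + d) • J e := by module
  have e2 : a • e + b • J e - (c • e + d • J e) = (a - c) • e + (b - d) • J e := by module
  rw [e1, e2, hnorm, hnorm, hnorm, hnorm]
  ring

end Tangent

/-- `K₄` is rigid in every non-Euclidean normed plane: there is a
well-positioned placement of four points whose only infinitesimal flexes are the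
constant maps. -/
theorem K4_rigid_of_nonEuclidean
    (X : Type*) [NormedAddCommGroup X] [NormedSpace ℝ X]
    (hdim : Module.finrank ℝ X = 2)
    (hnE : ∃ x y : X, ‖x + y‖ ^ 2 + ‖x - y‖ ^ 2 ≠ 2 * ‖x‖ ^ 2 + 2 * ‖y‖ ^ 2) :
    ∃ p : Fin 4 → X,
      (∀ i j : Fin 4, i ≠ j → DifferentiableAt ℝ (fun x : X => ‖x‖) (p i - p j)) ∧
      ∀ u : Fin 4 → X,
        (∀ i j : Fin 4, i ≠ j →
          fderiv ℝ (fun x : X => ‖x‖) (p i - p j) (u i - u j) = 0) →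
        ∃ c : X, ∀ i, u i = c := by
  by_contra! hcon
  obtain ⟨x, y, hxy⟩ := hnE
  have hflex : ParallelogramsFlexible X :=
    parallelogramsFlexible_of_forall_placement hdim fun p hp => by
      obtain ⟨u, hu, hne⟩ := hcon p hp
      refine ⟨u, hu, ?_⟩
      push Not
      exact hne
  obtain ⟨A, hA0, hA⟩ := hflex.exists_linearMap hdim
  exact hxy (parallelogram_law_of_norm_le hdim hA0 hA x y)
end

section
/- Let X be a two-dimensional real normed space that is not strictly convex: there exist distinct x, y ∈ X with ‖x‖ = ‖y‖ = 1 and some t ∈ (0,1) with ‖tx + (1−t)y‖ = 1. Then K₄ is rigid in X: there exists a placement p : {1,2,3,4} → X with the norm differentiable at p_i − p_j for all i ≠ j, such that every u : {1,2,3,4} → X satisfying D(p_i − p_j)(u_i − u_j) = 0 for all i ≠ j is a constant map. -/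
/-- If `w = x • a + y • b` with `‖a‖ = 1` and `‖w‖` exceeds `|x + y|`, then the derivative of the
norm at `w` does not vanish on `b - a`. -/
lemma fderiv_norm_sub_ne_zero {X : Type*} [NormedAddCommGroup X] [NormedSpace ℝ X]
    {a b w : X} {x y : ℝ} (ha : ‖a‖ = 1) (hw : w = x • a + y • b) (hlt : |x + y| < ‖w‖)
    (hd : DifferentiableAt ℝ (fun x : X => ‖x‖) w) :
    fderiv ℝ (fun x : X => ‖x‖) w (b - a) ≠ 0 := by
  intro h
  have hab : fderiv ℝ (fun x : X => ‖x‖) w b = fderiv ℝ (fun x : X => ‖x‖) w a := by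
    rw [map_sub] at h; linarith
  have hself : fderiv ℝ (fun x : X => ‖x‖) w w = ‖w‖ := hd.fderiv_norm_self
  have hval : fderiv ℝ (fun x : X => ‖x‖) w w =
      (x + y) * fderiv ℝ (fun x : X => ‖x‖) w a := by
    conv_lhs => rw [congrArg (fderiv ℝ (fun x : X => ‖x‖) w) hw]
    rw [map_add, map_smul, map_smul, hab, smul_eq_mul, smul_eq_mul]
    ring
  have hle : |fderiv ℝ (fun x : X => ‖x‖) w a| ≤ 1 := by
    have h1 := (fderiv ℝ (fun x : X => ‖x‖) w).le_opNorm a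
    have h2 : ‖fderiv ℝ (fun x : X => ‖x‖) w‖ ≤ 1 := by
      simpa using norm_fderiv_le_of_lipschitz ℝ (lipschitzWith_one_norm (E := X)) (x₀ := w)
    rw [ha, mul_one, Real.norm_eq_abs] at h1
    exact h1.trans h2
  have h3 : ‖w‖ ≤ |x + y| := by
    rw [← hself, hval]
    calc _ ≤ |(x + y) * fderiv ℝ (fun x : X => ‖x‖) w a| := le_abs_self _
      _ = |x + y| * |fderiv ℝ (fun x : X => ‖x‖) w a| := abs_mul _ _
      _ ≤ |x + y| * 1 := by gcongr
      _ = |x + y| := mul_one _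
  linarith

/-- The unit sphere of a space that is not strictly convex contains a maximal segment `[a, b]`. -/
lemma exists_maximal_unit_segment {X : Type*} [NormedAddCommGroup X] [NormedSpace ℝ X]
    (hnsc : ∃ x y : X, x ≠ y ∧ ‖x‖ = 1 ∧ ‖y‖ = 1 ∧
      ∃ t : ℝ, 0 < t ∧ t < 1 ∧ ‖t • x + (1 - t) • y‖ = 1) :
    ∃ a b : X, LinearIndependent ℝ ![a, b] ∧ (∀ x y : ℝ, 0 ≤ x → 0 ≤ y → ‖x • a + y • b‖ = x + y) ∧
      ∀ x y : ℝ, x * y < 0 → |x + y| < ‖x • a + y • b‖ := by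
  obtain ⟨a₀, b₀, hne, ha₀, hb₀, t, ht0, ht1, ht⟩ := hnsc
  have hd : b₀ - a₀ ≠ 0 := sub_ne_zero.2 hne.symm
  have hdpos : 0 < ‖b₀ - a₀‖ := norm_pos_iff.2 hd
  let S : Set ℝ := {s | ‖a₀ + s • (b₀ - a₀)‖ ≤ 1}
  have hS : IsCompact S := by
    refine Metric.isCompact_of_isClosed_isBounded ?_ ?_
    · exact isClosed_le (by fun_prop) continuous_const
    · refine (Metric.isBounded_closedBall (x := (0 : ℝ)) (r := 2 / ‖b₀ - a₀‖)).subset ?_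
      intro s (hs : ‖a₀ + s • (b₀ - a₀)‖ ≤ 1)
      rw [mem_closedBall_zero_iff, le_div_iff₀ hdpos, ← norm_smul]
      calc ‖s • (b₀ - a₀)‖ = ‖(a₀ + s • (b₀ - a₀)) - a₀‖ := by rw [add_sub_cancel_left]
        _ ≤ ‖a₀ + s • (b₀ - a₀)‖ + ‖a₀‖ := norm_sub_le _ _
        _ ≤ 2 := by linarith
  have h0 : (0 : ℝ) ∈ S := by simp [S, ha₀]
  have h1 : (1 : ℝ) ∈ S := by simp [S, hb₀]
  obtain ⟨α, hαS, hα⟩ := hS.exists_isLeast ⟨0, h0⟩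
  obtain ⟨β, hβS, hβ⟩ := hS.exists_isGreatest ⟨0, h0⟩
  have hα0 : α ≤ 0 := hα h0
  have hβ1 : 1 ≤ β := hβ h1
  set a := a₀ + α • (b₀ - a₀) with ha
  set b := a₀ + β • (b₀ - a₀) with hb
  have hna : ‖a‖ ≤ 1 := hαS
  have hnb : ‖b‖ ≤ 1 := hβS
  have hba : b - a = (β - α) • (b₀ - a₀) := by rw [ha, hb]; module
  have hab : b - a ≠ 0 := by
    rw [hba]; exact smul_ne_zero (by linarith) hd
  have hcomb : ∀ x y : ℝ, x + y ≠ 0 →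
      x • a + y • b = (x + y) • (a₀ + ((x * α + y * β) / (x + y)) • (b₀ - a₀)) := by
    intro x y h
    rw [smul_add (x + y), smul_smul, mul_div_cancel₀ _ h, ha, hb]
    module
  have hpos : ∀ x y : ℝ, x * y < 0 → 0 < x + y → x + y < ‖x • a + y • b‖ := by
    intro x y hxy hs
    rw [hcomb x y hs.ne', norm_smul, Real.norm_of_nonneg hs.le]
    refine lt_mul_of_one_lt_right hs (lt_of_not_ge fun hle => ?_)
    have hl := hα (show (x * α + y * β) / (x + y) ∈ S from hle)
    have hu := hβ (show (x * α + y * β) / (x + y) ∈ S from hle)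
    rw [le_div_iff₀ hs] at hl
    rw [div_le_iff₀ hs] at hu
    have hy : 0 ≤ y := by nlinarith
    have hx : 0 ≤ x := by nlinarith
    nlinarith [mul_nonneg hx hy]
  obtain ⟨φ, hφ, hφm⟩ := exists_dual_vector ℝ (t • a₀ + (1 - t) • b₀)
    (by rw [ht]; exact one_ne_zero)
  have hφle : ∀ v, φ v ≤ ‖v‖ := fun v => by
    have := φ.le_opNorm v
    rw [hφ, one_mul] at this
    exact (le_abs_self _).trans this
  have hm : φ ((β - α) • (t • a₀ + (1 - t) • b₀)) =
      (β - (1 - t)) * φ a + ((1 - t) - α) * φ b := by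
    rw [← smul_eq_mul, ← smul_eq_mul, ← map_smul, ← map_smul, ← map_add, ha, hb]
    congr 1
    module
  rw [map_smul, hφm, ht] at hm
  simp only [smul_eq_mul] at hm
  norm_num at hm
  have hφa : φ a ≤ 1 := (hφle a).trans hna
  have hφb : φ b ≤ 1 := (hφle b).trans hnb
  have hφa' : φ a = 1 := by nlinarith
  have hφb' : φ b = 1 := by nlinarith
  refine ⟨a, b, ?_, ?_, ?_⟩
  · rw [LinearIndependent.pair_iff]
    intro x y h
    have hx : x = -y := by
      have := congrArg φ h
      simp only [map_add, map_smul, hφa', hφb', smul_eq_mul, mul_one, map_zero] at this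
      linarith
    have hy : y • (b - a) = 0 := by rw [← h, hx]; module
    have hy0 : y = 0 := (smul_eq_zero.1 hy).resolve_right hab
    exact ⟨by rw [hx, hy0, neg_zero], hy0⟩
  · intro x y hx hy
    apply le_antisymm
    · calc ‖x • a + y • b‖ ≤ ‖x • a‖ + ‖y • b‖ := norm_add_le _ _
        _ = x * ‖a‖ + y * ‖b‖ := by
          rw [norm_smul, norm_smul, Real.norm_of_nonneg hx, Real.norm_of_nonneg hy]
        _ ≤ x * 1 + y * 1 := by gcongr
        _ = x + y := by ring
    · simpa [hφa', hφb'] using hφle (x • a + y • b)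
  · intro x y hxy
    rcases lt_trichotomy (x + y) 0 with h | h | h
    · have := hpos (-x) (-y) (by linarith) (by linarith)
      rw [abs_of_neg h]
      calc -(x + y) = -x + -y := by ring
        _ < ‖(-x) • a + (-y) • b‖ := this
        _ = ‖x • a + y • b‖ := by rw [← norm_neg]; congr 1; module
    · rw [h, abs_zero, norm_pos_iff]
      have hx : x = -y := by linarith
      have : x • a + y • b = y • (b - a) := by rw [hx]; module
      rw [this]
      refine smul_ne_zero ?_ hab
      rintro rfl
      simp at hxy
    · rw [abs_of_pos h]
      exact hpos x y hxy h

/-- A plane whose unit sphere contains a segment has linear coordinates `P`, `Q` in which the norm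
is `P + Q` on the closed first quadrant and exceeds `|P + Q|` on the open second and fourth
quadrants. -/
lemma exists_coordinates_of_not_strictlyConvex
    {X : Type*} [NormedAddCommGroup X] [NormedSpace ℝ X] (hdim : Module.finrank ℝ X = 2)
    (hnsc : ∃ x y : X, x ≠ y ∧ ‖x‖ = 1 ∧ ‖y‖ = 1 ∧
      ∃ t : ℝ, 0 < t ∧ t < 1 ∧ ‖t • x + (1 - t) • y‖ = 1) :
    ∃ (a b : X) (P Q : X →L[ℝ] ℝ), ‖a‖ = 1 ∧ (∀ v, v = P v • a + Q v • b) ∧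
      (∀ x y : ℝ, P (x • a + y • b) = x ∧ Q (x • a + y • b) = y) ∧
      (∀ v, 0 ≤ P v → 0 ≤ Q v → ‖v‖ = P v + Q v) ∧
      ∀ v, P v * Q v < 0 → |P v + Q v| < ‖v‖ := by
  obtain ⟨a, b, hli, hA, hB⟩ := exists_maximal_unit_segment hnsc
  have : FiniteDimensional ℝ X := Module.finite_of_finrank_pos (by omega)
  let B := basisOfLinearIndependentOfCardEqFinrank hli (by simp [hdim])
  have hB0 : B 0 = a := by simp [B]
  have hB1 : B 1 = b := by simp [B]
  have hrep : ∀ v, v = B.coord 0 v • a + B.coord 1 v • b := fun v => by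
    have := B.sum_repr v
    rw [Fin.sum_univ_two, hB0, hB1] at this
    exact this.symm
  refine ⟨a, b, LinearMap.toContinuousLinearMap (B.coord 0),
    LinearMap.toContinuousLinearMap (B.coord 1), ?_, hrep, ?_, ?_, ?_⟩
  · simpa using hA 1 0 zero_le_one le_rfl
  · intro x y
    simp [← hB0, ← hB1]
  · intro v h0 h1
    exact (congrArg norm (hrep v)).trans (hA _ _ h0 h1)
  · intro v h
    exact (hB _ _ h).trans_eq (congrArg norm (hrep v)).symm

/-- `K₄` is rigid in every normed plane that is not strictly
convex. -/
theorem K4_rigid_of_not_strictlyConvex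
    (X : Type*) [NormedAddCommGroup X] [NormedSpace ℝ X]
    (hdim : Module.finrank ℝ X = 2)
    (hnsc : ∃ x y : X, x ≠ y ∧ ‖x‖ = 1 ∧ ‖y‖ = 1 ∧
      ∃ t : ℝ, 0 < t ∧ t < 1 ∧ ‖t • x + (1 - t) • y‖ = 1) :
    ∃ p : Fin 4 → X,
      (∀ i j : Fin 4, i ≠ j → DifferentiableAt ℝ (fun x : X => ‖x‖) (p i - p j)) ∧
      ∀ u : Fin 4 → X,
        (∀ i j : Fin 4, i ≠ j →
          fderiv ℝ (fun x : X => ‖x‖) (p i - p j) (u i - u j) = 0) →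
        ∃ c : X, ∀ i, u i = c := by
  have : FiniteDimensional ℝ X := Module.finite_of_finrank_pos (by omega)
  obtain ⟨a, b, P, Q, ha, hrep, hPQ, hA, hB⟩ :=
    exists_coordinates_of_not_strictlyConvex hdim hnsc
  have hcone : ∀ v, 0 < P v → 0 < Q v → HasFDerivAt (fun x : X => ‖x‖) (P + Q) v := by
    intro v hP hQ
    refine (P + Q).hasFDerivAt.congr_of_eventuallyEq ?_
    filter_upwards [P.continuous.continuousAt.eventually_const_lt hP,
      Q.continuous.continuousAt.eventually_const_lt hQ] with x hx hy
    simpa using hA x hx.le hy.le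
  have hbox : ∀ x y : ℝ, ∃ v, DifferentiableAt ℝ (fun x : X => ‖x‖) v ∧
      |P v - x| < 1 / 10 ∧ |Q v - y| < 1 / 10 := by
    intro x y
    have hopen : IsOpen {v | |P v - x| < 1 / 10 ∧ |Q v - y| < 1 / 10} :=
      .and (isOpen_lt (by fun_prop) continuous_const) (isOpen_lt (by fun_prop) continuous_const)
    obtain ⟨v, hv, hv'⟩ := (dense_differentiableAt_norm (E := X)).inter_open_nonempty _ hopen
      ⟨x • a + y • b, by simp only [Set.mem_ofPred_eq, hPQ, sub_self, abs_zero]; norm_num⟩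
    exact ⟨v, hv', hv⟩
  obtain ⟨w, hwd, hwP, hwQ⟩ := hbox (-2) 1
  obtain ⟨z, hzd, hzP, hzQ⟩ := hbox (-1) 3
  rw [abs_lt] at hwP hwQ hzP hzQ
  have hinj : ∀ w, P w < 0 → 0 < Q w → DifferentiableAt ℝ (fun x : X => ‖x‖) w →
      ∀ v, P v + Q v = 0 → fderiv ℝ (fun x : X => ‖x‖) w v = 0 → v = 0 := by
    intro w hP hQ hd v hv h0
    have hne := fderiv_norm_sub_ne_zero ha (hrep w)
      (hB w (mul_neg_of_neg_of_pos hP hQ)) hd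
    have hv' : v = Q v • (b - a) := by
      conv_lhs => rw [hrep v, show P v = -Q v by linarith]
      module
    rw [hv', map_smul, smul_eq_mul] at h0
    rw [hv', (mul_eq_zero.1 h0).resolve_right hne, zero_smul]
  have hv₁ := hcone (z - w) (by rw [map_sub]; linarith) (by rw [map_sub]; linarith)
  have hv₂ := hcone (z - w - w) (by simp only [map_sub]; linarith)
    (by simp only [map_sub]; linarith)
  refine ⟨![0, z - w, w, z], ?_, ?_⟩
  · have hsymm : ∀ x y : X, DifferentiableAt ℝ (fun x : X => ‖x‖) (x - y) →
        DifferentiableAt ℝ (fun x : X => ‖x‖) (y - x) := fun x y h => by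
      simpa using (differentiableAt_norm_smul (t := -1) (by norm_num)).1 h
    have h10 : DifferentiableAt ℝ (fun x : X => ‖x‖) (z - w - 0) := by
      simpa using hv₁.differentiableAt
    have h20 : DifferentiableAt ℝ (fun x : X => ‖x‖) (w - 0) := by simpa using hwd
    have h30 : DifferentiableAt ℝ (fun x : X => ‖x‖) (z - 0) := by simpa using hzd
    have h12 := hv₂.differentiableAt
    have h31 : DifferentiableAt ℝ (fun x : X => ‖x‖) (z - (z - w)) := by simpa using hwd
    have h32 := hv₁.differentiableAt
    intro i j hij
    fin_cases i <;> fin_cases j <;>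
      first
      | exact absurd rfl hij
      | assumption
      | (apply hsymm; assumption)
  · intro u hu
    have h10 := hu 1 0 (by decide)
    have h20 := hu 2 0 (by decide)
    have h30 := hu 3 0 (by decide)
    have h12 := hu 1 2 (by decide)
    have h31 := hu 3 1 (by decide)
    have h32 := hu 3 2 (by decide)
    simp only [Matrix.cons_val, sub_zero, sub_sub_cancel] at h10 h20 h30 h12 h31 h32
    rw [hv₁.fderiv] at h10 h32
    rw [hv₂.fderiv] at h12
    simp only [add_apply, map_sub] at h10 h12 h32
    have e20 := hinj w (by linarith) (by linarith) hwd (u 2 - u 0)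
      (by simp only [map_sub]; linarith) h20
    have e31 := hinj w (by linarith) (by linarith) hwd (u 3 - u 1)
      (by simp only [map_sub]; linarith) h31
    have e30 := hinj z (by linarith) (by linarith) hzd (u 3 - u 0)
      (by simp only [map_sub]; linarith) h30
    rw [sub_eq_zero] at e20 e31 e30
    refine ⟨u 0, fun i => ?_⟩
    fin_cases i
    · rfl
    · exact e31.symm.trans e30
    · exact e20
    · exact e30
end

section
/- Let X be a two-dimensional real normed space that is strictly convex and whose norm fails to be Fréchet differentiable at some nonzero point. Then K₄ is rigid in X: there exists a placement p : {1,2,3,4} → X with the norm differentiable at p_i − p_j for all i ≠ j, such that every u : {1,2,3,4} → X satisfying D(p_i − p_j)(u_i − u_j) = 0 for all i ≠ j is a constant map. -/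
open MeasureTheory Filter Topology

section SupportFunctionals

variable {X : Type*} [NormedAddCommGroup X] [NormedSpace ℝ X]

/-- `f` is a support functional of the norm at `x`. -/
def IsSupportFunctional (f : X →L[ℝ] ℝ) (x : X) : Prop :=
  ‖f‖ ≤ 1 ∧ f x = ‖x‖

theorem IsSupportFunctional.le_norm {f : X →L[ℝ] ℝ} {x : X} (hf : IsSupportFunctional f x)
    (y : X) : f y ≤ ‖y‖ :=
  (le_abs_self _).trans (by simpa using f.le_of_opNorm_le hf.1 y)

theorem isSupportFunctional_fderiv {x : X}
    (hx : DifferentiableAt ℝ (fun x : X => ‖x‖) x) :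
    IsSupportFunctional (fderiv ℝ (fun x : X => ‖x‖) x) x := by
  refine ⟨norm_fderiv_le_of_lip' ℝ zero_le_one (Eventually.of_forall fun y => ?_),
    hx.fderiv_norm_self⟩
  simpa using abs_norm_sub_norm_le y x

theorem IsSupportFunctional.eq_fderiv {f : X →L[ℝ] ℝ} {x : X} (hf : IsSupportFunctional f x)
    (hx : DifferentiableAt ℝ (fun x : X => ‖x‖) x) :
    f = fderiv ℝ (fun x : X => ‖x‖) x := by
  have hmin : IsLocalMin (fun y : X => ‖y‖ - f y) x :=
    Eventually.of_forall fun y => by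
      have h := hf.le_norm y
      simp only [hf.2]
      linarith
  exact (sub_eq_zero.1 (hmin.hasFDerivAt_eq_zero (hx.hasFDerivAt.sub f.hasFDerivAt))).symm

theorem IsSupportFunctional.of_tendsto {ι : Type*} {l : Filter ι} [l.NeBot]
    {f : ι → X →L[ℝ] ℝ} {x : ι → X} {φ : X →L[ℝ] ℝ} {y : X}
    (hf : Tendsto f l (𝓝 φ)) (hx : Tendsto x l (𝓝 y))
    (h : ∀ᶠ i in l, IsSupportFunctional (f i) (x i)) : IsSupportFunctional φ y := by
  refine ⟨le_of_tendsto hf.norm (h.mono fun i hi => hi.1), ?_⟩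
  have hfx : Tendsto (fun i => f i (x i)) l (𝓝 (φ y)) :=
    (isBoundedBilinearMap_apply.continuous.tendsto (φ, y)).comp (hf.prodMk_nhds hx)
  exact tendsto_nhds_unique hfx (hx.norm.congr' (h.mono fun i hi => hi.2.symm))

/-- Along any ultrafilter the derivatives of the norm converge, to a support functional. -/
theorem exists_tendsto_fderiv_norm [FiniteDimensional ℝ X] {ι : Type*} (U : Ultrafilter ι)
    {x : ι → X} {y : X} (hx : Tendsto x U (𝓝 y))
    (hd : ∀ᶠ i in U, DifferentiableAt ℝ (fun x : X => ‖x‖) (x i)) :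
    ∃ φ, Tendsto (fun i => fderiv ℝ (fun x : X => ‖x‖) (x i)) U (𝓝 φ) ∧
      IsSupportFunctional φ y := by
  have hs := hd.mono fun i hi => isSupportFunctional_fderiv hi
  obtain ⟨φ, -, hφ⟩ := (isCompact_closedBall (0 : X →L[ℝ] ℝ) 1).ultrafilter_le_nhds
    (U.map fun i => fderiv ℝ (fun x : X => ‖x‖) (x i)) (by
      rw [le_principal_iff]
      exact hs.mono fun i hi => by simpa using hi.1)
  exact ⟨φ, hφ, .of_tendsto (f := fun i => fderiv ℝ (fun x : X => ‖x‖) (x i)) hφ hx hs⟩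

theorem tendsto_fderiv_norm [FiniteDimensional ℝ X] {ι : Type*} (U : Ultrafilter ι)
    {x : ι → X} {y : X} (hx : Tendsto x U (𝓝 y))
    (hd : ∀ᶠ i in U, DifferentiableAt ℝ (fun x : X => ‖x‖) (x i))
    (hy : DifferentiableAt ℝ (fun x : X => ‖x‖) y) :
    Tendsto (fun i => fderiv ℝ (fun x : X => ‖x‖) (x i)) U
      (𝓝 (fderiv ℝ (fun x : X => ‖x‖) y)) := by
  obtain ⟨φ, hφ, hs⟩ := exists_tendsto_fderiv_norm U hx hd
  rwa [← hs.eq_fderiv hy]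

theorem hasFDerivAt_norm_of_tendsto {T : Set X} (hT : Dense T)
    (hd : ∀ x ∈ T, DifferentiableAt ℝ (fun x : X => ‖x‖) x) {z : X} {φ : X →L[ℝ] ℝ}
    (hφ : Tendsto (fun x => fderiv ℝ (fun x : X => ‖x‖) x) (𝓝[T] z) (𝓝 φ)) :
    HasFDerivAt (fun x : X => ‖x‖) φ z := by
  have : (𝓝[T] z).NeBot := mem_closure_iff_nhdsWithin_neBot.1 (hT z)
  have hs : IsSupportFunctional φ z := .of_tendsto hφ (tendsto_id.mono_left nhdsWithin_le_nhds)
    (eventually_nhdsWithin_of_forall fun x hx => isSupportFunctional_fderiv (hd x hx))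
  rw [hasFDerivAt_iff_isLittleO, Asymptotics.isLittleO_iff]
  intro ε hε
  have h1 : ∀ᶠ x in 𝓝[T] z, dist (fderiv ℝ (fun x : X => ‖x‖) x) φ < ε :=
    (Metric.tendsto_nhds.1 hφ) ε hε
  rw [eventually_nhdsWithin_iff, Metric.eventually_nhds_iff_ball] at h1
  obtain ⟨δ, hδ, h1⟩ := h1
  have hclosed : IsClosed {x : X | ‖‖x‖ - ‖z‖ - φ (x - z)‖ ≤ ε * ‖x - z‖} :=
    isClosed_le (by fun_prop) (by fun_prop)
  have hsub : Metric.ball z δ ∩ T ⊆ {x : X | ‖‖x‖ - ‖z‖ - φ (x - z)‖ ≤ ε * ‖x - z‖} := by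
    rintro x ⟨hxb, hxT⟩
    have h2 := isSupportFunctional_fderiv (hd x hxT)
    have h3 := h1 x hxb hxT
    rw [dist_eq_norm] at h3
    have h4 := (le_abs_self _).trans
      ((fderiv ℝ (fun x : X => ‖x‖) x - φ).le_of_opNorm_le h3.le (x - z))
    simp only [sub_apply, map_sub, h2.2, hs.2] at h4
    have h5 := h2.le_norm z
    have h6 := hs.le_norm x
    simp only [Set.mem_ofPred_eq, map_sub, hs.2, Real.norm_eq_abs]
    rw [abs_of_nonneg] <;> linarith
  filter_upwards [Metric.ball_mem_nhds z hδ] with x hx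
  exact hclosed.closure_subset_iff.2 hsub (hT.open_subset_closure_inter Metric.isOpen_ball hx)

/-- At a point where the norm is not differentiable, its derivatives have two limits. -/
theorem exists_tendsto_fderiv_norm_ne [FiniteDimensional ℝ X] {T : Set X} (hT : Dense T)
    (hd : ∀ x ∈ T, DifferentiableAt ℝ (fun x : X => ‖x‖) x) {z : X}
    (hz : ¬ DifferentiableAt ℝ (fun x : X => ‖x‖) z) (φ : X →L[ℝ] ℝ) :
    ∃ (U : Ultrafilter X) (ψ : X →L[ℝ] ℝ), ↑U ≤ 𝓝[T] z ∧ ψ ≠ φ ∧ IsSupportFunctional ψ z ∧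
      Tendsto (fun x => fderiv ℝ (fun x : X => ‖x‖) x) U (𝓝 ψ) := by
  have h := mt (fun h => (hasFDerivAt_norm_of_tendsto hT hd (φ := φ) h).differentiableAt) hz
  rw [tendsto_iff_ultrafilter] at h
  push Not at h
  obtain ⟨U, hU, hn⟩ := h
  obtain ⟨ψ, hψ, hs⟩ := exists_tendsto_fderiv_norm U (x := id) (y := z)
    (hU.trans nhdsWithin_le_nhds) (hU (eventually_nhdsWithin_of_forall hd))
  exact ⟨U, ψ, hU, by rintro rfl; exact hn hψ, hs, hψ⟩

end SupportFunctionals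

section Plane

variable {X : Type*} [NormedAddCommGroup X] [NormedSpace ℝ X]

theorem exists_smul_eq_of_apply_eq_zero (hdim : Module.finrank ℝ X = 2) {f : X →L[ℝ] ℝ} {x : X}
    (hx : f x ≠ 0) {v w : X} (hv0 : v ≠ 0) (hv : f v = 0) (hw : f w = 0) :
    ∃ c : ℝ, c • v = w := by
  have : FiniteDimensional ℝ X := .of_finrank_pos (by omega)
  have hf : (f : Module.Dual ℝ X) ≠ 0 := fun h => hx (LinearMap.congr_fun h x)
  have h1 := Module.Dual.finrank_ker_add_one_of_ne_zero hf
  obtain ⟨c, hc⟩ := (finrank_eq_one_iff_of_nonzero' (K := ℝ)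
    (⟨v, hv⟩ : LinearMap.ker (f : X →ₗ[ℝ] ℝ))
    fun h => hv0 (congrArg Subtype.val h)).1 (by omega) ⟨w, hw⟩
  exact ⟨c, congrArg Subtype.val hc⟩

theorem linearIndependent_of_notMem_span {x y : X} (hx : x ≠ 0) (hy : y ∉ Submodule.span ℝ {x}) :
    LinearIndependent ℝ ![x, y] := by
  rw [LinearIndependent.pair_iff' hx]
  exact fun a h => hy (Submodule.mem_span_singleton.2 ⟨a, h⟩)

theorem eq_zero_of_isSupportFunctional (hdim : Module.finrank ℝ X = 2)
    (hsc : ∀ x y : X, x ≠ y → ‖x‖ = 1 → ‖y‖ = 1 →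
      ∀ t : ℝ, 0 < t → t < 1 → ‖t • x + (1 - t) • y‖ < 1)
    {f g : X →L[ℝ] ℝ} {x y : X} (hf : IsSupportFunctional f x) (hg : IsSupportFunctional g y)
    (hxy : LinearIndependent ℝ ![x, y]) {v : X} (hfv : f v = 0) (hgv : g v = 0) : v = 0 := by
  by_contra hv
  have hx : 0 < ‖x‖ := norm_pos_iff.2 (hxy.ne_zero 0)
  have hy : 0 < ‖y‖ := norm_pos_iff.2 (hxy.ne_zero 1)
  have hfx : f x ≠ 0 := by rw [hf.2]; exact hx.ne'
  set a : ℝ := f y / ‖x‖ with ha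
  have hfy : f y = a * ‖x‖ := by rw [ha]; field_simp
  obtain ⟨b, hb⟩ := exists_smul_eq_of_apply_eq_zero hdim hfx hv hfv (w := y - a • x)
    (by simp [hf.2, hfy])
  have hgy : ‖y‖ = a * g x := by
    have := congrArg g hb
    simp only [map_smul, hgv, map_sub, hg.2, smul_eq_mul] at this
    linarith
  have h1 : |a| * ‖x‖ ≤ ‖y‖ := by
    have := f.le_of_opNorm_le hf.1 y
    rwa [hfy, Real.norm_eq_abs, abs_mul, abs_norm, one_mul] at this
  have h2 : ‖y‖ ≤ |a| * ‖x‖ := by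
    have := g.le_of_opNorm_le hg.1 x
    rw [Real.norm_eq_abs, one_mul] at this
    calc ‖y‖ ≤ |a * g x| := hgy ▸ le_abs_self _
      _ = |a| * |g x| := abs_mul _ _
      _ ≤ _ := by gcongr
  have ha0 : a ≠ 0 := by rintro h; rw [h] at hgy; linarith
  have hne : ‖x‖⁻¹ • x ≠ (a * ‖x‖)⁻¹ • y := by
    intro h
    have := (LinearIndependent.pair_iff.1 hxy (‖x‖⁻¹) (-(a * ‖x‖)⁻¹) (by rw [h]; module)).1
    exact hx.ne' (inv_eq_zero.1 this)
  have hlt := hsc _ _ hne (by rw [norm_smul, norm_inv, norm_norm]; field_simp)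
    (by
      rw [norm_smul, norm_inv, norm_mul, norm_norm, Real.norm_eq_abs, ← le_antisymm h2 h1]
      field_simp) (1 / 2) (by norm_num) (by norm_num)
  have hle := hf.le_norm ((1 / 2 : ℝ) • ‖x‖⁻¹ • x + (1 - 1 / 2 : ℝ) • (a * ‖x‖)⁻¹ • y)
  simp only [map_add, map_smul, smul_eq_mul, hf.2, hfy] at hle
  rw [inv_mul_cancel₀ hx.ne', inv_mul_cancel₀ (mul_ne_zero ha0 hx.ne')] at hle
  linarith

end Plane

section Rigidity

variable {X : Type*} [NormedAddCommGroup X] [NormedSpace ℝ X]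

/-- The only flex of `K₄` fixing its second vertex is zero, for edge functionals `a` (on the
edge 12), `b` (13), `c` (14), `d` (23), `e` (24) and `f` (34). -/
def OnlyZeroFlex (a b c d e f : X →L[ℝ] ℝ) : Prop :=
  ∀ u v w : X, a u = 0 → b (u - v) = 0 → c (u - w) = 0 → d v = 0 → e w = 0 → f (v - w) = 0 →
    u = 0 ∧ v = 0 ∧ w = 0

theorem eventually_onlyZeroFlex [FiniteDimensional ℝ X] {ι : Type*} {l : Filter ι}
    {A B C : ι → X →L[ℝ] ℝ} {a b c : X →L[ℝ] ℝ} (d e f : X →L[ℝ] ℝ)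
    (hA : Tendsto A l (𝓝 a)) (hB : Tendsto B l (𝓝 b)) (hC : Tendsto C l (𝓝 c))
    (h : OnlyZeroFlex a b c d e f) : ∀ᶠ i in l, OnlyZeroFlex (A i) (B i) (C i) d e f := by
  let p₁ : X × X × X →L[ℝ] X := .fst ℝ X (X × X)
  let p₂ : X × X × X →L[ℝ] X := (ContinuousLinearMap.fst ℝ X X).comp (.snd ℝ X (X × X))
  let p₃ : X × X × X →L[ℝ] X := (ContinuousLinearMap.snd ℝ X X).comp (.snd ℝ X (X × X))
  let F : (X →L[ℝ] ℝ) × (X →L[ℝ] ℝ) × (X →L[ℝ] ℝ) → X × X × X →L[ℝ] ℝ × ℝ × ℝ × ℝ × ℝ × ℝ :=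
    fun q => (q.1.comp p₁).prod ((q.2.1.comp (p₁ - p₂)).prod ((q.2.2.comp (p₁ - p₃)).prod
      ((d.comp p₂).prod ((e.comp p₃).prod (f.comp (p₂ - p₃))))))
  have hF : ∀ q, Function.Injective (F q) ↔ OnlyZeroFlex q.1 q.2.1 q.2.2 d e f := by
    intro q
    rw [injective_iff_map_eq_zero]
    simp [F, p₁, p₂, p₃, OnlyZeroFlex]
  have hcont : Continuous F := by
    rw [continuous_clm_apply]
    intro y
    simp only [F, ContinuousLinearMap.prod_apply, ContinuousLinearMap.comp_apply]
    fun_prop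
  have ho : IsOpen {q | Function.Injective (F q)} :=
    ContinuousLinearMap.isOpen_injective.preimage hcont
  have ht := hA.prodMk_nhds (hB.prodMk_nhds hC)
  filter_upwards [ht (ho.mem_nhds ((hF (a, b, c)).2 h))] with i hi
  exact (hF _).1 hi

/-- The graph `K₄` minus an edge has a one-dimensional space of flexes, so at most one functional
on the missing edge, up to scaling, can fail to make `K₄` rigid. -/
theorem onlyZeroFlex_or (hdim : Module.finrank ℝ X = 2)
    {a a' b c d e f : X →L[ℝ] ℝ} {z x : X} (haa' : a ≠ a') (hz : z ≠ 0) (haz : a z = ‖z‖)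
    (haz' : a' z = ‖z‖) (hf : f x ≠ 0)
    (hbc : ∀ v, b v = 0 → c v = 0 → v = 0) (hbd : ∀ v, b v = 0 → d v = 0 → v = 0)
    (hce : ∀ v, c v = 0 → e v = 0 → v = 0) (hde : ∀ v, d v = 0 → e v = 0 → v = 0) :
    OnlyZeroFlex a b c d e f ∨ OnlyZeroFlex a' b c d e f := by
  have key : ∀ u v : X, b (u - v) = 0 → c (u - v) = 0 → d v = 0 → e v = 0 →
      u = 0 ∧ v = 0 := by
    intro u v h1 h2 h3 h4
    have h5 := hbc _ h1 h2
    have h6 := hde _ h3 h4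
    exact ⟨by rw [← sub_add_cancel u v, h5, h6, add_zero], h6⟩
  by_contra! hcon
  obtain ⟨h, h'⟩ := hcon
  unfold OnlyZeroFlex at h h'
  push Not at h h'
  obtain ⟨u, v, w, h1, h2, h3, h4, h5, h6, h7⟩ := h
  obtain ⟨u', v', w', h1', h2', h3', h4', h5', h6', h7'⟩ := h'
  have hvw : v - w ≠ 0 := by
    intro h
    obtain rfl := sub_eq_zero.1 h
    obtain ⟨hu, hv⟩ := key u v h2 h3 h4 h5
    exact h7 hu hv hv
  obtain ⟨t, ht⟩ := exists_smul_eq_of_apply_eq_zero hdim hf hvw h6 h6'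
  have hw : w' - t • w = v' - t • v := by
    have : w' = v' - t • (v - w) := by rw [ht]; abel
    rw [this]; module
  have hb : b ((u' - t • u) - (v' - t • v)) = 0 := by
    simp only [map_sub, map_smul, smul_eq_mul] at h2 h2' ⊢
    linear_combination h2' - t * h2
  have hc : c ((u' - t • u) - (v' - t • v)) = 0 := by
    rw [← hw]
    simp only [map_sub, map_smul, smul_eq_mul] at h3 h3' ⊢
    linear_combination h3' - t * h3
  obtain ⟨hu0, hv0⟩ := key _ _ hb hc (by simp [h4, h4']) (by rw [← hw]; simp [h5, h5'])
  have hw0 := hw.trans hv0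
  rw [sub_eq_zero] at hu0 hv0 hw0
  have ht0 : t ≠ 0 := by
    rintro rfl
    exact h7' (by simpa using hu0) (by simpa using hv0) (by simpa using hw0)
  have hu' : a' u = 0 := by
    rw [hu0, map_smul, smul_eq_mul] at h1'
    exact (mul_eq_zero.1 h1').resolve_left ht0
  obtain ⟨y, hy⟩ : ∃ y, (a - a') y ≠ 0 := by
    by_contra! h
    exact haa' (sub_eq_zero.1 (ContinuousLinearMap.ext h))
  obtain ⟨s, hs⟩ := exists_smul_eq_of_apply_eq_zero hdim hy hz (by simp [haz, haz'])
    (w := u) (by simp [h1, hu'])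
  have hu : u = 0 := by
    rw [← hs, map_smul, haz, smul_eq_mul, mul_eq_zero] at h1
    rw [← hs, h1.resolve_right (norm_ne_zero_iff.2 hz), zero_smul]
  subst hu
  have hv : v = 0 := hbd v (by simpa using h2) h4
  have hw : w = 0 := hce w (by simpa using h3) h5
  exact h7 rfl hv hw

end Rigidity

section GeneralPosition

variable {X : Type*} [NormedAddCommGroup X] [NormedSpace ℝ X] [FiniteDimensional ℝ X]
  [MeasurableSpace X] [BorelSpace X] (μ : Measure X) [μ.IsAddHaarMeasure]

theorem ae_differentiableAt_norm_sub (a : X) :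
    ∀ᵐ x ∂μ, DifferentiableAt ℝ (fun x : X => ‖x‖) (x - a) :=
  (measurePreserving_sub_right μ a).quasiMeasurePreserving.ae
    (lipschitzWith_one_norm.ae_differentiableAt (μ := μ))

theorem ae_sub_notMem_span_singleton (hdim : Module.finrank ℝ X = 2) (a b : X) :
    ∀ᵐ x ∂μ, x - a ∉ Submodule.span ℝ {b} := by
  refine (measurePreserving_sub_right μ a).quasiMeasurePreserving.ae
    (p := fun x => x ∉ Submodule.span ℝ {b}) ?_
  refine measure_eq_zero_iff_ae_notMem.1 (Measure.addHaar_submodule μ _ fun h => ?_)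
  have h1 := finrank_span_finset_le_card (R := ℝ) {b}
  rw [Finset.coe_singleton, Set.finrank, h, finrank_top, hdim, Finset.card_singleton] at h1
  omega

end GeneralPosition

/-- `K₄` is rigid in every strictly convex normed plane whose
norm fails to be Fréchet differentiable at some nonzero point. -/
theorem K4_rigid_of_strictlyConvex_not_smooth
    (X : Type*) [NormedAddCommGroup X] [NormedSpace ℝ X]
    (hdim : Module.finrank ℝ X = 2)
    (hsc : ∀ x y : X, x ≠ y → ‖x‖ = 1 → ‖y‖ = 1 →
      ∀ t : ℝ, 0 < t → t < 1 → ‖t • x + (1 - t) • y‖ < 1)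
    (hns : ∃ z : X, z ≠ 0 ∧ ¬ DifferentiableAt ℝ (fun x : X => ‖x‖) z) :
    ∃ p : Fin 4 → X,
      (∀ i j : Fin 4, i ≠ j → DifferentiableAt ℝ (fun x : X => ‖x‖) (p i - p j)) ∧
      ∀ u : Fin 4 → X,
        (∀ i j : Fin 4, i ≠ j →
          fderiv ℝ (fun x : X => ‖x‖) (p i - p j) (u i - u j) = 0) →
        ∃ c : X, ∀ i, u i = c := by
  have : FiniteDimensional ℝ X := .of_finrank_pos (by omega)
  borelize X
  let μ : Measure X := Measure.addHaar
  obtain ⟨z, hz0, hz⟩ := hns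
  have hneg : ∀ {x y : X}, DifferentiableAt ℝ (fun x : X => ‖x‖) (x - y) →
      DifferentiableAt ℝ (fun x : X => ‖x‖) (y - x) := by
    intro x y h
    have h1 : DifferentiableAt ℝ (fun v : X => ‖-v‖) (y - x) :=
      DifferentiableAt.comp (y - x) (g := fun x : X => ‖x‖) (f := fun v : X => -v)
        (by simpa using h) differentiableAt_id.neg
    simpa using h1
  obtain ⟨q, hq0, hqz, hqs⟩ := ((ae_differentiableAt_norm_sub μ 0).and
    ((ae_differentiableAt_norm_sub μ z).and
      (ae_sub_notMem_span_singleton μ hdim 0 z))).exists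
  obtain ⟨r, hr0, hrz, hrq, hrs, hrs', hrs''⟩ := ((ae_differentiableAt_norm_sub μ 0).and
    ((ae_differentiableAt_norm_sub μ z).and ((ae_differentiableAt_norm_sub μ q).and
      ((ae_sub_notMem_span_singleton μ hdim 0 z).and
        ((ae_sub_notMem_span_singleton μ hdim 0 q).and
          (ae_sub_notMem_span_singleton μ hdim z (q - z))))))).exists
  rw [sub_zero] at hq0 hqs hr0 hrs hrs'
  let T : Set X := {x | DifferentiableAt ℝ (fun x : X => ‖x‖) x ∧
    DifferentiableAt ℝ (fun x : X => ‖x‖) (x - q) ∧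
    DifferentiableAt ℝ (fun x : X => ‖x‖) (x - r)}
  have hT : Dense T :=
    Measure.dense_of_ae (μ := μ) (by
      filter_upwards [ae_differentiableAt_norm_sub μ 0, ae_differentiableAt_norm_sub μ q,
        ae_differentiableAt_norm_sub μ r] with x h1 h2 h3
      exact ⟨by simpa using h1, h2, h3⟩)
  have hzq : LinearIndependent ℝ ![z, q] := linearIndependent_of_notMem_span hz0 hqs
  have hzr : LinearIndependent ℝ ![z, r] := linearIndependent_of_notMem_span hz0 hrs
  have hqr : LinearIndependent ℝ ![q, r] :=
    linearIndependent_of_notMem_span (hzq.ne_zero 1) hrs'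
  have hqzrz : LinearIndependent ℝ ![z - q, z - r] := by
    have h := linearIndependent_of_notMem_span (x := q - z) (y := r - z) (by
      intro h
      rw [sub_eq_zero.1 h] at hqs
      exact hqs (Submodule.mem_span_singleton_self z)) hrs''
    rw [LinearIndependent.pair_iff] at h ⊢
    intro s t hst
    refine h s t ?_
    rw [← neg_eq_zero, ← hst]
    module
  have hshift : ∀ {y : X}, LinearIndependent ℝ ![z, y] → LinearIndependent ℝ ![z - y, y] := by
    intro y h
    rw [LinearIndependent.pair_iff] at h ⊢
    intro s t hst
    obtain ⟨hs, ht⟩ := h s (t - s) (by rw [← hst]; module)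
    exact ⟨hs, by linarith⟩
  obtain ⟨U, φ, hU, -, hφs, hφ⟩ := exists_tendsto_fderiv_norm_ne hT (fun x hx => hx.1) hz 0
  obtain ⟨V, ψ, hV, hψφ, hψs, hψ⟩ := exists_tendsto_fderiv_norm_ne hT (fun x hx => hx.1) hz φ
  have hqr0 : q - r ≠ 0 := by
    intro h
    rw [sub_eq_zero.1 h] at hrs'
    exact hrs' (Submodule.mem_span_singleton_self r)
  have hb := isSupportFunctional_fderiv (hneg hqz)
  have hc := isSupportFunctional_fderiv (hneg hrz)
  have hd := isSupportFunctional_fderiv hq0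
  have he := isSupportFunctional_fderiv hr0
  have hf := isSupportFunctional_fderiv (hneg hrq)
  have hor := onlyZeroFlex_or hdim hψφ hz0 hψs.2 hφs.2 (x := q - r)
    (by rw [hf.2]; exact norm_ne_zero_iff.2 hqr0)
    (fun v => eq_zero_of_isSupportFunctional hdim hsc hb hc hqzrz)
    (fun v => eq_zero_of_isSupportFunctional hdim hsc hb hd (hshift hzq))
    (fun v => eq_zero_of_isSupportFunctional hdim hsc hc he (hshift hzr))
    (fun v => eq_zero_of_isSupportFunctional hdim hsc hd he hqr)
  have hexists : ∀ (W : Ultrafilter X) (χ : X →L[ℝ] ℝ), ↑W ≤ 𝓝[T] z →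
      Tendsto (fun x => fderiv ℝ (fun x : X => ‖x‖) x) W (𝓝 χ) →
      OnlyZeroFlex χ (fderiv ℝ (fun x : X => ‖x‖) (z - q)) (fderiv ℝ (fun x : X => ‖x‖) (z - r))
        (fderiv ℝ (fun x : X => ‖x‖) q) (fderiv ℝ (fun x : X => ‖x‖) r)
        (fderiv ℝ (fun x : X => ‖x‖) (q - r)) →
      ∃ x ∈ T, OnlyZeroFlex (fderiv ℝ (fun x : X => ‖x‖) x)
        (fderiv ℝ (fun x : X => ‖x‖) (x - q)) (fderiv ℝ (fun x : X => ‖x‖) (x - r))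
        (fderiv ℝ (fun x : X => ‖x‖) q) (fderiv ℝ (fun x : X => ‖x‖) r)
        (fderiv ℝ (fun x : X => ‖x‖) (q - r)) := by
    intro W χ hW hχ h
    have hWT : ∀ᶠ x in W, x ∈ T := hW self_mem_nhdsWithin
    have hid : Tendsto (fun x : X => x) W (𝓝 z) := hW.trans nhdsWithin_le_nhds
    exact (hWT.and (eventually_onlyZeroFlex _ _ _ hχ
      (tendsto_fderiv_norm W (hid.sub_const q) (hWT.mono fun x hx => hx.2.1) (hneg hqz))
      (tendsto_fderiv_norm W (hid.sub_const r) (hWT.mono fun x hx => hx.2.2) (hneg hrz))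
      h)).exists
  obtain ⟨x, ⟨hx, hxq, hxr⟩, hflex⟩ := hor.elim (hexists V ψ hV hψ) (hexists U φ hU hφ)
  refine ⟨![x, 0, q, r], ?_, fun u hu => ⟨u 1, ?_⟩⟩
  · have hx' := hneg (x := x) (y := 0) (by simpa using hx)
    have hq' := hneg (x := q) (y := 0) (by simpa using hq0)
    have hr' := hneg (x := r) (y := 0) (by simpa using hr0)
    intro i j hij
    fin_cases i <;> fin_cases j <;> first
      | exact absurd rfl hij
      | simpa using hx
      | simpa using hq0
      | simpa using hr0
      | simpa using hx'
      | simpa using hq'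
      | simpa using hr'
      | exact hxq
      | exact hxr
      | exact hneg hxq
      | exact hneg hxr
      | exact hrq
      | exact hneg hrq
  · obtain ⟨h0, h2, h3⟩ := hflex (u 0 - u 1) (u 2 - u 1) (u 3 - u 1)
      (by simpa using hu 0 1 (by decide)) (by simpa using hu 0 2 (by decide))
      (by simpa using hu 0 3 (by decide)) (by simpa using hu 2 1 (by decide))
      (by simpa using hu 3 1 (by decide)) (by simpa using hu 2 3 (by decide))
    intro i
    fin_cases i
    · exact sub_eq_zero.1 h0
    · rfl
    · exact sub_eq_zero.1 h2
    · exact sub_eq_zero.1 h3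
end
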